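/- Suppose x ∈ X with cap₁({x}) > 0, suppose A ⊂ X is 1-thin at x, and let 0 < R < (1/8) diam X. Then there exists a 1-superminimizer u in B(x,R) such that lim_{A∋y→x} u^∧(y) = ∞ while u^∨(x) < ∞. (Strong Cartan property at points of nonzero 1-capacity.) -/

import Mathlib

open MeasureTheory Metric Filter Set
open scoped ENNReal NNReal Topology

noncomputable section

namespace MetricBV

variable {X : Type*} [MetricSpace X] [MeasurableSpace X]

/-- A rectifiable curve, encoded as a Lipschitz map on the interval `[0,1]`
(every rectifiable curve admits such a reparametrization). -/
structure Curve (X : Type*) [MetricSpace X] where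
  toFun : ℝ → X
  lipschitz : ∃ K : ℝ≥0, LipschitzOnWith K toFun (Set.Icc 0 1)

/-- The metric speed of a curve at a point. -/
def speed (γ : ℝ → X) (t : ℝ) : ℝ≥0∞ :=
  Filter.limsup (fun h : ℝ => ENNReal.ofReal (dist (γ (t + h)) (γ t) / |h|)) (𝓝[≠] (0 : ℝ))

/-- The curve integral `∫_γ g ds`. -/
def curveIntegral (g : X → ℝ≥0∞) (γ : Curve X) : ℝ≥0∞ :=
  ∫⁻ t in Set.Icc (0 : ℝ) 1, g (γ.toFun t) * speed γ.toFun t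

/-- A curve lies in a set `Ω`. -/
def Curve.In (γ : Curve X) (Ω : Set X) : Prop :=
  ∀ t ∈ Set.Icc (0 : ℝ) 1, γ.toFun t ∈ Ω

/-- The 1-modulus of a family of curves. -/
def Mod1 (μ : Measure X) (Γ : Set (Curve X)) : ℝ≥0∞ :=
  ⨅ (ρ : X → ℝ≥0∞) (_ : Measurable ρ) (_ : ∀ γ ∈ Γ, 1 ≤ curveIntegral ρ γ),
    ∫⁻ x, ρ x ∂μ

/-- `g` is an upper gradient of `u` in `Ω`: the upper gradient inequality holds
along every curve contained in `Ω`. -/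
def IsUpperGradientOn (g : X → ℝ≥0∞) (u : X → ℝ) (Ω : Set X) : Prop :=
  ∀ γ : Curve X, γ.In Ω →
    ENNReal.ofReal |u (γ.toFun 1) - u (γ.toFun 0)| ≤ curveIntegral g γ

/-- `g` is a 1-weak upper gradient of `u` in `Ω`: the upper gradient inequality holds
along every curve in `Ω` outside a family of zero 1-modulus. -/
def IsWeakUpperGradientOn (μ : Measure X) (g : X → ℝ≥0∞) (u : X → ℝ) (Ω : Set X) : Prop :=
  ∃ Γ : Set (Curve X), Mod1 μ Γ = 0 ∧
    ∀ γ : Curve X, γ ∉ Γ → γ.In Ω →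
      ENNReal.ofReal |u (γ.toFun 1) - u (γ.toFun 0)| ≤ curveIntegral g γ

/-- Membership in the Newtonian space `N^{1,1}(X)`. -/
def MemN11 (μ : Measure X) (u : X → ℝ) : Prop :=
  Integrable u μ ∧ ∃ g : X → ℝ≥0∞, Measurable g ∧
    IsWeakUpperGradientOn μ g u Set.univ ∧ ∫⁻ x, g x ∂μ < ⊤

/-- The 1-capacity `cap₁(A) = inf ‖u‖_{N^{1,1}(X)}` over `u ∈ N^{1,1}(X)` with `u ≥ 1` on `A`. -/
def cap1 (μ : Measure X) (A : Set X) : ℝ≥0∞ :=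
  ⨅ (u : X → ℝ) (_ : MemN11 μ u) (_ : ∀ x ∈ A, 1 ≤ u x)
    (g : X → ℝ≥0∞) (_ : Measurable g) (_ : IsWeakUpperGradientOn μ g u Set.univ),
    (∫⁻ x, ENNReal.ofReal |u x| ∂μ + ∫⁻ x, g x ∂μ)

/-- The variational 1-capacity `cap₁(A,Ω) = inf ∫ g_u dμ` over `u ∈ N^{1,1}(X)` with
`u ≥ 1` on `A` and `u = 0` on `X ∖ Ω`. -/
def vcap1 (μ : Measure X) (A Ω : Set X) : ℝ≥0∞ :=
  ⨅ (u : X → ℝ) (_ : MemN11 μ u) (_ : ∀ x ∈ A, 1 ≤ u x) (_ : ∀ x ∈ Ωᶜ, u x = 0)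
    (g : X → ℝ≥0∞) (_ : Measurable g) (_ : IsWeakUpperGradientOn μ g u Set.univ),
    ∫⁻ x, g x ∂μ

/-- Locally Lipschitz in `Ω`: Lipschitz on every compact subset of `Ω`. -/
def LocLipschitzOn (u : X → ℝ) (Ω : Set X) : Prop :=
  ∀ K : Set X, IsCompact K → K ⊆ Ω → ∃ L : ℝ≥0, LipschitzOnWith L u K

/-- Convergence `v i → u` in `L¹_loc(Ω)`. -/
def TendstoL1Loc (μ : Measure X) (v : ℕ → X → ℝ) (u : X → ℝ) (Ω : Set X) : Prop :=
  ∀ K : Set X, IsCompact K → K ⊆ Ω →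
    Filter.Tendsto (fun i => ∫⁻ x in K, ENNReal.ofReal |v i x - u x| ∂μ)
      Filter.atTop (𝓝 0)

/-- The total variation `‖Du‖(Ω)` of `u` in an open set `Ω`: the infimum of
`liminf ∫_Ω g_i dμ` over sequences of locally Lipschitz functions `v i → u` in `L¹_loc(Ω)`
with `g i` a 1-weak upper gradient of `v i` in `Ω`. -/
def tv (μ : Measure X) (u : X → ℝ) (Ω : Set X) : ℝ≥0∞ :=
  ⨅ (v : ℕ → X → ℝ) (_ : ∀ i, LocLipschitzOn (v i) Ω) (_ : TendstoL1Loc μ v u Ω)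
    (g : ℕ → X → ℝ≥0∞) (_ : ∀ i, Measurable (g i))
    (_ : ∀ i, IsWeakUpperGradientOn μ (g i) (v i) Ω),
    Filter.liminf (fun i => ∫⁻ x in Ω, g i x ∂μ) Filter.atTop

/-- The total variation `‖Du‖(A)` for an arbitrary set `A`. -/
def tvs (μ : Measure X) (u : X → ℝ) (A : Set X) : ℝ≥0∞ :=
  ⨅ (U : Set X) (_ : IsOpen U) (_ : A ⊆ U), tv μ u U

/-- The characteristic function of a set, as a real-valued function. -/
def chi (E : Set X) : X → ℝ := Set.indicator E fun _ => (1 : ℝ)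

/-- The perimeter `P(E,Ω) = ‖Dχ_E‖(Ω)` of `E` in an open set `Ω`. -/
def perim (μ : Measure X) (E : Set X) (Ω : Set X) : ℝ≥0∞ := tv μ (chi E) Ω

/-- `u ∈ BV(Ω)`: `u ∈ L¹(Ω)` and `‖Du‖(Ω) < ∞`. -/
def MemBV (μ : Measure X) (u : X → ℝ) (Ω : Set X) : Prop :=
  IntegrableOn u Ω μ ∧ tv μ u Ω < ⊤

/-- `u ∈ BV_loc(Ω)`. -/
def MemBVloc (μ : Measure X) (u : X → ℝ) (Ω : Set X) : Prop :=
  ∀ K : Set X, IsCompact K → K ⊆ Ω → ∃ U : Set X, IsOpen U ∧ K ⊆ U ∧ U ⊆ Ω ∧ MemBV μ u U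

/-- `φ ∈ BV_c(Ω)`: a BV function with compact support in `Ω`. -/
def MemBVc (μ : Measure X) (φ : X → ℝ) (Ω : Set X) : Prop :=
  MemBV μ φ Ω ∧ IsCompact (tsupport φ) ∧ tsupport φ ⊆ Ω

/-- `u` is a 1-minimizer (function of least gradient) in `Ω`. -/
def IsMinimizer (μ : Measure X) (u : X → ℝ) (Ω : Set X) : Prop :=
  MemBVloc μ u Ω ∧ ∀ φ : X → ℝ, MemBVc μ φ Ω →
    tvs μ u (tsupport φ) ≤ tvs μ (fun y => u y + φ y) (tsupport φ)

/-- `u` is a 1-superminimizer in `Ω`. -/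
def IsSuperminimizer (μ : Measure X) (u : X → ℝ) (Ω : Set X) : Prop :=
  MemBVloc μ u Ω ∧ ∀ φ : X → ℝ, MemBVc μ φ Ω → (∀ x, 0 ≤ φ x) →
    tvs μ u (tsupport φ) ≤ tvs μ (fun y => u y + φ y) (tsupport φ)

/-- `u` is a 1-subminimizer in `Ω`. -/
def IsSubminimizer (μ : Measure X) (u : X → ℝ) (Ω : Set X) : Prop :=
  MemBVloc μ u Ω ∧ ∀ φ : X → ℝ, MemBVc μ φ Ω → (∀ x, φ x ≤ 0) →
    tvs μ u (tsupport φ) ≤ tvs μ (fun y => u y + φ y) (tsupport φ)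

/-- The lower approximate limit `u^∧(x)`, with values in `[-∞,∞]`. -/
def lowerApprox (μ : Measure X) (u : X → ℝ) (x : X) : EReal :=
  sSup ((fun t : ℝ => (t : EReal)) '' {t : ℝ | Filter.Tendsto
    (fun r : ℝ => μ ({y | u y < t} ∩ Metric.ball x r) / μ (Metric.ball x r))
    (𝓝[>] (0 : ℝ)) (𝓝 0)})

/-- The upper approximate limit `u^∨(x)`, with values in `[-∞,∞]`. -/
def upperApprox (μ : Measure X) (u : X → ℝ) (x : X) : EReal :=
  sInf ((fun t : ℝ => (t : EReal)) '' {t : ℝ | Filter.Tendsto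
    (fun r : ℝ => μ ({y | t < u y} ∩ Metric.ball x r) / μ (Metric.ball x r))
    (𝓝[>] (0 : ℝ)) (𝓝 0)})

/-- The upper approximate limit of an extended-real-valued function. -/
def upperApproxE (μ : Measure X) (ψ : X → EReal) (x : X) : EReal :=
  sInf ((fun t : ℝ => (t : EReal)) '' {t : ℝ | Filter.Tendsto
    (fun r : ℝ => μ ({y | (t : EReal) < ψ y} ∩ Metric.ball x r) / μ (Metric.ball x r))
    (𝓝[>] (0 : ℝ)) (𝓝 0)})

/-- The measure-theoretic interior `I_E`. -/
def measInterior (μ : Measure X) (E : Set X) : Set X :=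
  {x : X | Filter.Tendsto (fun r : ℝ => μ (Metric.ball x r \ E) / μ (Metric.ball x r))
    (𝓝[>] (0 : ℝ)) (𝓝 0)}

/-- The measure-theoretic boundary `∂*E`. -/
def measBoundary (μ : Measure X) (E : Set X) : Set X :=
  {x : X | 0 < Filter.limsup (fun r : ℝ => μ (Metric.ball x r ∩ E) / μ (Metric.ball x r))
      (𝓝[>] (0 : ℝ)) ∧
    0 < Filter.limsup (fun r : ℝ => μ (Metric.ball x r \ E) / μ (Metric.ball x r))
      (𝓝[>] (0 : ℝ))}

/-- `A` is 1-thin at `x`. -/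
def IsThinAt (μ : Measure X) (A : Set X) (x : X) : Prop :=
  Filter.Tendsto (fun r : ℝ =>
      ENNReal.ofReal r * vcap1 μ (A ∩ Metric.ball x r) (Metric.ball x (2 * r))
        / μ (Metric.ball x r))
    (𝓝[>] (0 : ℝ)) (𝓝 0)

/-- `U` is 1-finely open. -/
def IsFinelyOpen (μ : Measure X) (U : Set X) : Prop :=
  ∀ x ∈ U, IsThinAt μ Uᶜ x

/-- The class `K_{ψ,f}(Ω)` of admissible functions for the obstacle problem. -/
def MemK (μ : Measure X) (ψ : X → EReal) (f : X → ℝ) (Ω : Set X) (u : X → ℝ) : Prop :=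
  MemBVloc μ u Set.univ ∧ (∀ᵐ x ∂μ, x ∈ Ω → ψ x ≤ (u x : EReal)) ∧
    (∀ᵐ x ∂μ, x ∉ Ω → u x = f x)

/-- `u` is a solution of the `K_{ψ,f}(Ω)`-obstacle problem. -/
def IsObstacleSolution (μ : Measure X) (ψ : X → EReal) (f : X → ℝ) (Ω : Set X)
    (u : X → ℝ) : Prop :=
  MemK μ ψ f Ω u ∧ ∀ v : X → ℝ, MemK μ ψ f Ω v → tv μ u Set.univ ≤ tv μ v Set.univ

/-- The standing assumptions: `(X,d,μ)` is a complete metric space with at least two points,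
`μ` is a doubling measure with constant `Cd`, and `X` supports a `(1,1)`-Poincaré inequality
with constants `CP`, `lam`. -/
structure MMS {X : Type*} [MetricSpace X] [MeasurableSpace X] (μ : Measure X)
    (Cd CP lam : ℝ) : Prop where
  complete : CompleteSpace X
  nontrivial : Nontrivial X
  hCd : 1 ≤ Cd
  hCP : 0 < CP
  hlam : 1 ≤ lam
  doubling : ∀ (x : X) (r : ℝ), 0 < r →
    0 < μ (Metric.ball x (2 * r)) ∧
    μ (Metric.ball x (2 * r)) ≤ ENNReal.ofReal Cd * μ (Metric.ball x r) ∧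
    μ (Metric.ball x r) < ⊤
  poincare : ∀ (x : X) (r : ℝ), 0 < r → ∀ u : X → ℝ, MeasureTheory.LocallyIntegrable u μ →
    ∀ g : X → ℝ≥0∞, Measurable g → IsUpperGradientOn g u Set.univ →
      ∫⁻ y in Metric.ball x r, ENNReal.ofReal |u y - ⨍ z in Metric.ball x r, u z ∂μ| ∂μ ≤
        ENNReal.ofReal (CP * r) * (μ (Metric.ball x r) / μ (Metric.ball x (lam * r))) *
          ∫⁻ y in Metric.ball x (lam * r), g y ∂μ

set_option linter.unusedSectionVars false

/-! ### One-dimensional calculus -/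

lemma absolutelyContinuousOnInterval_of_abs_sub_le {f g h : ℝ → ℝ} {a b L : ℝ}
    (hg : AbsolutelyContinuousOnInterval g a b) (hh : AbsolutelyContinuousOnInterval h a b)
    (hle : ∀ s ∈ uIcc a b, ∀ t ∈ uIcc a b,
      |f s - f t| ≤ L * (|g s - g t| + |h s - h t|)) :
    AbsolutelyContinuousOnInterval f a b := by
  unfold AbsolutelyContinuousOnInterval at *
  have := (hg.add hh).const_mul L
  rw [add_zero, mul_zero] at this
  refine squeeze_zero' (Eventually.of_forall fun E => Finset.sum_nonneg fun _ _ => dist_nonneg)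
    ?_ this
  have hmem : AbsolutelyContinuousOnInterval.disjWithin a b ∈
      AbsolutelyContinuousOnInterval.totalLengthFilter ⊓
        𝓟 (AbsolutelyContinuousOnInterval.disjWithin a b) :=
    mem_inf_of_right (mem_principal_self _)
  filter_upwards [hmem] with E hE
  rw [← Finset.sum_add_distrib, Finset.mul_sum]
  refine Finset.sum_le_sum fun i hi => ?_
  simpa [Real.dist_eq] using hle _ (hE.1 i hi).1 _ (hE.1 i hi).2

lemma absolutelyContinuousOnInterval_const (c a b : ℝ) :
    AbsolutelyContinuousOnInterval (fun _ => c) a b :=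
  (LipschitzOnWith.of_dist_le_mul (K := 0) (by simp)).absolutelyContinuousOnInterval

lemma tendsto_abs_quotient {f : ℝ → ℝ} {t : ℝ} (hf : DifferentiableAt ℝ f t) :
    Tendsto (fun h : ℝ => |f (t + h) - f t| / |h|) (𝓝[≠] 0) (𝓝 |deriv f t|) := by
  have := (hasDerivAt_iff_tendsto_slope_zero.1 hf.hasDerivAt).abs
  refine this.congr fun h => ?_
  rw [smul_eq_mul, abs_mul, abs_inv, div_eq_inv_mul]

lemma tendsto_add_nhdsNE (t : ℝ) : Tendsto (fun h : ℝ => t + h) (𝓝[≠] 0) (𝓝 t) := by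
  have : Tendsto (fun h : ℝ => t + h) (𝓝 0) (𝓝 (t + 0)) := by
    exact (continuous_const.add continuous_id).tendsto 0
  rw [add_zero] at this
  exact this.mono_left nhdsWithin_le_nhds

lemma abs_deriv_le_of_eventually {f g h : ℝ → ℝ} {t L : ℝ}
    (hf : DifferentiableAt ℝ f t) (hg : DifferentiableAt ℝ g t) (hh : DifferentiableAt ℝ h t)
    (hle : ∀ᶠ s in 𝓝 t, |f s - f t| ≤ L * (|g s - g t| + |h s - h t|)) :
    |deriv f t| ≤ L * (|deriv g t| + |deriv h t|) := by
  refine le_of_tendsto_of_tendsto (tendsto_abs_quotient hf)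
    (((tendsto_abs_quotient hg).add (tendsto_abs_quotient hh)).const_mul L) ?_
  filter_upwards [(tendsto_add_nhdsNE t).eventually hle] with s hs
  calc _ ≤ L * (|g (t + s) - g t| + |h (t + s) - h t|) / |s| := by gcongr
    _ = _ := by ring

lemma deriv_eq_zero_of_forall_ge {f : ℝ → ℝ} {t : ℝ} (h : ∀ s, f t ≤ f s) : deriv f t = 0 :=
  IsLocalMin.deriv_eq_zero (Eventually.of_forall h)

lemma deriv_eq_zero_of_forall_le {f : ℝ → ℝ} {t : ℝ} (h : ∀ s, f s ≤ f t) : deriv f t = 0 :=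
  IsLocalMax.deriv_eq_zero (Eventually.of_forall h)

lemma ofReal_abs_sub_le_lintegral_deriv {f : ℝ → ℝ} {G : ℝ → ℝ≥0∞}
    (hf : AbsolutelyContinuousOnInterval f 0 1)
    (hG : ∀ᵐ t : ℝ, t ∈ Ioo (0:ℝ) 1 → ENNReal.ofReal |deriv f t| ≤ G t) :
    ENNReal.ofReal |f 1 - f 0| ≤ ∫⁻ t in Icc (0:ℝ) 1, G t := by
  rw [← hf.integral_deriv_eq_sub, intervalIntegral.integral_of_le zero_le_one,
    ← Real.enorm_eq_ofReal_abs]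
  refine (enorm_integral_le_lintegral_enorm _).trans ?_
  rw [setLIntegral_congr Ioo_ae_eq_Ioc.symm, setLIntegral_congr Ioo_ae_eq_Icc.symm]
  refine lintegral_mono_ae ?_
  rw [ae_restrict_iff' measurableSet_Ioo]
  filter_upwards [hG] with t ht h
  rw [Real.enorm_eq_ofReal_abs]
  exact ht h

/-! ### Speed and curve integrals -/

lemma Curve.continuousOn (γ : Curve X) : ContinuousOn γ.toFun (Icc 0 1) :=
  γ.lipschitz.choose_spec.continuousOn

lemma Curve.continuousAt (γ : Curve X) {t : ℝ} (ht : t ∈ Ioo (0:ℝ) 1) :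
    ContinuousAt γ.toFun t :=
  γ.continuousOn.continuousAt (Icc_mem_nhds ht.1 ht.2)

lemma speed_congr {γ γ' : ℝ → X} {t : ℝ} (h : γ =ᶠ[𝓝 t] γ') : speed γ t = speed γ' t := by
  unfold speed
  refine limsup_congr ?_
  filter_upwards [(tendsto_add_nhdsNE t).eventually h] with s hs
  rw [hs, h.self_of_nhds]

lemma measurable_speed_of_continuous {γ : ℝ → X} (hγ : Continuous γ) : Measurable (speed γ) := by
  have hb : (𝓝[≠] (0:ℝ)).HasBasis (fun n : ℕ => True)
      (fun n : ℕ => ball (0:ℝ) (1 / ((n:ℝ) + 1)) ∩ {0}ᶜ) :=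
    nhdsWithin_hasBasis Metric.nhds_basis_ball_inv_nat_succ _
  have : speed γ = fun t => ⨅ n : ℕ, ⨆ h ∈ (ball (0:ℝ) (1 / ((n:ℝ) + 1)) ∩ {0}ᶜ : Set ℝ),
      ENNReal.ofReal (dist (γ (t + h)) (γ t) / |h|) := by
    funext t
    unfold speed
    rw [hb.limsup_eq_iInf_iSup]
    simp
  rw [this]
  refine Measurable.iInf fun n => LowerSemicontinuous.measurable ?_
  refine lowerSemicontinuous_biSup fun h _ => Continuous.lowerSemicontinuous ?_
  exact ENNReal.continuous_ofReal.comp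
    (((hγ.comp (continuous_id.add continuous_const)).dist hγ).div_const _)

lemma Curve.aemeasurable_toFun [BorelSpace X] (γ : Curve X) :
    AEMeasurable γ.toFun (volume.restrict (Icc (0:ℝ) 1)) :=
  γ.continuousOn.aemeasurable measurableSet_Icc

lemma Curve.aemeasurable_speed (γ : Curve X) :
    AEMeasurable (speed γ.toFun) (volume.restrict (Icc (0:ℝ) 1)) := by
  have hc : Continuous (IccExtend (zero_le_one' ℝ) (fun t => γ.toFun t)) := by
    refine Continuous.Icc_extend' ?_
    exact continuousOn_iff_continuous_domRestrict.1 γ.continuousOn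
  refine ⟨_, measurable_speed_of_continuous hc, ?_⟩
  rw [← restrict_Ioo_eq_restrict_Icc, EventuallyEq, ae_restrict_iff' measurableSet_Ioo]
  refine Eventually.of_forall fun t ht => speed_congr ?_
  filter_upwards [Icc_mem_nhds ht.1 ht.2] with s hs
  rw [IccExtend_of_mem _ _ hs]

lemma Curve.aemeasurable_integrand [BorelSpace X] (γ : Curve X) {g : X → ℝ≥0∞}
    (hg : Measurable g) :
    AEMeasurable (fun t => g (γ.toFun t) * speed γ.toFun t) (volume.restrict (Icc (0:ℝ) 1)) :=
  (hg.comp_aemeasurable γ.aemeasurable_toFun).mul γ.aemeasurable_speed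

lemma curveIntegral_add [BorelSpace X] {g h : X → ℝ≥0∞} (hg : Measurable g) (γ : Curve X) :
    curveIntegral (fun x => g x + h x) γ = curveIntegral g γ + curveIntegral h γ := by
  unfold curveIntegral
  rw [← lintegral_add_left' (γ.aemeasurable_integrand hg)]
  simp_rw [add_mul]

lemma curveIntegral_const_mul [BorelSpace X] {g : X → ℝ≥0∞} (c : ℝ≥0∞) (hg : Measurable g)
    (γ : Curve X) :
    curveIntegral (fun x => c * g x) γ = c * curveIntegral g γ := by
  unfold curveIntegral
  rw [← lintegral_const_mul'' _ (γ.aemeasurable_integrand hg)]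
  simp_rw [mul_assoc]

lemma curveIntegral_tsum [BorelSpace X] {g : ℕ → X → ℝ≥0∞} (hg : ∀ i, Measurable (g i))
    (γ : Curve X) :
    curveIntegral (fun x => ∑' i, g i x) γ = ∑' i, curveIntegral (g i) γ := by
  unfold curveIntegral
  rw [← lintegral_tsum fun i => γ.aemeasurable_integrand (hg i)]
  simp_rw [ENNReal.tsum_mul_right]

lemma curveIntegral_mono {g h : X → ℝ≥0∞} (γ : Curve X)
    (hgh : ∀ t ∈ Icc (0:ℝ) 1, g (γ.toFun t) ≤ h (γ.toFun t)) :
    curveIntegral g γ ≤ curveIntegral h γ :=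
  setLIntegral_mono' measurableSet_Icc fun t ht => mul_le_mul_left (hgh t ht) _

/-- The restriction of a curve to `[s,t]`, reparametrized on `[0,1]`. -/
def Curve.sub (γ : Curve X) (s t : ℝ) (hs : 0 ≤ s) (hst : s < t) (ht : t ≤ 1) : Curve X where
  toFun := fun τ => γ.toFun (s + τ * (t - s))
  lipschitz := by
    obtain ⟨K, hK⟩ := γ.lipschitz
    refine ⟨K * (t - s).toNNReal, LipschitzOnWith.of_dist_le_mul fun a ha b hb => ?_⟩
    have h1 : ∀ c ∈ Icc (0:ℝ) 1, s + c * (t - s) ∈ Icc (0:ℝ) 1 := fun c hc =>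
      ⟨by nlinarith [hc.1, hc.2], by nlinarith [hc.1, hc.2]⟩
    refine (hK.dist_le_mul _ (h1 a ha) _ (h1 b hb)).trans (le_of_eq ?_)
    rw [Real.dist_eq, Real.dist_eq, NNReal.coe_mul, Real.coe_toNNReal _ (by linarith), mul_assoc,
      show s + a * (t - s) - (s + b * (t - s)) = (a - b) * (t - s) by ring, abs_mul,
      abs_of_pos (sub_pos.2 hst), mul_comm (t - s)]

lemma speed_affine (γ : ℝ → X) (s c τ : ℝ) (hc : 0 < c) :
    speed (fun τ => γ (s + τ * c)) τ = ENNReal.ofReal c * speed γ (s + τ * c) := by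
  unfold speed
  have hmap : map (fun h : ℝ => h * c) (𝓝[≠] (0:ℝ)) = 𝓝[≠] (0:ℝ) := by
    have := (Homeomorph.mulRight₀ c hc.ne').map_punctured_nhds_eq 0
    simpa using this
  conv_rhs => rw [← hmap]
  rw [← ENNReal.limsup_const_mul_of_ne_top ENNReal.ofReal_ne_top]
  rw [← limsup_comp]
  refine limsup_congr ?_
  filter_upwards [self_mem_nhdsWithin] with h hh
  have hh' : 0 < |h| := abs_pos.2 hh
  simp only [Function.comp_apply]
  rw [← ENNReal.ofReal_mul hc.le, abs_mul, abs_of_pos hc]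
  congr 1
  rw [show s + (τ + h) * c = s + τ * c + h * c by ring]
  field_simp

lemma curveIntegral_sub (g : X → ℝ≥0∞) (γ : Curve X) {s t : ℝ} (hs : 0 ≤ s) (hst : s < t)
    (ht : t ≤ 1) : curveIntegral g (γ.sub s t hs hst ht) =
      ∫⁻ τ in Icc s t, g (γ.toFun τ) * speed γ.toFun τ := by
  have hc : 0 < t - s := sub_pos.2 hst
  unfold curveIntegral Curve.sub
  simp only [speed_affine γ.toFun s (t - s) _ hc]
  have hd : ∀ x ∈ Icc (0:ℝ) 1, HasDerivWithinAt (fun τ : ℝ => s + τ * (t - s)) (t - s)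
      (Icc 0 1) x := fun x _ => by
    have := ((hasDerivAt_id x).mul_const (t - s)).const_add s
    simpa using this.hasDerivWithinAt
  have hinj : InjOn (fun τ : ℝ => s + τ * (t - s)) (Icc 0 1) := fun a _ b _ hab => by
    have : a * (t - s) = b * (t - s) := by simpa using hab
    exact mul_right_cancel₀ hc.ne' this
  have himg : (fun τ : ℝ => s + τ * (t - s)) '' Icc 0 1 = Icc s t := by
    ext y
    constructor
    · rintro ⟨a, ha, rfl⟩
      exact ⟨by nlinarith [ha.1, ha.2], by nlinarith [ha.1, ha.2]⟩
    · intro hy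
      refine ⟨(y - s) / (t - s), ⟨div_nonneg (by linarith [hy.1]) hc.le,
        (div_le_one hc).2 (by linarith [hy.2])⟩, ?_⟩
      field_simp
      ring
  rw [← himg, lintegral_image_eq_lintegral_abs_deriv_mul measurableSet_Icc hd hinj,
    abs_of_pos hc]
  refine lintegral_congr fun τ => ?_
  ring

lemma curveIntegral_sub_le (g : X → ℝ≥0∞) (γ : Curve X) {s t : ℝ} (hs : 0 ≤ s) (hst : s < t)
    (ht : t ≤ 1) : curveIntegral g (γ.sub s t hs hst ht) ≤ curveIntegral g γ := by
  rw [curveIntegral_sub]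
  exact lintegral_mono_set (Icc_subset_Icc hs ht)

/-- Along `γ`, the function `v` is absolutely continuous with derivative controlled by `g`. -/
def DerivBound (γ : Curve X) (v : X → ℝ) (g : X → ℝ≥0∞) : Prop :=
  AbsolutelyContinuousOnInterval (v ∘ γ.toFun) 0 1 ∧
    ∀ᵐ t : ℝ, t ∈ Ioo (0:ℝ) 1 →
      ENNReal.ofReal |deriv (v ∘ γ.toFun) t| ≤ g (γ.toFun t) * speed γ.toFun t

lemma DerivBound.le_curveIntegral {γ : Curve X} {v : X → ℝ} {g : X → ℝ≥0∞}
    (h : DerivBound γ v g) :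
    ENNReal.ofReal |v (γ.toFun 1) - v (γ.toFun 0)| ≤ curveIntegral g γ :=
  ofReal_abs_sub_le_lintegral_deriv h.1 h.2

lemma DerivBound.ae_differentiableAt {γ : Curve X} {v : X → ℝ} {g : X → ℝ≥0∞}
    (h : DerivBound γ v g) :
    ∀ᵐ t : ℝ, t ∈ Ioo (0:ℝ) 1 → DifferentiableAt ℝ (v ∘ γ.toFun) t := by
  filter_upwards [h.1.ae_differentiableAt] with t ht h
  rw [uIcc_of_le zero_le_one] at ht
  exact ht (Ioo_subset_Icc_self h)

lemma DerivBound.continuousAt {γ : Curve X} {v : X → ℝ} {g : X → ℝ≥0∞}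
    (h : DerivBound γ v g) {t : ℝ} (ht : t ∈ Ioo (0:ℝ) 1) :
    ContinuousAt (v ∘ γ.toFun) t := by
  have := h.1.continuousOn
  rw [uIcc_of_le zero_le_one] at this
  exact this.continuousAt (Icc_mem_nhds ht.1 ht.2)

lemma DerivBound.mono {γ : Curve X} {v : X → ℝ} {g g' : X → ℝ≥0∞}
    (h : DerivBound γ v g) (hg : ∀ x, g x ≤ g' x) : DerivBound γ v g' :=
  ⟨h.1, by filter_upwards [h.2] with t ht h using (ht h).trans (mul_le_mul_left (hg _) _)⟩

lemma derivBound_of_lipschitz (γ : Curve X) {v : X → ℝ} {L : ℝ≥0} (hv : LipschitzWith L v) :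
    DerivBound γ v (fun _ => L) := by
  have hac : AbsolutelyContinuousOnInterval (v ∘ γ.toFun) 0 1 := by
    obtain ⟨K, hK⟩ := γ.lipschitz
    have := hv.comp_lipschitzOnWith hK
    rw [← uIcc_of_le zero_le_one] at this
    exact this.absolutelyContinuousOnInterval
  refine ⟨hac, ?_⟩
  filter_upwards [hac.ae_differentiableAt] with t ht h
  rw [uIcc_of_le zero_le_one] at ht
  have hd := tendsto_abs_quotient (ht (Ioo_subset_Icc_self h))
  have hd' := (ENNReal.continuous_ofReal.tendsto _).comp hd
  rw [← hd'.limsup_eq, speed, ← ENNReal.limsup_const_mul_of_ne_top ENNReal.coe_ne_top]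
  refine limsup_le_limsup (Eventually.of_forall fun s => ?_)
  simp only [Function.comp_apply]
  rw [← ENNReal.ofReal_coe_nnreal, ← ENNReal.ofReal_mul L.coe_nonneg, ← mul_div_assoc]
  gcongr
  exact hv.dist_le_mul _ _

/-- Absolute continuity along a curve on which `g` has finite integral. -/
lemma derivBound_aux [BorelSpace X] {γ : Curve X} {v : X → ℝ} {g : X → ℝ≥0∞} {V : Set X}
    (hV : IsOpen V) (hg : Measurable g) (hfin : curveIntegral g γ ≠ ∞)
    (h : ∀ (s t : ℝ) (hs : 0 ≤ s) (hst : s < t) (ht : t ≤ 1), (γ.sub s t hs hst ht).In V →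
      ENNReal.ofReal |v (γ.toFun t) - v (γ.toFun s)| ≤ curveIntegral g (γ.sub s t hs hst ht)) :
    (V = univ → AbsolutelyContinuousOnInterval (v ∘ γ.toFun) 0 1) ∧
    ∀ᵐ t : ℝ, t ∈ Ioo (0:ℝ) 1 → γ.toFun t ∈ V → DifferentiableAt ℝ (v ∘ γ.toFun) t →
      ENNReal.ofReal |deriv (v ∘ γ.toFun) t| ≤ g (γ.toFun t) * speed γ.toFun t := by
  set G : ℝ → ℝ≥0∞ := fun t => g (γ.toFun t) * speed γ.toFun t with hGdef
  have hGm : AEMeasurable G (volume.restrict (Icc (0:ℝ) 1)) := γ.aemeasurable_integrand hg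
  have hGint : IntegrableOn (fun t => (G t).toReal) (Icc (0:ℝ) 1) :=
    integrable_toReal_of_lintegral_ne_top hGm hfin
  have hGfin : ∀ᵐ t ∂(volume.restrict (Icc (0:ℝ) 1)), G t < ∞ := ae_lt_top' hGm hfin
  have hGI : IntervalIntegrable (fun t => (G t).toReal) volume 0 1 := by
    rw [intervalIntegrable_iff_integrableOn_Icc_of_le zero_le_one]; exact hGint
  set Φ : ℝ → ℝ := fun t => ∫ τ in (0:ℝ)..t, (G τ).toReal with hΦ
  have hΦac : AbsolutelyContinuousOnInterval Φ 0 1 :=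
    hGI.absolutelyContinuousOnInterval_intervalIntegral (by simp)
  have hsub : ∀ s t : ℝ, 0 ≤ s → s ≤ t → t ≤ 1 →
      (∀ τ ∈ Icc s t, γ.toFun τ ∈ V) →
      |(v ∘ γ.toFun) t - (v ∘ γ.toFun) s| ≤ |Φ t - Φ s| := by
    intro s t hs hst ht hin
    rcases hst.eq_or_lt with rfl | hst
    · simp
    have h1 := h s t hs hst ht (fun τ hτ => hin _
      ⟨by nlinarith [hτ.1, hτ.2], by nlinarith [hτ.1, hτ.2]⟩)
    rw [curveIntegral_sub] at h1
    have hsubset : Icc s t ⊆ Icc (0:ℝ) 1 := Icc_subset_Icc hs ht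
    have h2 : ∫⁻ τ in Icc s t, G τ = ENNReal.ofReal (Φ t - Φ s) := by
      have e1 : Φ t - Φ s = ∫ τ in s..t, (G τ).toReal :=
        intervalIntegral.integral_interval_sub_left
          (hGI.mono_set (by rw [uIcc_of_le zero_le_one, uIcc_of_le (hs.trans hst.le)]
                            exact Icc_subset_Icc_right ht))
          (hGI.mono_set (by rw [uIcc_of_le zero_le_one, uIcc_of_le hs]
                            exact Icc_subset_Icc_right (hst.le.trans ht)))
      rw [e1, intervalIntegral.integral_of_le hst.le, ← integral_Icc_eq_integral_Ioc,
        integral_toReal (hGm.mono_measure (Measure.restrict_mono hsubset le_rfl))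
          (ae_mono (Measure.restrict_mono hsubset le_rfl) hGfin), ENNReal.ofReal_toReal]
      exact ((lintegral_mono_set hsubset).trans_lt (lt_top_iff_ne_top.2 hfin)).ne
    rw [h2] at h1
    by_cases h0 : 0 ≤ Φ t - Φ s
    · exact ((ENNReal.ofReal_le_ofReal_iff h0).1 h1).trans (le_abs_self _)
    · rw [ENNReal.ofReal_of_nonpos (not_le.1 h0).le, nonpos_iff_eq_zero,
        ENNReal.ofReal_eq_zero] at h1
      exact h1.trans (abs_nonneg _)
  refine ⟨fun hVu => ?_, ?_⟩
  · refine absolutelyContinuousOnInterval_of_abs_sub_le (L := 1) hΦac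
      (absolutelyContinuousOnInterval_const 0 0 1) fun s hs t ht => ?_
    rw [uIcc_of_le zero_le_one] at hs ht
    simp only [sub_self, abs_zero, add_zero, one_mul]
    rcases le_total s t with hst | hst
    · rw [abs_sub_comm, abs_sub_comm (Φ s)]
      exact hsub s t hs.1 hst ht.2 (by simp [hVu])
    · exact hsub t s ht.1 hst hs.2 (by simp [hVu])
  · have hfin' := (ae_restrict_iff' measurableSet_Icc).1 hGfin
    filter_upwards [hGI.ae_hasDerivAt_integral, hfin'] with t ht htf h01 htV hd
    have ht2 := ht (by rw [uIcc_of_le zero_le_one]; exact Ioo_subset_Icc_self h01) 0 (by simp)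
    have hnear : ∀ᶠ s in 𝓝 t, ∀ τ ∈ uIcc t s, γ.toFun τ ∈ V := by
      have hnb := (γ.continuousAt h01).preimage_mem_nhds (hV.mem_nhds htV)
      obtain ⟨ε, hε, hball⟩ := Metric.mem_nhds_iff.1 hnb
      filter_upwards [Metric.ball_mem_nhds t hε] with s hs τ hτ
      refine hball ?_
      rw [mem_ball, Real.dist_eq] at hs ⊢
      exact (abs_sub_left_of_mem_uIcc hτ).trans_lt hs
    have h01' : ∀ᶠ s in 𝓝 t, s ∈ Icc (0:ℝ) 1 := Icc_mem_nhds h01.1 h01.2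
    have key := abs_deriv_le_of_eventually (L := 1) hd ht2.differentiableAt
      (differentiableAt_const (0:ℝ)) (by
        filter_upwards [hnear, h01'] with s hs hs01
        simp only [sub_self, abs_zero, add_zero, one_mul]
        rcases le_total s t with hst | hst
        · rw [abs_sub_comm, abs_sub_comm (Φ s)]
          exact hsub s t hs01.1 hst h01.2.le (by rwa [uIcc_of_ge hst] at hs)
        · exact hsub t s h01.1.le hst hs01.2 (by rwa [uIcc_of_le hst] at hs))
    rw [deriv_const, abs_zero, add_zero, one_mul, ht2.deriv,
      abs_of_nonneg ENNReal.toReal_nonneg] at key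
    calc _ ≤ ENNReal.ofReal (G t).toReal := ENNReal.ofReal_le_ofReal key
      _ = G t := ENNReal.ofReal_toReal (htf (Ioo_subset_Icc_self h01)).ne

/-! ### Weak upper gradients in differential form -/

/-- Along all curves on which some fixed integrable function has finite integral, `v` is
absolutely continuous with derivative controlled by `g`. -/
def WGrad (μ : Measure X) (g : X → ℝ≥0∞) (v : X → ℝ) : Prop :=
  ∃ ρ : X → ℝ≥0∞, Measurable ρ ∧ ∫⁻ x, ρ x ∂μ ≠ ∞ ∧
    ∀ γ : Curve X, curveIntegral ρ γ ≠ ∞ → DerivBound γ v g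

lemma exists_curveIntegral_eq_top [BorelSpace X] {μ : Measure X} {Γ : Set (Curve X)}
    (h : Mod1 μ Γ = 0) :
    ∃ ρ : X → ℝ≥0∞, Measurable ρ ∧ ∫⁻ x, ρ x ∂μ ≠ ∞ ∧ ∀ γ ∈ Γ, curveIntegral ρ γ = ∞ := by
  have h1 : ∀ n : ℕ, ∃ ρ : X → ℝ≥0∞, Measurable ρ ∧ (∀ γ ∈ Γ, 1 ≤ curveIntegral ρ γ) ∧
      ∫⁻ x, ρ x ∂μ < 2⁻¹ ^ n := by
    intro n
    have : Mod1 μ Γ < 2⁻¹ ^ n := by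
      rw [h]; exact ENNReal.pow_pos (by simp) n
    unfold Mod1 at this
    simp only [iInf_lt_iff] at this
    obtain ⟨ρ, h1, h2, h3⟩ := this
    exact ⟨ρ, h1, h2, h3⟩
  choose ρ hρm hρ hρi using h1
  refine ⟨fun x => ∑' n, ρ n x, Measurable.tsum hρm, ?_, fun γ hγ => ?_⟩
  · rw [lintegral_tsum fun n => (hρm n).aemeasurable]
    refine ((ENNReal.tsum_le_tsum fun n => (hρi n).le).trans_lt ?_).ne
    rw [ENNReal.tsum_geometric_two]
    exact ENNReal.ofNat_lt_top
  · rw [curveIntegral_tsum hρm, eq_top_iff, ← ENNReal.tsum_const_eq_top_of_ne_zero (α := ℕ) one_ne_zero]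
    exact ENNReal.tsum_le_tsum fun n => hρ n γ hγ

lemma WGrad.mono {μ : Measure X} {g g' : X → ℝ≥0∞} {v : X → ℝ} (h : WGrad μ g v)
    (hg : ∀ x, g x ≤ g' x) : WGrad μ g' v := by
  obtain ⟨ρ, h1, h2, h3⟩ := h
  exact ⟨ρ, h1, h2, fun γ hγ => (h3 γ hγ).mono hg⟩

/-- Combine two weak gradients. -/
lemma WGrad.map₂ [BorelSpace X] {μ : Measure X} {g₁ g₂ g : X → ℝ≥0∞} {v₁ v₂ v : X → ℝ}
    (h₁ : WGrad μ g₁ v₁) (h₂ : WGrad μ g₂ v₂)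
    (h : ∀ γ : Curve X, DerivBound γ v₁ g₁ → DerivBound γ v₂ g₂ → DerivBound γ v g) :
    WGrad μ g v := by
  obtain ⟨ρ₁, h11, h12, h13⟩ := h₁
  obtain ⟨ρ₂, h21, h22, h23⟩ := h₂
  refine ⟨fun x => ρ₁ x + ρ₂ x, h11.add h21, ?_, fun γ hγ => ?_⟩
  · rw [lintegral_add_left h11]; exact ENNReal.add_ne_top.2 ⟨h12, h22⟩
  · rw [curveIntegral_add h11, ENNReal.add_ne_top] at hγ
    exact h γ (h13 γ hγ.1) (h23 γ hγ.2)

lemma wgrad_of_lipschitz {μ : Measure X} {v : X → ℝ} {L : ℝ≥0} (hv : LipschitzWith L v) :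
    WGrad μ (fun _ => L) v :=
  ⟨0, measurable_zero, by simp, fun γ _ => derivBound_of_lipschitz γ hv⟩

lemma IsWeakUpperGradientOn.exists_finite [BorelSpace X] {μ : Measure X} {g : X → ℝ≥0∞}
    {v : X → ℝ} {V : Set X} (hV : IsOpen V) (hg : Measurable g)
    (hfin : ∫⁻ x in V, g x ∂μ ≠ ∞) (h : IsWeakUpperGradientOn μ g v V) :
    ∃ ρ : X → ℝ≥0∞, Measurable ρ ∧ ∫⁻ x, ρ x ∂μ ≠ ∞ ∧ ∀ γ : Curve X, curveIntegral ρ γ ≠ ∞ →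
      curveIntegral (V.indicator g) γ ≠ ∞ ∧
      ∀ (s t : ℝ) (hs : 0 ≤ s) (hst : s < t) (ht : t ≤ 1), (γ.sub s t hs hst ht).In V →
        ENNReal.ofReal |v (γ.toFun t) - v (γ.toFun s)| ≤
          curveIntegral (V.indicator g) (γ.sub s t hs hst ht) := by
  obtain ⟨Γ, hΓ, hug⟩ := h
  obtain ⟨ρ, hρ, hρi, hρΓ⟩ := exists_curveIntegral_eq_top hΓ
  refine ⟨fun x => ρ x + V.indicator g x, hρ.add (hg.indicator hV.measurableSet), ?_,
    fun γ hγ => ?_⟩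
  · rw [lintegral_add_left hρ, lintegral_indicator hV.measurableSet]
    exact ENNReal.add_ne_top.2 ⟨hρi, hfin⟩
  · rw [curveIntegral_add hρ, ENNReal.add_ne_top] at hγ
    refine ⟨hγ.2, fun s t hs hst ht hin => ?_⟩
    have hnot : γ.sub s t hs hst ht ∉ Γ := fun hmem =>
      ((curveIntegral_sub_le ρ γ hs hst ht).trans_lt (lt_top_iff_ne_top.2 hγ.1)).ne
        (hρΓ _ hmem)
    have := hug _ hnot hin
    have e1 : (γ.sub s t hs hst ht).toFun 1 = γ.toFun t := by
      simp [Curve.sub]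
    have e0 : (γ.sub s t hs hst ht).toFun 0 = γ.toFun s := by
      simp [Curve.sub]
    rw [e1, e0] at this
    refine this.trans (curveIntegral_mono _ fun τ hτ => ?_)
    rw [indicator_of_mem (hin τ hτ)]

lemma IsWeakUpperGradientOn.wgrad [BorelSpace X] {μ : Measure X} {g : X → ℝ≥0∞} {v : X → ℝ}
    (hg : Measurable g) (hfin : ∫⁻ x, g x ∂μ ≠ ∞) (h : IsWeakUpperGradientOn μ g v univ) :
    WGrad μ g v := by
  obtain ⟨ρ, h1, h2, h3⟩ := h.exists_finite isOpen_univ hg (by simpa using hfin)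
  refine ⟨ρ, h1, h2, fun γ hγ => ?_⟩
  obtain ⟨h4, h5⟩ := h3 γ hγ
  rw [indicator_univ] at h4 h5
  obtain ⟨h6, h7⟩ := derivBound_aux isOpen_univ hg h4 h5
  refine ⟨h6 rfl, ?_⟩
  filter_upwards [h7, (h6 rfl).ae_differentiableAt] with t ht hd h01
  rw [uIcc_of_le zero_le_one] at hd
  exact ht h01 (mem_univ _) (hd (Ioo_subset_Icc_self h01))

lemma isWeakUpperGradientOn_of_forall {μ : Measure X} {g : X → ℝ≥0∞} {v : X → ℝ} {V : Set X}
    (h : IsUpperGradientOn g v V) : IsWeakUpperGradientOn μ g v V := by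
  refine ⟨∅, ?_, fun γ _ => h γ⟩
  unfold Mod1
  refine le_antisymm (iInf_le_of_le 0 ?_) zero_le
  simp [measurable_zero]

lemma IsUpperGradientOn.wgrad [BorelSpace X] {μ : Measure X} {g : X → ℝ≥0∞} {v : X → ℝ}
    (hg : Measurable g) (hfin : ∫⁻ x, g x ∂μ ≠ ∞) (h : IsUpperGradientOn g v univ) :
    WGrad μ g v :=
  (isWeakUpperGradientOn_of_forall h).wgrad hg hfin

/-- A Lipschitz function with a weak upper gradient in an open set. -/
lemma wgrad_of_lipschitz_of_isWeak [BorelSpace X] {μ : Measure X} {g : X → ℝ≥0∞} {v : X → ℝ}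
    {V : Set X} {L : ℝ≥0} (hv : LipschitzWith L v) (hV : IsOpen V) (hg : Measurable g)
    (hfin : ∫⁻ x in V, g x ∂μ ≠ ∞) (h : IsWeakUpperGradientOn μ g v V) :
    WGrad μ (fun x => V.indicator g x + Vᶜ.indicator (fun _ => (L : ℝ≥0∞)) x) v := by
  obtain ⟨ρ, h1, h2, h3⟩ := h.exists_finite hV hg hfin
  refine ⟨ρ, h1, h2, fun γ hγ => ?_⟩
  obtain ⟨h4, h5⟩ := h3 γ hγ
  obtain ⟨-, h7⟩ := derivBound_aux hV (hg.indicator hV.measurableSet) h4 h5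
  have hL := derivBound_of_lipschitz γ hv
  refine ⟨hL.1, ?_⟩
  filter_upwards [h7, hL.ae_differentiableAt, hL.2] with t ht hd hLt h01
  by_cases hVt : γ.toFun t ∈ V
  · rw [indicator_of_notMem (notMem_compl_iff.2 hVt), add_zero]
    exact ht h01 hVt (hd h01)
  · rw [indicator_of_notMem hVt, indicator_of_mem (mem_compl hVt), zero_add]
    exact hLt h01

lemma WGrad.exists_isUpperGradientOn [BorelSpace X] {μ : Measure X} {g : X → ℝ≥0∞} {v : X → ℝ}
    (h : WGrad μ g v) (hg : Measurable g) {ε : ℝ≥0∞} (hε : ε ≠ 0) :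
    ∃ ρ : X → ℝ≥0∞, Measurable ρ ∧ ∫⁻ x, ρ x ∂μ ≤ ε ∧
      IsUpperGradientOn (fun x => g x + ρ x) v univ := by
  obtain ⟨ρ, h1, h2, h3⟩ := h
  obtain ⟨δ, hδ, hδε⟩ := ENNReal.exists_nnreal_pos_mul_lt h2 hε
  refine ⟨fun x => δ * ρ x, h1.const_mul _, ?_, fun γ _ => ?_⟩
  · rw [lintegral_const_mul _ h1]
    exact hδε.le
  · rw [curveIntegral_add hg, curveIntegral_const_mul _ h1]
    by_cases hγ : curveIntegral ρ γ = ∞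
    · rw [hγ, ENNReal.mul_top (by simpa using hδ.ne')]
      simp
    · exact (h3 γ hγ).le_curveIntegral.trans le_self_add

lemma DerivBound.comp {γ : Curve X} {g : X → ℝ≥0∞} {v : X → ℝ} (h : DerivBound γ v g)
    {ζ : ℝ → ℝ} {L : ℝ≥0} (hζ : LipschitzWith L ζ) {Z : Set ℝ}
    (hZ : ∀ a ∈ Z, (∀ b, ζ a ≤ ζ b) ∨ ∀ b, ζ b ≤ ζ a) :
    DerivBound γ (fun x => ζ (v x)) ((v ⁻¹' Z)ᶜ.indicator fun x => L * g x) := by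
  have hz : ∀ s t, |ζ s - ζ t| ≤ L * |s - t| := fun s t => by
    simpa [Real.dist_eq] using hζ.dist_le_mul s t
  have hac : AbsolutelyContinuousOnInterval ((fun x => ζ (v x)) ∘ γ.toFun) 0 1 :=
    absolutelyContinuousOnInterval_of_abs_sub_le h.1
      (absolutelyContinuousOnInterval_const 0 0 1) (L := L) fun s _ t _ => by
        simpa using hz _ _
  refine ⟨hac, ?_⟩
  filter_upwards [hac.ae_differentiableAt, h.ae_differentiableAt, h.2] with t h1 h2 h3 h01
  by_cases hv : v (γ.toFun t) ∈ Z
  · have : deriv ((fun x => ζ (v x)) ∘ γ.toFun) t = 0 := by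
      rcases hZ _ hv with h | h
      · exact deriv_eq_zero_of_forall_ge fun s => h _
      · exact deriv_eq_zero_of_forall_le fun s => h _
    simp [this]
  · rw [indicator_of_mem (show γ.toFun t ∈ (v ⁻¹' Z)ᶜ from hv)]
    rw [uIcc_of_le zero_le_one] at h1
    have := abs_deriv_le_of_eventually (L := L) (h1 (Ioo_subset_Icc_self h01)) (h2 h01)
      (differentiableAt_const (0:ℝ)) (Eventually.of_forall fun s => by simpa using hz _ _)
    rw [deriv_const, abs_zero, add_zero] at this
    calc _ ≤ ENNReal.ofReal (L * |deriv (v ∘ γ.toFun) t|) := ENNReal.ofReal_le_ofReal this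
      _ = L * ENNReal.ofReal |deriv (v ∘ γ.toFun) t| := by
          rw [ENNReal.ofReal_mul L.coe_nonneg, ENNReal.ofReal_coe_nnreal]
      _ ≤ L * (g (γ.toFun t) * speed γ.toFun t) := mul_le_mul_right (h3 h01) _
      _ = _ := by rw [mul_assoc]

/-- Chain rule for Lipschitz functions, with vanishing gradient where `ζ` is extremal. -/
lemma WGrad.comp {μ : Measure X} {g : X → ℝ≥0∞} {v : X → ℝ} (h : WGrad μ g v)
    {ζ : ℝ → ℝ} {L : ℝ≥0} (hζ : LipschitzWith L ζ) {Z : Set ℝ}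
    (hZ : ∀ a ∈ Z, (∀ b, ζ a ≤ ζ b) ∨ ∀ b, ζ b ≤ ζ a) :
    WGrad μ ((v ⁻¹' Z)ᶜ.indicator fun x => L * g x) (fun x => ζ (v x)) := by
  obtain ⟨ρ, h1, h2, h3⟩ := h
  exact ⟨ρ, h1, h2, fun γ hγ => (h3 γ hγ).comp hζ hZ⟩

lemma WGrad.comp_lipschitz {μ : Measure X} {g : X → ℝ≥0∞} {v : X → ℝ} (h : WGrad μ g v)
    {ζ : ℝ → ℝ} {L : ℝ≥0} (hζ : LipschitzWith L ζ) :
    WGrad μ (fun x => L * g x) (fun x => ζ (v x)) :=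
  (h.comp hζ (Z := ∅) (by simp)).mono fun x => by simp

lemma WGrad.posPart_sub [BorelSpace X] {μ : Measure X} {g G : X → ℝ≥0∞} {v f : X → ℝ}
    (h : WGrad μ g v) (hf : WGrad μ G f) :
    WGrad μ ({x | f x < v x}.indicator fun x => g x + G x) (fun x => max (v x - f x) 0) := by
  refine h.map₂ hf fun γ h hf => ?_
  have hle : ∀ s t, |max ((v ∘ γ.toFun) s - (f ∘ γ.toFun) s) 0 -
      max ((v ∘ γ.toFun) t - (f ∘ γ.toFun) t) 0| ≤
      1 * (|(v ∘ γ.toFun) s - (v ∘ γ.toFun) t| + |(f ∘ γ.toFun) s - (f ∘ γ.toFun) t|) := by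
    intro s t
    refine (abs_max_sub_max_le_abs _ _ _).trans ?_
    rw [one_mul]
    refine le_trans (le_of_eq ?_) (abs_sub _ _)
    congr 1; ring
  have hac : AbsolutelyContinuousOnInterval ((fun x => max (v x - f x) 0) ∘ γ.toFun) 0 1 :=
    absolutelyContinuousOnInterval_of_abs_sub_le h.1 hf.1 (L := 1) fun s _ t _ => hle s t
  refine ⟨hac, ?_⟩
  filter_upwards [hac.ae_differentiableAt, h.ae_differentiableAt, h.2, hf.ae_differentiableAt,
    hf.2] with t h1 h2 h3 h4 h5 h01
  by_cases hv : f (γ.toFun t) < v (γ.toFun t)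
  · rw [indicator_of_mem (show γ.toFun t ∈ {x | f x < v x} from hv)]
    rw [uIcc_of_le zero_le_one] at h1
    have := abs_deriv_le_of_eventually (h1 (Ioo_subset_Icc_self h01)) (h2 h01)
      (h4 h01) (Eventually.of_forall fun s => hle s t)
    rw [one_mul] at this
    refine (ENNReal.ofReal_le_ofReal this).trans ?_
    rw [ENNReal.ofReal_add (abs_nonneg _) (abs_nonneg _), add_mul]
    exact add_le_add (h3 h01) (h5 h01)
  · have : deriv ((fun x => max (v x - f x) 0) ∘ γ.toFun) t = 0 := by
      refine deriv_eq_zero_of_forall_ge fun s => ?_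
      have e : ((fun x => max (v x - f x) 0) ∘ γ.toFun) t = 0 :=
        max_eq_right (by linarith [not_lt.1 hv])
      rw [e]
      exact le_max_right _ _
    simp [this]

lemma WGrad.inf [BorelSpace X] {μ : Measure X} {g G : X → ℝ≥0∞} {v f : X → ℝ}
    (h : WGrad μ g v) (hf : WGrad μ G f) :
    WGrad μ (fun x => {x | f x < v x}.indicator G x + {x | f x < v x}ᶜ.indicator g x)
      (fun x => min (v x) (f x)) := by
  refine (h.map₂ hf fun γ h hf => ?_ )
  have hle : ∀ s t, |min ((v ∘ γ.toFun) s) ((f ∘ γ.toFun) s) -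
      min ((v ∘ γ.toFun) t) ((f ∘ γ.toFun) t)| ≤
      1 * (|(v ∘ γ.toFun) s - (v ∘ γ.toFun) t| + |(f ∘ γ.toFun) s - (f ∘ γ.toFun) t|) := by
    intro s t
    refine (abs_min_sub_min_le_max _ _ _ _).trans ?_
    rw [one_mul]
    exact max_le_add_of_nonneg (abs_nonneg _) (abs_nonneg _)
  have hac : AbsolutelyContinuousOnInterval ((fun x => min (v x) (f x)) ∘ γ.toFun) 0 1 :=
    absolutelyContinuousOnInterval_of_abs_sub_le h.1 hf.1 (L := 1) fun s _ t _ => hle s t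
  refine ⟨hac, ?_⟩
  filter_upwards [hac.ae_differentiableAt, h.ae_differentiableAt, h.2, hf.ae_differentiableAt,
    hf.2] with t h1 h2 h3 h4 h5 h01
  by_cases hv : f (γ.toFun t) < v (γ.toFun t)
  · rw [indicator_of_mem (show γ.toFun t ∈ {x | f x < v x} from hv),
      indicator_of_notMem (notMem_compl_iff.2 (show γ.toFun t ∈ {x | f x < v x} from hv)),
      add_zero]
    have : (fun x => min (v x) (f x)) ∘ γ.toFun =ᶠ[𝓝 t] f ∘ γ.toFun := by
      filter_upwards [(hf.continuousAt h01).eventually_lt (h.continuousAt h01) hv] with s hs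
      exact min_eq_right (le_of_lt hs)
    rw [this.deriv_eq]
    exact h5 h01
  · rw [indicator_of_notMem (show γ.toFun t ∉ {x | f x < v x} from hv),
      indicator_of_mem (show γ.toFun t ∈ {x | f x < v x}ᶜ from hv), zero_add]
    rw [uIcc_of_le zero_le_one] at h1
    set m := (fun x => min (v x) (f x)) ∘ γ.toFun with hm
    have hd : deriv (v ∘ γ.toFun - m) t = 0 := by
      refine deriv_eq_zero_of_forall_ge fun s => ?_
      have : m t = (v ∘ γ.toFun) t := min_eq_left (not_lt.1 hv)
      rw [Pi.sub_apply, this, sub_self, Pi.sub_apply, sub_nonneg]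
      exact min_le_left _ _
    rw [deriv_sub (h2 h01) (h1 (Ioo_subset_Icc_self h01)), sub_eq_zero] at hd
    rw [← hd]
    exact h3 h01

lemma WGrad.convexCombination [BorelSpace X] {μ : Measure X} {gv gu : X → ℝ≥0∞}
    {v u η : X → ℝ} {L : ℝ≥0}
    (hv : WGrad μ gv v) (hu : WGrad μ gu u) (hη : LipschitzWith L η)
    (h0 : ∀ x, 0 ≤ η x) (h1 : ∀ x, η x ≤ 1) :
    WGrad μ (fun x => ENNReal.ofReal (η x) * gv x + ENNReal.ofReal (1 - η x) * gu x +
      {x | η x ≠ 0 ∧ η x ≠ 1}.indicator (fun x => L * ENNReal.ofReal |v x - u x|) x)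
      (fun x => η x * v x + (1 - η x) * u x) := by
  refine hv.map₂ hu fun γ hv hu => ?_
  have hL := derivBound_of_lipschitz γ hη
  have hac : AbsolutelyContinuousOnInterval ((fun x => η x * v x + (1 - η x) * u x) ∘ γ.toFun)
      0 1 :=
    (hL.1.mul hv.1).add (((absolutelyContinuousOnInterval_const 1 0 1).sub hL.1).mul hu.1)
  refine ⟨hac, ?_⟩
  filter_upwards [hL.ae_differentiableAt, hL.2, hv.ae_differentiableAt, hv.2,
    hu.ae_differentiableAt, hu.2] with t h3 h4 h5 h6 h7 h8 h01
  have hd := ((h3 h01).hasDerivAt.mul (h5 h01).hasDerivAt).add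
    (((hasDerivAt_const t (1:ℝ)).sub (h3 h01).hasDerivAt).mul (h7 h01).hasDerivAt)
  have hd' : deriv ((fun x => η x * v x + (1 - η x) * u x) ∘ γ.toFun) t =
      η (γ.toFun t) * deriv (v ∘ γ.toFun) t + (1 - η (γ.toFun t)) * deriv (u ∘ γ.toFun) t +
        deriv (η ∘ γ.toFun) t * (v (γ.toFun t) - u (γ.toFun t)) := by
    have := hd.deriv
    simp only [Function.comp_apply, Pi.sub_apply] at this
    refine Eq.trans ?_ (this.trans ?_)
    · rfl
    · ring
  rw [hd']
  have e1 : ∀ a b c : ℝ, |a + b + c| ≤ |a| + |b| + |c| := fun a b c =>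
    (abs_add_le _ _).trans (add_le_add_left (abs_add_le _ _) _)
  refine (ENNReal.ofReal_le_ofReal (e1 _ _ _)).trans ?_
  rw [ENNReal.ofReal_add (by positivity) (by positivity),
    ENNReal.ofReal_add (by positivity) (by positivity), add_mul, add_mul, abs_mul, abs_mul,
    abs_mul, abs_of_nonneg (h0 _), abs_of_nonneg (sub_nonneg.2 (h1 (γ.toFun t))),
    ENNReal.ofReal_mul (h0 _), ENNReal.ofReal_mul (sub_nonneg.2 (h1 _)), mul_assoc, mul_assoc]
  refine add_le_add (add_le_add (mul_le_mul_right (h6 h01) _) (mul_le_mul_right (h8 h01) _)) ?_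
  by_cases hS : η (γ.toFun t) ≠ 0 ∧ η (γ.toFun t) ≠ 1
  · rw [indicator_of_mem (show γ.toFun t ∈ {x | η x ≠ 0 ∧ η x ≠ 1} from hS),
      ENNReal.ofReal_mul (abs_nonneg _), mul_right_comm]
    exact mul_le_mul_left (h4 h01) _
  · have : deriv (η ∘ γ.toFun) t = 0 := by
      rw [not_and_or, not_not, not_not] at hS
      rcases hS with hS | hS
      · refine deriv_eq_zero_of_forall_ge fun s => ?_
        rw [Function.comp_apply, hS]
        exact h0 _
      · refine deriv_eq_zero_of_forall_le fun s => ?_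
        rw [Function.comp_apply, Function.comp_apply, hS]
        exact h1 _
    simp [this]

/-! ### Doubling spaces -/

section Doubling
variable {μ : Measure X} {Cd CP lam : ℝ}

lemma MMS.ball_pos (hX : MMS μ Cd CP lam) (x : X) {r : ℝ} (hr : 0 < r) : 0 < μ (ball x r) := by
  have := (hX.doubling x (r / 2) (by positivity)).1
  rwa [mul_div_cancel₀ _ (two_ne_zero' ℝ)] at this

lemma MMS.ball_lt_top (hX : MMS μ Cd CP lam) (x : X) (r : ℝ) : μ (ball x r) < ∞ := by
  rcases le_or_gt r 0 with hr | hr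
  · simp [ball_eq_empty.2 hr]
  · exact (hX.doubling x r hr).2.2

lemma MMS.measure_ball_le (hX : MMS μ Cd CP lam) (x : X) {r : ℝ} (hr : 0 < r) (k : ℕ) :
    μ (ball x (2 ^ k * r)) ≤ ENNReal.ofReal Cd ^ k * μ (ball x r) := by
  induction k with
  | zero => simp
  | succ k ih =>
    rw [pow_succ', mul_assoc]
    refine (hX.doubling x _ (by positivity)).2.1.trans ?_
    rw [pow_succ', mul_assoc]
    exact mul_le_mul_right ih _

lemma MMS.one_le_ofReal (hX : MMS μ Cd CP lam) : 1 ≤ ENNReal.ofReal Cd := by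
  rw [← ENNReal.ofReal_one]; exact ENNReal.ofReal_le_ofReal hX.hCd

lemma MMS.card_separated_le [BorelSpace X] (hX : MMS μ Cd CP lam) {s Λ : ℝ} (hs : 0 < s) (hΛ : 0 ≤ Λ) {k : ℕ}
    (hk : 4 * Λ + 2 ≤ 2 ^ k) {Z : Finset X} {y : X}
    (hsep : ∀ z ∈ Z, ∀ z' ∈ Z, z ≠ z' → s ≤ dist z z') (hZ : ∀ z ∈ Z, dist y z < Λ * s) :
    (Z.card : ℝ≥0∞) ≤ ENNReal.ofReal Cd ^ k := by
  have hpos : 0 < (Λ + 1) * s := by positivity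
  have h1 : ∀ z ∈ Z, μ (ball y ((Λ + 1) * s)) ≤ ENNReal.ofReal Cd ^ k * μ (ball z (s / 2)) := by
    intro z hz
    refine (measure_mono ?_).trans (hX.measure_ball_le z (by positivity) k)
    refine ball_subset_ball' ?_
    have := hZ z hz
    nlinarith [mul_le_mul_of_nonneg_right hk hs.le]
  have hdisj : (Z : Set X).PairwiseDisjoint fun z => ball z (s / 2) := by
    intro z hz z' hz' hne
    exact ball_disjoint_ball (by linarith [hsep z hz z' hz' hne])
  have h2 : ∑ z ∈ Z, μ (ball z (s / 2)) ≤ μ (ball y ((Λ + 1) * s)) := by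
    rw [← measure_biUnion_finset hdisj fun z _ => measurableSet_ball]
    refine measure_mono (iUnion₂_subset fun z hz => ball_subset_ball' ?_)
    have := hZ z hz
    rw [dist_comm]
    linarith
  have h3 : (Z.card : ℝ≥0∞) * μ (ball y ((Λ + 1) * s)) ≤
      ENNReal.ofReal Cd ^ k * μ (ball y ((Λ + 1) * s)) := by
    calc _ = ∑ z ∈ Z, μ (ball y ((Λ + 1) * s)) := by simp
      _ ≤ ∑ z ∈ Z, ENNReal.ofReal Cd ^ k * μ (ball z (s / 2)) := Finset.sum_le_sum h1
      _ = ENNReal.ofReal Cd ^ k * ∑ z ∈ Z, μ (ball z (s / 2)) := by rw [Finset.mul_sum]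
      _ ≤ _ := mul_le_mul_right h2 _
  exact (ENNReal.mul_le_mul_iff_left (hX.ball_pos y hpos).ne' (hX.ball_lt_top _ _).ne).1 h3

lemma MMS.exists_net [BorelSpace X] (hX : MMS μ Cd CP lam) (x : X) {ρ s : ℝ} (hρ : 0 < ρ) (hs : 0 < s) :
    ∃ Z : Finset X, (∀ z ∈ Z, z ∈ ball x ρ) ∧
      (∀ z ∈ Z, ∀ z' ∈ Z, z ≠ z' → s ≤ dist z z') ∧ ball x ρ ⊆ ⋃ z ∈ Z, ball z s := by
  classical
  obtain ⟨k, hk⟩ := pow_unbounded_of_one_lt (4 * (ρ / s) + 2) (one_lt_two (α := ℝ))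
  let P : Finset X → Prop := fun Z => (∀ z ∈ Z, z ∈ ball x ρ) ∧
    (∀ z ∈ Z, ∀ z' ∈ Z, z ≠ z' → s ≤ dist z z')
  obtain ⟨N, hN⟩ := ENNReal.exists_nat_gt (r := ENNReal.ofReal Cd ^ k) (by simp)
  have hcard : ∀ Z, P Z → Z.card ≤ N := by
    intro Z hZ
    have h := hX.card_separated_le (y := x) hs (by positivity) hk.le hZ.2 (fun z hz => by
      rw [div_mul_cancel₀ _ hs.ne', dist_comm]; exact hZ.1 z hz)
    exact_mod_cast (h.trans hN.le)
  have hex : ∃ n, ∃ Z, P Z ∧ Z.card = n := ⟨0, ∅, ⟨by simp, by simp⟩, rfl⟩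
  obtain ⟨Z, hZ, hZn⟩ := Nat.findGreatest_spec (P := fun n => ∃ Z, P Z ∧ Z.card = n)
    (Nat.zero_le N) ⟨∅, ⟨by simp, by simp⟩, rfl⟩
  refine ⟨Z, hZ.1, hZ.2, fun y hy => ?_⟩
  by_contra hcon
  simp only [mem_iUnion, mem_ball, not_exists, not_lt] at hcon
  have hyZ : y ∉ Z := fun h => by
    have := hcon y h
    rw [dist_self] at this
    linarith
  have hP : P (insert y Z) := by
    refine ⟨fun z hz => ?_, fun z hz z' hz' hne => ?_⟩
    · rcases Finset.mem_insert.1 hz with rfl | hz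
      exacts [hy, hZ.1 z hz]
    · rcases Finset.mem_insert.1 hz with rfl | hz
      · rcases Finset.mem_insert.1 hz' with rfl | hz'
        exacts [absurd rfl hne, hcon _ hz']
      · rcases Finset.mem_insert.1 hz' with h | hz'
        · rw [h, dist_comm]; exact hcon _ hz
        · exact hZ.2 z hz z' hz' hne
  have h1 := Finset.card_insert_of_notMem hyZ
  have := Nat.le_findGreatest (P := fun n => ∃ Z, P Z ∧ Z.card = n) (hcard _ hP) ⟨_, hP, rfl⟩
  omega

lemma MMS.properSpace [BorelSpace X] (hX : MMS μ Cd CP lam) : ProperSpace X := by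
  have := hX.complete
  refine ⟨fun x r => ?_⟩
  rcases lt_or_ge r 0 with hr | hr
  · rw [closedBall_eq_empty.2 hr]; exact isCompact_empty
  refine TotallyBounded.isCompact_of_isClosed (Metric.totallyBounded_iff.2 fun ε hε => ?_)
    isClosed_closedBall
  obtain ⟨Z, -, -, h⟩ := hX.exists_net x (ρ := r + 1) (by linarith) hε
  exact ⟨Z, Z.finite_toSet, (closedBall_subset_ball (by linarith)).trans h⟩

lemma MMS.isLocallyFiniteMeasure (hX : MMS μ Cd CP lam) : IsLocallyFiniteMeasure μ :=
  ⟨fun x => ⟨ball x 1, ball_mem_nhds _ one_pos, hX.ball_lt_top _ _⟩⟩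

/-! ### Poincaré inequalities -/

lemma MMS.poincare_wgrad [BorelSpace X] (hX : MMS μ Cd CP lam) (x : X) {r : ℝ} (hr : 0 < r)
    {u : X → ℝ} {g : X → ℝ≥0∞} (hu : Integrable u μ) (hg : Measurable g) (h : WGrad μ g u) :
    ∫⁻ y in ball x r, ENNReal.ofReal |u y - ⨍ z in ball x r, u z ∂μ| ∂μ ≤
      ENNReal.ofReal (CP * r) * ∫⁻ y in ball x (lam * r), g y ∂μ := by
  have hlam : r ≤ lam * r := le_mul_of_one_le_left hr.le hX.hlam
  have hstep : ∀ ε : ℝ≥0, 0 < ε → ∫⁻ y in ball x r, ENNReal.ofReal |u y - ⨍ z in ball x r, u z ∂μ| ∂μ ≤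
      ENNReal.ofReal (CP * r) * (∫⁻ y in ball x (lam * r), g y ∂μ + ε) := by
    intro ε hε
    obtain ⟨ρ, hρ, hρi, hug⟩ := h.exists_isUpperGradientOn hg (ε := ε) (by simpa using hε.ne')
    refine (hX.poincare x r hr u hu.locallyIntegrable _ (hg.add hρ) hug).trans ?_
    refine mul_le_mul' ?_ ?_
    · refine (mul_le_mul_right (ENNReal.div_le_of_le_mul ?_) _).trans (mul_one _).le
      rw [one_mul]
      exact measure_mono (ball_subset_ball hlam)
    · simp only [Pi.add_apply]
      rw [lintegral_add_left hg]
      exact add_le_add_right ((setLIntegral_le_lintegral _ _).trans hρi) _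
  rcases eq_or_ne (∫⁻ y in ball x (lam * r), g y ∂μ) ∞ with htop | htop
  · rw [htop, ENNReal.mul_top]
    · exact le_top
    · exact (ENNReal.ofReal_pos.2 (mul_pos hX.hCP hr)).ne'
  · refine ENNReal.le_of_forall_pos_le_add fun ε hε _ => ?_
    have hc : ENNReal.ofReal (CP * r) ≠ ∞ := ENNReal.ofReal_ne_top
    obtain ⟨δ, hδ, hδε⟩ := ENNReal.exists_nnreal_pos_mul_lt hc
      (show (ε : ℝ≥0∞) ≠ 0 by simpa using hε.ne')
    refine (hstep δ hδ).trans ?_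
    rw [mul_add]
    refine add_le_add_right ?_ _
    rw [mul_comm]
    exact hδε.le

/-- Poincaré inequality for a nonnegative function vanishing on a large part of the ball. -/
lemma MMS.poincare_zero [BorelSpace X] (hX : MMS μ Cd CP lam) (x : X) {r : ℝ} (hr : 0 < r)
    {p : X → ℝ} {g : X → ℝ≥0∞} (hp : Integrable p μ) (hpm : Measurable p) (hp0 : ∀ y, 0 ≤ p y)
    (hg : Measurable g) (h : WGrad μ g p) {c : ℝ≥0∞}
    (hc : c * μ (ball x r) ≤ μ (ball x r ∩ {y | p y = 0})) :
    c * ∫⁻ y in ball x r, ENNReal.ofReal (p y) ∂μ ≤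
      ENNReal.ofReal (CP * r) * ∫⁻ y in ball x (lam * r), g y ∂μ := by
  refine le_trans ?_ (hX.poincare_wgrad x hr hp hg h)
  set a := ⨍ z in ball x r, p z ∂μ with ha
  have ha0 : 0 ≤ a := integral_nonneg fun y => hp0 y
  have h1 : ∫⁻ y in ball x r, ENNReal.ofReal (p y) ∂μ = ENNReal.ofReal a * μ (ball x r) := by
    rw [← ofReal_integral_eq_lintegral_ofReal hp.integrableOn (Eventually.of_forall hp0), ha,
      setAverage_eq, measureReal_def]
    have hm := hX.ball_pos x hr
    have hm' := (hX.ball_lt_top x r).ne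
    nth_rw 2 [← ENNReal.ofReal_toReal hm']
    rw [← ENNReal.ofReal_mul' ENNReal.toReal_nonneg]
    congr 1
    have : (μ (ball x r)).toReal ≠ 0 := (ENNReal.toReal_pos hm.ne' hm').ne'
    rw [smul_eq_mul]
    field_simp
  have hZ : MeasurableSet {y | p y = 0} := hpm (measurableSet_singleton 0)
  calc _ = ENNReal.ofReal a * (c * μ (ball x r)) := by rw [h1]; ring
    _ ≤ ENNReal.ofReal a * μ (ball x r ∩ {y | p y = 0}) := mul_le_mul_right hc _
    _ = ∫⁻ y in ball x r ∩ {y | p y = 0}, ENNReal.ofReal a ∂μ := by rw [setLIntegral_const]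
    _ ≤ ∫⁻ y in ball x r ∩ {y | p y = 0}, ENNReal.ofReal |p y - a| ∂μ := by
        refine setLIntegral_mono' (measurableSet_ball.inter hZ) fun y hy => ?_
        rw [show p y = 0 from hy.2, zero_sub, abs_neg, abs_of_nonneg ha0]
    _ ≤ _ := lintegral_mono_set inter_subset_left

/-! ### Annuli -/

lemma MMS.exists_mem_annulus [BorelSpace X] (hX : MMS μ Cd CP lam) {x y₀ : X} {a b : ℝ} (ha : 0 < a)
    (hab : a < b) (hb : b ≤ dist y₀ x) : ∃ y, a ≤ dist y x ∧ dist y x < b := by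
  by_contra! hcon
  set p : X → ℝ := (ball x a).indicator 1 with hp
  have hp01 : ∀ y, 0 ≤ p y := fun y => indicator_nonneg (fun _ _ => zero_le_one) y
  have hpm : Measurable p := measurable_one.indicator measurableSet_ball
  have hpi : Integrable p μ :=
    (integrable_indicator_iff measurableSet_ball).2 (integrableOn_const (hX.ball_lt_top x a).ne)
  have hug : IsUpperGradientOn 0 p univ := by
    intro γ _
    have hd : ContinuousOn (fun t => dist (γ.toFun t) x) (Icc 0 1) :=
      continuous_dist.comp_continuousOn (γ.continuousOn.prodMk continuousOn_const)
    have key : p (γ.toFun 1) = p (γ.toFun 0) := by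
      by_cases h0 : γ.toFun 0 ∈ ball x a <;> by_cases h1 : γ.toFun 1 ∈ ball x a
      · simp [hp, h0, h1]
      · obtain ⟨t, -, ht⟩ := intermediate_value_Icc zero_le_one hd
          (show a ∈ Icc _ _ from ⟨(mem_ball.1 h0).le, not_lt.1 h1⟩)
        exact absurd (hcon _ ht.ge) (not_le.2 (ht.le.trans_lt hab))
      · obtain ⟨t, -, ht⟩ := intermediate_value_Icc' zero_le_one hd
          (show a ∈ Icc _ _ from ⟨(mem_ball.1 h1).le, not_lt.1 h0⟩)
        exact absurd (hcon _ ht.ge) (not_le.2 (ht.le.trans_lt hab))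
      · simp [hp, h0, h1]
    simp [key]
  have hw : WGrad μ 0 p := hug.wgrad measurable_zero (by simp)
  set r := dist y₀ x + b
  have hr : 0 < r := by have := ha.trans hab; positivity
  set c := μ (ball x r ∩ {y | p y = 0}) / μ (ball x r)
  have hμ := hX.ball_pos x hr
  have hμ' := (hX.ball_lt_top x r).ne
  have hcc : c * μ (ball x r) ≤ μ (ball x r ∩ {y | p y = 0}) :=
    (ENNReal.div_mul_cancel hμ.ne' hμ').le
  have h := hX.poincare_zero x hr hpi hpm hp01 measurable_zero hw hcc
  simp only [Pi.zero_apply, lintegral_zero, mul_zero, nonpos_iff_eq_zero, mul_eq_zero] at h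
  rcases h with h | h
  · have h2 : 0 < μ (ball x r ∩ {y | p y = 0}) := by
      refine (hX.ball_pos y₀ (sub_pos.2 hab)).trans_le (measure_mono fun y hy => ⟨?_, ?_⟩)
      · rw [mem_ball] at hy ⊢
        have := dist_triangle y y₀ x
        show _ < dist y₀ x + b
        linarith
      · refine indicator_of_notMem (fun hy' => ?_) _
        rw [mem_ball] at hy hy'
        have := dist_triangle y₀ y x
        rw [dist_comm y₀ y] at this
        linarith
    exact (ENNReal.div_pos h2.ne' hμ').ne' h
  · have h2 : μ (ball x a) ≤ ∫⁻ y in ball x r, ENNReal.ofReal (p y) ∂μ := by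
      calc μ (ball x a) = ∫⁻ y in ball x a, ENNReal.ofReal (p y) ∂μ := by
            rw [setLIntegral_congr_fun measurableSet_ball (g := fun _ => 1)
              (fun y hy => by simp [hp, indicator_of_mem hy]), setLIntegral_one]
        _ ≤ _ := lintegral_mono_set (ball_subset_ball (by
            have : 0 ≤ dist y₀ x := dist_nonneg
            show a ≤ dist y₀ x + b
            linarith))
    rw [h] at h2
    exact (hX.ball_pos x ha).ne' (le_antisymm h2 zero_le)

lemma exists_le_dist_of_lt_diam {x : X} {R : ℝ}
    (hR' : ENNReal.ofReal R < Metric.ediam (Set.univ : Set X) / 8) :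
    ∃ y, 4 * R ≤ dist y x := by
  by_contra! hcon
  have : Metric.ediam (Set.univ : Set X) ≤ 8 * ENNReal.ofReal R := by
    refine Metric.ediam_le fun a _ b _ => ?_
    rw [edist_dist, show (8 : ℝ≥0∞) = ENNReal.ofReal 8 by simp, ← ENNReal.ofReal_mul (by norm_num)]
    refine ENNReal.ofReal_le_ofReal ?_
    have := dist_triangle_right a b x
    linarith [hcon a, hcon b]
  refine absurd hR' (not_lt.2 (ENNReal.div_le_of_le_mul ?_))
  rwa [mul_comm]

lemma MMS.measure_ball_le_annulus [BorelSpace X] (hX : MMS μ Cd CP lam) {x y₀ : X} {ρ : ℝ} (hρ : 0 < ρ)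
    (h : 4 * ρ ≤ dist y₀ x) :
    μ (ball x (4 * ρ)) ≤ ENNReal.ofReal Cd ^ 3 * μ (ball x (4 * ρ) \ ball x ρ) := by
  obtain ⟨y, h1, h2⟩ := hX.exists_mem_annulus (x := x) (a := 2 * ρ) (b := 3 * ρ) (by positivity)
    (by linarith) (by linarith : 3 * ρ ≤ dist y₀ x)
  calc μ (ball x (4 * ρ)) ≤ μ (ball y (2 ^ 3 * ρ)) :=
        measure_mono (ball_subset_ball' (by rw [dist_comm]; linarith))
    _ ≤ ENNReal.ofReal Cd ^ 3 * μ (ball y ρ) := hX.measure_ball_le y hρ 3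
    _ ≤ _ := by
        have hsub : ball y ρ ⊆ ball x (4 * ρ) \ ball x ρ := fun z hz => ⟨?_, fun hz' => ?_⟩
        · exact mul_le_mul_right (measure_mono hsub) _
        · rw [mem_ball] at hz ⊢
          linarith [dist_triangle z y x]
        · rw [mem_ball] at hz hz'
          have := dist_triangle_left y x z
          linarith

lemma MMS.tendsto_measure_ball [BorelSpace X] (hX : MMS μ Cd CP lam) {x y₀ : X} (h : y₀ ≠ x) :
    Tendsto (fun ρ => μ (ball x ρ)) (𝓝[>] 0) (𝓝 0) := by
  have hd : 0 < dist y₀ x := dist_pos.2 h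
  have h1 : Tendsto (fun ρ : ℝ => μ (ball x ρ \ {x})) (𝓝[>] 0) (𝓝 0) := by
    have h2 : Tendsto (fun ρ : ℝ => μ (ball x ρ \ {x})) (𝓝[>] 0)
        (𝓝 (μ (⋂ ρ > (0:ℝ), ball x ρ \ {x}))) := by
      refine tendsto_measure_biInter_gt (fun r _ => (measurableSet_ball.diff
        (measurableSet_singleton x)).nullMeasurableSet) (fun i j _ hij => sdiff_subset_sdiff_left
        (ball_subset_ball hij)) ⟨1, one_pos, ?_⟩
      exact (measure_mono sdiff_subset |>.trans_lt (hX.ball_lt_top x 1)).ne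
    have h3 : (⋂ ρ > (0:ℝ), ball x ρ \ {x}) = ∅ := by
      refine eq_empty_of_forall_notMem fun y hy => ?_
      simp only [mem_iInter, Set.mem_sdiff, mem_ball, mem_singleton_iff] at hy
      have hne := (hy 1 one_pos).2
      exact lt_irrefl _ (hy (dist y x) (dist_pos.2 hne)).1
    rwa [h3, measure_empty] at h2
  have h4 : Tendsto (fun ρ : ℝ => ENNReal.ofReal Cd ^ 3 * μ (ball x ρ \ {x})) (𝓝[>] 0) (𝓝 0) := by
    have := ENNReal.Tendsto.const_mul (a := ENNReal.ofReal Cd ^ 3) h1 (Or.inr (by simp))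
    rwa [mul_zero] at this
  refine tendsto_of_tendsto_of_tendsto_of_le_of_le' tendsto_const_nhds h4
    (Eventually.of_forall fun _ => zero_le) ?_
  filter_upwards [Ioc_mem_nhdsGT hd] with ρ hρ
  have := hX.measure_ball_le_annulus (x := x) (y₀ := y₀) (ρ := ρ / 4) (by linarith [hρ.1])
    (by linarith [hρ.2])
  rw [mul_div_cancel₀ _ (four_ne_zero' ℝ)] at this
  refine this.trans (mul_le_mul_right (measure_mono (sdiff_subset_sdiff_right ?_)) _)
  rw [singleton_subset_iff]
  exact mem_ball_self (by linarith [hρ.1])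

lemma MMS.measure_singleton [BorelSpace X] (hX : MMS μ Cd CP lam) {x y₀ : X} (h : y₀ ≠ x) :
    μ {x} = 0 := by
  refine le_antisymm (ge_of_tendsto (hX.tendsto_measure_ball h) ?_) zero_le
  filter_upwards [self_mem_nhdsWithin] with ρ hρ
  exact measure_mono (singleton_subset_iff.2 (mem_ball_self hρ))

lemma MMS.tendsto_lintegral_ball [BorelSpace X] (hX : MMS μ Cd CP lam) {x y₀ : X} (h : y₀ ≠ x)
    {G : X → ℝ≥0∞} (hG : ∫⁻ y, G y ∂μ ≠ ∞) :
    Tendsto (fun ρ => ∫⁻ y in ball x ρ, G y ∂μ) (𝓝[>] 0) (𝓝 0) :=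
  tendsto_setLIntegral_zero hG (hX.tendsto_measure_ball h)

/-- Radial cutoff functions. -/
lemma exists_cutoff (x : X) {a b : ℝ} (hab : a < b) :
    ∃ η : X → ℝ, LipschitzWith (1 / (b - a)).toNNReal η ∧ (∀ y, 0 ≤ η y) ∧ (∀ y, η y ≤ 1) ∧
      (∀ y, dist y x ≤ a → η y = 1) ∧ (∀ y, b ≤ dist y x → η y = 0) := by
  have hba : 0 < b - a := sub_pos.2 hab
  refine ⟨fun y => max 0 (min 1 ((b - dist y x) / (b - a))), ?_, fun y => le_max_left _ _,
    fun y => max_le zero_le_one (min_le_left _ _), fun y hy => ?_, fun y hy => ?_⟩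
  · refine LipschitzWith.const_max (LipschitzWith.const_min ?_ _) _
    refine LipschitzWith.of_dist_le_mul fun y z => ?_
    rw [Real.dist_eq, ← sub_div, abs_div, abs_of_pos hba, Real.coe_toNNReal _ (by positivity),
      div_eq_mul_one_div, mul_comm]
    gcongr
    rw [sub_sub_sub_cancel_left, abs_sub_comm]
    exact abs_dist_sub_le _ _ _
  · have : 1 ≤ (b - dist y x) / (b - a) := (one_le_div hba).2 (by linarith)
    simp [min_eq_left this]
  · have : (b - dist y x) / (b - a) ≤ 0 := div_nonpos_of_nonpos_of_nonneg (by linarith) hba.le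
    exact max_eq_left ((min_le_right _ _).trans this)

end Doubling

section Density
variable {μ : Measure X} {Cd CP lam : ℝ}

lemma WGrad.cap1_le [BorelSpace X] {g : X → ℝ≥0∞} {u : X → ℝ} (hu : Integrable u μ)
    (hg : Measurable g) (hfin : ∫⁻ y, g y ∂μ ≠ ∞) (h : WGrad μ g u) {A : Set X}
    (hA : ∀ y ∈ A, 1 ≤ u y) :
    cap1 μ A ≤ ∫⁻ y, ENNReal.ofReal |u y| ∂μ + ∫⁻ y, g y ∂μ := by
  refine ENNReal.le_of_forall_pos_le_add fun ε hε _ => ?_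
  obtain ⟨ρ, hρ, hρi, hug⟩ := h.exists_isUpperGradientOn hg (ε := ε) (by simpa using hε.ne')
  have hw := isWeakUpperGradientOn_of_forall (μ := μ) hug
  have hint : ∫⁻ y, (g y + ρ y) ∂μ ≤ ∫⁻ y, g y ∂μ + ε := by
    rw [lintegral_add_left hg]; exact add_le_add_right hρi _
  have hmem : MemN11 μ u := ⟨hu, _, hg.add hρ, hw,
    hint.trans_lt (ENNReal.add_lt_top.2 ⟨lt_top_iff_ne_top.2 hfin, ENNReal.coe_lt_top⟩)⟩
  refine (iInf₂_le_of_le u hmem <| iInf₂_le_of_le hA _ <| iInf₂_le_of_le (hg.add hρ) hw le_rfl).trans ?_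
  rw [add_assoc]
  exact add_le_add_right hint _

/-- Lower growth bound for the measure at a point of positive capacity. -/
lemma MMS.exists_growth [BorelSpace X] (hX : MMS μ Cd CP lam) {x : X} (hx : 0 < cap1 μ {x})
    {R : ℝ} (hR : 0 < R) :
    ∃ F : ℝ, 0 < F ∧ ∀ ρ : ℝ, 0 < ρ → ρ ≤ R → ENNReal.ofReal (F * ρ) ≤ μ (ball x ρ) := by
  obtain ⟨c, hc, hcx⟩ := ENNReal.lt_iff_exists_nnreal_btwn.1 hx
  have hc0 : 0 < (c : ℝ) := by exact_mod_cast hc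
  refine ⟨c / (R + 1), by positivity, fun ρ hρ hρR => ?_⟩
  obtain ⟨η, hηL, hη0, hη1, hηa, hηb⟩ := exists_cutoff x hρ
  have hηw : WGrad μ ((ball x ρ).indicator fun _ => ((1 / (ρ - 0)).toNNReal : ℝ≥0∞)) η := by
    have hcomp := (wgrad_of_lipschitz (μ := μ) hηL).comp (ζ := fun s => max s 0) (L := 1)
      (LipschitzWith.id.max_const 0) (Z := Iic 0)
      (fun a ha => Or.inl fun b => by rw [max_eq_right (show a ≤ 0 from ha)]; exact le_max_right _ _)
    simp only [max_eq_left (hη0 _)] at hcomp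
    refine hcomp.mono fun y => ?_
    by_cases hy : y ∈ ball x ρ
    · rw [indicator_of_mem hy]
      exact indicator_apply_le' (fun _ => by simp) (fun _ => zero_le)
    · have : η y = 0 := hηb y (not_lt.1 hy)
      rw [indicator_of_notMem (by simp [this])]
      exact zero_le
  have hηm : Measurable η := hηL.continuous.measurable
  have hηle : ∀ y, η y ≤ (ball x ρ).indicator (fun _ => (1:ℝ)) y := fun y => by
    by_cases hy : y ∈ ball x ρ
    · rw [indicator_of_mem hy]; exact hη1 y
    · rw [indicator_of_notMem hy, hηb y (not_lt.1 hy)]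
  have hind : Integrable ((ball x ρ).indicator (fun _ => (1:ℝ))) μ :=
    (integrable_indicator_iff measurableSet_ball).2 (integrableOn_const (hX.ball_lt_top x ρ).ne)
  have hηi : Integrable η μ := hind.mono' hηm.aestronglyMeasurable
    (Eventually.of_forall fun y => by rw [Real.norm_of_nonneg (hη0 y)]; exact hηle y)
  have hgi : ∫⁻ y, (ball x ρ).indicator (fun _ => ((1 / (ρ - 0)).toNNReal : ℝ≥0∞)) y ∂μ =
      ENNReal.ofReal (1 / ρ) * μ (ball x ρ) := by
    rw [lintegral_indicator measurableSet_ball, setLIntegral_const, sub_zero]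
    rfl
  have hcap := hηw.cap1_le hηi (measurable_const.indicator measurableSet_ball)
    (by rw [hgi]; exact ENNReal.mul_ne_top ENNReal.ofReal_ne_top (hX.ball_lt_top _ _).ne)
    (A := {x}) (by rintro _ rfl; rw [hηa _ (by simp)])
  have h1 : ∫⁻ y, ENNReal.ofReal |η y| ∂μ ≤ μ (ball x ρ) := by
    rw [← lintegral_indicator_one measurableSet_ball]
    refine lintegral_mono fun y => ?_
    rw [abs_of_nonneg (hη0 y)]
    refine (ENNReal.ofReal_le_ofReal (hηle y)).trans (le_of_eq ?_)
    by_cases hy : y ∈ ball x ρ <;> simp [hy]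
  rw [hgi] at hcap
  have h2 : (c : ℝ≥0∞) ≤ ENNReal.ofReal (1 + 1 / ρ) * μ (ball x ρ) := by
    rw [ENNReal.ofReal_add zero_le_one (by positivity), add_mul, ENNReal.ofReal_one, one_mul]
    exact hcx.le.trans (hcap.trans (add_le_add_left h1 _))
  have h3 : c / (R + 1) * ρ ≤ c / (1 + 1 / ρ) := by
    have hρ' : (0:ℝ) < ρ + 1 := by positivity
    rw [show (c : ℝ) / (1 + 1 / ρ) = c * ρ / (ρ + 1) by field_simp, div_mul_eq_mul_div]
    gcongr
  calc ENNReal.ofReal (c / (R + 1) * ρ) ≤ ENNReal.ofReal (c / (1 + 1 / ρ)) :=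
        ENNReal.ofReal_le_ofReal h3
    _ = c / ENNReal.ofReal (1 + 1 / ρ) := by
        rw [ENNReal.ofReal_div_of_pos (by positivity), ENNReal.ofReal_coe_nnreal]
    _ ≤ _ := ENNReal.div_le_of_le_mul' h2

/-- Nonnegative functions vanishing outside a ball with a weak gradient of finite mass. -/
structure Adm (μ : Measure X) (x : X) (R : ℝ) (v : X → ℝ) (g : X → ℝ≥0∞) : Prop where
  meas : Measurable v
  nonneg : ∀ y, 0 ≤ v y
  zero : ∀ y, y ∉ ball x R → v y = 0
  integrable : Integrable v μ
  gmeas : Measurable g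
  gfin : ∫⁻ y, g y ∂μ ≠ ∞
  wgrad : WGrad μ g v

lemma MMS.integrable_of_le [BorelSpace X] (hX : MMS μ Cd CP lam) {x : X} {R : ℝ} {v : X → ℝ} {M : ℝ}
    (hm : Measurable v) (h0 : ∀ y, 0 ≤ v y) (hM : ∀ y, v y ≤ M)
    (hz : ∀ y, y ∉ ball x R → v y = 0) : Integrable v μ := by
  have hind : Integrable ((ball x R).indicator (fun _ => M)) μ :=
    (integrable_indicator_iff measurableSet_ball).2 (integrableOn_const (hX.ball_lt_top x R).ne)
  refine hind.mono' hm.aestronglyMeasurable (Eventually.of_forall fun y => ?_)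
  rw [Real.norm_of_nonneg (h0 y)]
  by_cases hy : y ∈ ball x R
  · rw [indicator_of_mem hy]; exact hM y
  · rw [indicator_of_notMem hy, hz y hy]

/-- If the mean value of `q` is at most `1/2`, the set where `q = 1` is small. -/
lemma MMS.measure_level_one_le [BorelSpace X] (hX : MMS μ Cd CP lam) (x : X) {r : ℝ} (hr : 0 < r)
    {q : X → ℝ} {e : X → ℝ≥0∞} (hq : Integrable q μ) (hqm : Measurable q) (hq0 : ∀ y, 0 ≤ q y)
    (he : Measurable e) (h : WGrad μ e q)
    (hhalf : 2 * ∫⁻ y in ball x r, ENNReal.ofReal (q y) ∂μ ≤ μ (ball x r)) :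
    μ (ball x r ∩ {y | 1 ≤ q y}) ≤
      2 * (ENNReal.ofReal (CP * r) * ∫⁻ y in ball x (lam * r), e y ∂μ) := by
  refine le_trans ?_ (mul_le_mul_right (hX.poincare_wgrad x hr hq he h) _)
  set a := ⨍ z in ball x r, q z ∂μ with ha
  have hm := hX.ball_pos x hr
  have hm' := (hX.ball_lt_top x r).ne
  have ha2 : a ≤ 1 / 2 := by
    rw [← ofReal_integral_eq_lintegral_ofReal hq.integrableOn (Eventually.of_forall hq0)] at hhalf
    rw [ha, setAverage_eq, measureReal_def, smul_eq_mul, inv_mul_le_iff₀ (ENNReal.toReal_pos hm.ne' hm')]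
    have := ENNReal.toReal_mono hm' hhalf
    rw [ENNReal.toReal_mul, ENNReal.toReal_ofReal (integral_nonneg fun y => hq0 y)] at this
    simp only [ENNReal.toReal_ofNat] at this
    linarith
  have hZ : MeasurableSet {y | 1 ≤ q y} := hqm measurableSet_Ici
  calc μ (ball x r ∩ {y | 1 ≤ q y})
      = 2 * ∫⁻ y in ball x r ∩ {y | 1 ≤ q y}, ENNReal.ofReal (1 / 2) ∂μ := by
        rw [setLIntegral_const, ← mul_assoc, ENNReal.ofReal_div_of_pos two_pos, ENNReal.ofReal_one,
          ENNReal.ofReal_ofNat, ENNReal.mul_div_cancel (by simp) (by simp), one_mul]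
    _ ≤ 2 * ∫⁻ y in ball x r ∩ {y | 1 ≤ q y}, ENNReal.ofReal |q y - a| ∂μ := by
        refine mul_le_mul_right (setLIntegral_mono' (measurableSet_ball.inter hZ) fun y hy => ?_) _
        have : 1 ≤ q y := hy.2
        exact ENNReal.ofReal_le_ofReal ((by linarith : 1 / 2 ≤ q y - a).trans (le_abs_self _))
    _ ≤ _ := mul_le_mul_right (lintegral_mono_set inter_subset_left) _

/-- Truncation between two levels. -/
lemma Adm.window [BorelSpace X] {x : X} {R : ℝ} {v : X → ℝ} {g : X → ℝ≥0∞}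
    (hX : MMS μ Cd CP lam) (h : Adm μ x R v g) {t ε : ℝ} (ht : 0 ≤ t) (hε : 0 < ε) :
    ∃ q : X → ℝ, Adm μ x R q ({y | t < v y ∧ v y < t + ε}.indicator
        fun y => ENNReal.ofReal (1 / ε) * g y) ∧
      (∀ y, q y ≤ 1) ∧ (∀ y, t + ε ≤ v y → q y = 1) ∧ (∀ y, v y ≤ t → q y = 0) := by
  set ζ : ℝ → ℝ := fun s => max 0 (min 1 ((s - t) / ε)) with hζdef
  have hζ : LipschitzWith (1 / ε).toNNReal ζ := by
    refine LipschitzWith.const_max (LipschitzWith.const_min ?_ _) _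
    refine LipschitzWith.of_dist_le_mul fun y z => ?_
    rw [Real.dist_eq, ← sub_div, abs_div, abs_of_pos hε, Real.coe_toNNReal _ (by positivity),
      div_eq_mul_one_div, mul_comm, sub_sub_sub_cancel_right, Real.dist_eq]
  have hζ0 : ∀ s, 0 ≤ ζ s := fun s => le_max_left _ _
  have hζ1 : ∀ s, ζ s ≤ 1 := fun s => max_le zero_le_one (min_le_left _ _)
  have hlow : ∀ s, s ≤ t → ζ s = 0 := fun s hs =>
    max_eq_left ((min_le_right _ _).trans (div_nonpos_of_nonpos_of_nonneg (by linarith) hε.le))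
  have hhigh : ∀ s, t + ε ≤ s → ζ s = 1 := fun s hs => by
    have : 1 ≤ (s - t) / ε := (one_le_div hε).2 (by linarith)
    simp [hζdef, min_eq_left this]
  have hS : MeasurableSet {y | t < v y ∧ v y < t + ε} := h.meas measurableSet_Ioo
  have hm : Measurable fun y => ζ (v y) := hζ.continuous.measurable.comp h.meas
  have hz : ∀ y, y ∉ ball x R → ζ (v y) = 0 := fun y hy => hlow _ (by rw [h.zero y hy]; exact ht)
  have hgm : Measurable ({y | t < v y ∧ v y < t + ε}.indicator
      fun y => ENNReal.ofReal (1 / ε) * g y) := (h.gmeas.const_mul _).indicator hS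
  refine ⟨fun y => ζ (v y), ⟨hm, fun y => hζ0 _, hz,
    hX.integrable_of_le hm (fun y => hζ0 _) (fun y => hζ1 _) hz, hgm, ?_, ?_⟩, fun y => hζ1 _,
    fun y => hhigh _, fun y => hlow _⟩
  · refine ((lintegral_mono fun y => indicator_le_self _ _ y).trans_lt ?_).ne
    rw [lintegral_const_mul _ h.gmeas]
    exact ENNReal.mul_lt_top ENNReal.ofReal_lt_top (lt_top_iff_ne_top.2 h.gfin)
  · refine (h.wgrad.comp hζ (Z := Iic t ∪ Ici (t + ε)) ?_).mono fun y => ?_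
    · rintro a (ha | ha)
      · exact Or.inl fun b => by rw [hlow a ha]; exact hζ0 b
      · exact Or.inr fun b => by rw [hhigh a ha]; exact hζ1 b
    · refine le_of_eq (congrFun (congrArg₂ _ ?_ rfl) y)
      ext y
      simp

lemma MMS.half_le_of_scale [BorelSpace X] (hX : MMS μ Cd CP lam) (x : X) {r θ : ℝ} (hr : 0 < r)
    {F : ℝ} (hF : 0 < F) (hgrow : ENNReal.ofReal (F * r) ≤ μ (ball x r)) (hθ : 0 ≤ θ)
    {I : ℝ≥0∞} (hI : I ≤ ENNReal.ofReal (θ * F / CP)) :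
    ENNReal.ofReal (CP * r) * I ≤ ENNReal.ofReal θ * μ (ball x r) := by
  have hCP := hX.hCP
  calc _ ≤ ENNReal.ofReal (CP * r) * ENNReal.ofReal (θ * F / CP) := mul_le_mul_right hI _
    _ = ENNReal.ofReal θ * ENNReal.ofReal (F * r) := by
        rw [← ENNReal.ofReal_mul (by positivity), ← ENNReal.ofReal_mul hθ]
        congr 1
        field_simp
    _ ≤ _ := mul_le_mul_right hgrow _

lemma exists_window_index [BorelSpace X] {v : X → ℝ} (hv : Measurable v) {g : X → ℝ≥0∞}
    {κ : ℝ≥0∞} (hκ0 : κ ≠ 0) (hκt : κ ≠ ∞) (hκ : ∫⁻ y, g y ∂μ ≤ κ) {ε : ℝ} (hε : 0 < ε)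
    (B : ℕ → Set X) (hB : ∀ k, MeasurableSet (B k))
    (hBt : ∀ k, μ (B k) ≠ ∞) (N : ℕ) {J : ℕ} (hJ : 0 < J) :
    ∃ j < J, ∫⁻ y in {y | j * ε < v y ∧ v y < j * ε + ε}, g y ∂μ ≤ 2 / J * κ ∧
      ∀ k < N, μ (B k ∩ {y | j * ε < v y ∧ v y < j * ε + ε}) ≤ 2 * N / J * μ (B k) := by
  set W : ℕ → Set X := fun j => {y | j * ε < v y ∧ v y < j * ε + ε} with hW
  have hWm : ∀ j, MeasurableSet (W j) := fun j => hv measurableSet_Ioo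
  have hWd : Pairwise fun i j => Disjoint (W i) (W j) := by
    have key : ∀ i j : ℕ, i < j → Disjoint (W i) (W j) := by
      intro i j hij
      refine disjoint_left.2 fun y hy hy' => ?_
      have : (i : ℝ) + 1 ≤ j := by exact_mod_cast hij
      have h1 : v y < i * ε + ε := hy.2
      have h2 : j * ε < v y := hy'.1
      nlinarith
    intro i j hij
    rcases lt_or_gt_of_ne hij with h | h
    exacts [key i j h, (key j i h).symm]
  set S : ℕ → ℝ≥0∞ := fun j => (∫⁻ y in W j, g y ∂μ) / κ +
    ∑ k ∈ Finset.range N, (μ (B k ∩ W j) / μ (B k)) / N with hS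
  have hsum : ∑ j ∈ Finset.range J, S j ≤ 2 := by
    rw [Finset.sum_add_distrib, ← one_add_one_eq_two]
    refine add_le_add ?_ ?_
    · simp_rw [div_eq_mul_inv]
      rw [← Finset.sum_mul, ← div_eq_mul_inv]
      refine ENNReal.div_le_of_le_mul ?_
      rw [one_mul, ← lintegral_biUnion_finset (fun i _ j _ hij => hWd hij) (fun j _ => hWm j)]
      exact (setLIntegral_le_lintegral _ _).trans hκ
    · rw [Finset.sum_comm]
      have : ∀ k ∈ Finset.range N, ∑ j ∈ Finset.range J, (μ (B k ∩ W j) / μ (B k)) / N ≤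
          1 / N := by
        intro k _
        simp_rw [div_eq_mul_inv]
        rw [← Finset.sum_mul, ← Finset.sum_mul]
        refine mul_le_mul_left ?_ _
        rw [← measure_biUnion_finset (fun i _ j _ hij => (hWd hij).mono inter_subset_right
          inter_subset_right) (fun j _ => (hB k).inter (hWm j)), ← div_eq_mul_inv]
        refine ENNReal.div_le_of_le_mul ?_
        rw [one_mul]
        exact measure_mono (iUnion₂_subset fun _ _ => inter_subset_left)
      refine (Finset.sum_le_sum this).trans ?_
      rw [Finset.sum_const, Finset.card_range, nsmul_eq_mul, mul_one_div]
      exact ENNReal.div_self_le_one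
  have hex : ∃ j ∈ Finset.range J, S j ≤ 2 / J := by
    by_contra! hcon
    have h1 := ENNReal.sum_lt_sum_of_nonempty (Finset.nonempty_range_iff.2 hJ.ne') hcon
    rw [Finset.sum_const, Finset.card_range, nsmul_eq_mul,
      ENNReal.mul_div_cancel (by exact_mod_cast hJ.ne') (by simp)] at h1
    exact absurd hsum (not_le.2 h1)
  obtain ⟨j, hj, hSj⟩ := hex
  refine ⟨j, Finset.mem_range.1 hj, ?_, fun k hk => ?_⟩
  · exact (ENNReal.div_le_iff hκ0 hκt).1 (le_self_add.trans hSj)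
  · have h1 : (μ (B k ∩ W j) / μ (B k)) / N ≤ 2 / J :=
      (Finset.single_le_sum (f := fun k => (μ (B k ∩ W j) / μ (B k)) / N) (fun _ _ => zero_le)
        (Finset.mem_range.2 hk)).trans (le_add_self.trans hSj)
    have hN : (N : ℝ≥0∞) ≠ 0 := by exact_mod_cast (Nat.zero_lt_of_lt hk).ne'
    rw [ENNReal.div_le_iff hN (by simp)] at h1
    rcases eq_or_ne (μ (B k)) 0 with h0 | h0
    · exact (measure_mono inter_subset_left).trans (by rw [h0]; simp)
    · have := (ENNReal.div_le_iff h0 (hBt k)).1 h1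
      refine this.trans (le_of_eq ?_)
      rw [← ENNReal.mul_div_right_comm]

/-- At points where the measure grows at least linearly, functions of small energy have small
level sets at every scale. -/
lemma MMS.density_level [BorelSpace X] (hX : MMS μ Cd CP lam) {x y₀ : X} {R : ℝ} (hR : 0 < R)
    (hy₀ : 4 * R ≤ dist y₀ x) {F : ℝ} (hF : 0 < F)
    (hgrow : ∀ ρ : ℝ, 0 < ρ → ρ ≤ 8 * R → ENNReal.ofReal (F * ρ) ≤ μ (ball x ρ))
    {v : X → ℝ} {g : X → ℝ≥0∞} (h : Adm μ x R v g) {T κ : ℝ} (hT : 0 < T) (hκ0 : 0 < κ)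
    (hκ : ∫⁻ y, g y ∂μ ≤ ENNReal.ofReal κ) (hsmall : 8 * CP * Cd ^ 4 * κ < T * F)
    {ρ : ℝ} (hρ : 0 < ρ) (hρR : ρ ≤ 4 * R) :
    μ (ball x ρ ∩ {y | T ≤ v y}) ≤ ENNReal.ofReal (4 * CP * κ / (T * F)) * μ (ball x ρ) := by
  have hCP := hX.hCP
  have hCd := hX.hCd
  set θ := 4 * CP * κ / (T * F) with hθ
  have hθ0 : 0 < θ := by positivity
  have hCd0 : 0 < Cd := by linarith
  have hθCd : 2 * Cd ^ 4 * θ < 1 := by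
    rw [hθ, mul_div_assoc', div_lt_one (by positivity)]; linarith
  have hθCd1 : 2 * Cd * θ < 1 := by
    refine lt_of_le_of_lt ?_ hθCd
    have : Cd ≤ Cd ^ 4 := le_self_pow₀ hCd (by norm_num)
    gcongr
  -- the number of scales
  obtain ⟨N, hN1, hN2⟩ : ∃ N : ℕ, 4 * R ≤ 2 ^ N * ρ ∧ 2 ^ N * ρ ≤ 8 * R := by
    have hex : ∃ N : ℕ, 4 * R ≤ 2 ^ N * ρ := by
      obtain ⟨N, hN⟩ := pow_unbounded_of_one_lt (4 * R / ρ) (one_lt_two (α := ℝ))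
      exact ⟨N, ((div_lt_iff₀ hρ).1 hN).le⟩
    classical
    refine ⟨Nat.find hex, Nat.find_spec hex, ?_⟩
    rcases hn : Nat.find hex with _ | n
    · simp; linarith
    · have := Nat.find_min hex (m := n) (by omega)
      rw [not_le] at this
      rw [pow_succ']
      linarith
  obtain ⟨J, hJ0, hJ⟩ : ∃ J : ℕ, 0 < J ∧ 2 * Cd * (θ + 2 * (N + 1 : ℕ) / J) ≤ 1 := by
    obtain ⟨J, hJ⟩ := exists_nat_gt (4 * Cd * (N + 1 : ℕ) / (1 - 2 * Cd * θ))
    have h1 : 0 < 1 - 2 * Cd * θ := by linarith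
    have hJ0 : (0:ℝ) < J := lt_of_le_of_lt (by positivity) hJ
    refine ⟨J, by exact_mod_cast hJ0, ?_⟩
    rw [div_lt_iff₀ h1] at hJ
    have : 2 * Cd * (2 * (N + 1 : ℕ) / J) ≤ 1 - 2 * Cd * θ := by
      rw [mul_div_assoc', div_le_iff₀ hJ0]; linarith
    linarith
  have hJr : (0:ℝ) < J := by exact_mod_cast hJ0
  set ε := T / J with hε
  have hε0 : 0 < ε := by positivity
  obtain ⟨j, hjJ, hj1, hj2⟩ := exists_window_index h.meas (ENNReal.ofReal_pos.2 hκ0).ne'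
    ENNReal.ofReal_ne_top hκ hε0 (fun k => ball x (2 ^ k * ρ)) (fun k => measurableSet_ball)
    (fun k => (hX.ball_lt_top _ _).ne) (N + 1) hJ0
  obtain ⟨q, hq, hq1, hqhigh, hqlow⟩ := h.window hX (t := j * ε) (by positivity) hε0
  set W := {y | j * ε < v y ∧ v y < j * ε + ε} with hW
  have hWm : MeasurableSet W := h.meas measurableSet_Ioo
  set e := W.indicator fun y => ENNReal.ofReal (1 / ε) * g y with he
  have hI : ∫⁻ y, e y ∂μ ≤ ENNReal.ofReal (θ / 2 * F / CP) := by
    rw [he, lintegral_indicator hWm, lintegral_const_mul _ h.gmeas]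
    refine (mul_le_mul_right hj1 _).trans (le_of_eq ?_)
    rw [show (2 / J : ℝ≥0∞) = ENNReal.ofReal (2 / J) by
        rw [ENNReal.ofReal_div_of_pos hJr, ENNReal.ofReal_natCast, ENNReal.ofReal_ofNat],
      ← ENNReal.ofReal_mul (by positivity), ← ENNReal.ofReal_mul (by positivity)]
    congr 1
    rw [hθ, hε]
    field_simp
    norm_num
  have hIr : ∀ r, ∫⁻ y in ball x (lam * r), e y ∂μ ≤ ENNReal.ofReal (θ / 2 * F / CP) :=
    fun r => (setLIntegral_le_lintegral _ _).trans hI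
  have hpos : ∀ k : ℕ, 0 < 2 ^ k * ρ := fun k => by positivity
  have hle : ∀ k, k ≤ N → 2 ^ k * ρ ≤ 8 * R := fun k hk =>
    le_trans (mul_le_mul_of_nonneg_right (pow_le_pow_right₀ one_le_two hk) hρ.le) hN2
  -- from mean at most one half to small density
  have hstep : ∀ k, k ≤ N →
      2 * ∫⁻ y in ball x (2 ^ k * ρ), ENNReal.ofReal (q y) ∂μ ≤ μ (ball x (2 ^ k * ρ)) →
      μ (ball x (2 ^ k * ρ) ∩ {y | 1 ≤ q y}) ≤ ENNReal.ofReal θ * μ (ball x (2 ^ k * ρ)) := by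
    intro k hk hhalf
    refine (hX.measure_level_one_le x (hpos k) hq.integrable hq.meas hq.nonneg hq.gmeas hq.wgrad
      hhalf).trans ?_
    refine (mul_le_mul_right (hX.half_le_of_scale x (hpos k) hF (hgrow _ (hpos k) (hle k hk))
      (θ := θ / 2) (by positivity) (hIr _)) 2).trans (le_of_eq ?_)
    rw [← mul_assoc, ← ENNReal.ofReal_ofNat, ← ENNReal.ofReal_mul (by norm_num)]
    congr 2
    ring
  have hhalf : ∀ i, i ≤ N → 2 * ∫⁻ y in ball x (2 ^ (N - i) * ρ), ENNReal.ofReal (q y) ∂μ ≤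
      μ (ball x (2 ^ (N - i) * ρ)) := by
    intro i
    induction i with
    | zero =>
      intro _
      rw [Nat.sub_zero]
      have hr := hpos N
      set r := 2 ^ N * ρ
      have hc : (ENNReal.ofReal Cd ^ 4)⁻¹ * μ (ball x r) ≤ μ (ball x r ∩ {y | q y = 0}) := by
        rw [ENNReal.inv_mul_le_iff (ENNReal.pow_pos (ENNReal.ofReal_pos.2 hCd0) 4).ne' (by simp)]
        have hsub : ball x (4 * R) \ ball x R ⊆ ball x r ∩ {y | q y = 0} := fun y hy =>
          ⟨ball_subset_ball hN1 hy.1, hq.zero y hy.2⟩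
        calc μ (ball x r) ≤ μ (ball x (2 ^ 1 * (4 * R))) :=
              measure_mono (ball_subset_ball (by linarith))
          _ ≤ ENNReal.ofReal Cd ^ 1 * μ (ball x (4 * R)) := hX.measure_ball_le x (by positivity) 1
          _ ≤ ENNReal.ofReal Cd ^ 1 * (ENNReal.ofReal Cd ^ 3 * μ (ball x (4 * R) \ ball x R)) :=
              mul_le_mul_right (hX.measure_ball_le_annulus hR hy₀) _
          _ = ENNReal.ofReal Cd ^ 4 * μ (ball x (4 * R) \ ball x R) := by ring
          _ ≤ _ := mul_le_mul_right (measure_mono hsub) _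
      have h1 := (hX.poincare_zero x hr hq.integrable hq.meas hq.nonneg hq.gmeas hq.wgrad hc).trans
        (hX.half_le_of_scale x hr hF (hgrow _ hr hN2) (θ := θ / 2) (by positivity) (hIr _))
      rw [ENNReal.inv_mul_le_iff (ENNReal.pow_pos (ENNReal.ofReal_pos.2 hCd0) 4).ne' (by simp)] at h1
      refine (mul_le_mul_right h1 2).trans ?_
      rw [← mul_assoc, ← mul_assoc]
      refine (mul_le_mul_left ?_ _).trans (one_mul _).le
      rw [← ENNReal.ofReal_ofNat, ← ENNReal.ofReal_pow hCd0.le,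
        ← ENNReal.ofReal_mul (by norm_num), ← ENNReal.ofReal_mul (by positivity),
        ← ENNReal.ofReal_one]
      exact ENNReal.ofReal_le_ofReal (by linarith [pow_pos hCd0 4, mul_pos (pow_pos hCd0 4) hθ0])
    | succ i ih =>
      intro hi
      have hk : N - i ≤ N := Nat.sub_le _ _
      have h1 := hstep _ hk (ih (by omega))
      have h2 := hj2 (N - i) (by omega)
      have hki : N - i = N - (i + 1) + 1 := by omega
      have h3 : ∫⁻ y in ball x (2 ^ (N - i) * ρ), ENNReal.ofReal (q y) ∂μ ≤
          ENNReal.ofReal (θ + 2 * (N + 1 : ℕ) / J) * μ (ball x (2 ^ (N - i) * ρ)) := by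
        rw [ENNReal.ofReal_add hθ0.le (by positivity), add_mul]
        refine le_trans ?_ (add_le_add h1 (h2.trans (le_of_eq ?_)))
        · refine le_trans ?_ (measure_union_le _ _)
          have hS : MeasurableSet ({y | 1 ≤ q y} ∪ W) := (hq.meas measurableSet_Ici).union hWm
          rw [← inter_union_distrib_left, ← setLIntegral_one, inter_comm,
            ← Measure.restrict_restrict hS, ← lintegral_indicator hS]
          refine lintegral_mono fun y => ?_
          by_cases hy : y ∈ {y | 1 ≤ q y} ∪ W
          · rw [indicator_of_mem hy, ← ENNReal.ofReal_one]
            exact ENNReal.ofReal_le_ofReal (hq1 y)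
          · rw [indicator_of_notMem hy, nonpos_iff_eq_zero, ENNReal.ofReal_eq_zero]
            refine (hqlow y ?_).le
            by_contra hc
            refine hy ?_
            by_cases hc' : v y < j * ε + ε
            · exact Or.inr ⟨not_le.1 hc, hc'⟩
            · exact Or.inl (hqhigh y (not_lt.1 hc')).ge
        · rw [ENNReal.ofReal_div_of_pos hJr, ENNReal.ofReal_mul (by norm_num),
            ENNReal.ofReal_natCast, ENNReal.ofReal_natCast, ENNReal.ofReal_ofNat]
      calc 2 * ∫⁻ y in ball x (2 ^ (N - (i + 1)) * ρ), ENNReal.ofReal (q y) ∂μ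
          ≤ 2 * ∫⁻ y in ball x (2 ^ (N - i) * ρ), ENNReal.ofReal (q y) ∂μ := by
            refine mul_le_mul_right (lintegral_mono_set (ball_subset_ball ?_)) _
            gcongr
            · norm_num
            · omega
        _ ≤ 2 * (ENNReal.ofReal (θ + 2 * (N + 1 : ℕ) / J) * μ (ball x (2 ^ (N - i) * ρ))) :=
            mul_le_mul_right h3 _
        _ ≤ 2 * (ENNReal.ofReal (θ + 2 * (N + 1 : ℕ) / J) *
              (ENNReal.ofReal Cd ^ 1 * μ (ball x (2 ^ (N - (i + 1)) * ρ)))) := by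
            refine mul_le_mul_right (mul_le_mul_right ?_ _) _
            rw [hki, pow_succ', mul_assoc]
            have := hX.measure_ball_le x (hpos (N - (i + 1))) 1
            rwa [pow_one] at this
        _ = ENNReal.ofReal (2 * Cd * (θ + 2 * (N + 1 : ℕ) / J)) *
              μ (ball x (2 ^ (N - (i + 1)) * ρ)) := by
            rw [ENNReal.ofReal_mul (by positivity), ENNReal.ofReal_mul (by norm_num),
              ENNReal.ofReal_ofNat]
            ring
        _ ≤ 1 * μ (ball x (2 ^ (N - (i + 1)) * ρ)) := by
            refine mul_le_mul_left ?_ _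
            rw [← ENNReal.ofReal_one]
            exact ENNReal.ofReal_le_ofReal hJ
        _ = _ := one_mul _
  have h0 := hhalf N le_rfl
  have hfin := hstep 0 (Nat.zero_le _) (by rw [Nat.sub_self] at h0; exact h0)
  rw [pow_zero, one_mul] at hfin
  have hsub : ball x ρ ∩ {y | T ≤ v y} ⊆ ball x ρ ∩ {y | 1 ≤ q y} := by
    rintro y ⟨hy1, hy2⟩
    refine ⟨hy1, (hqhigh y ?_).ge⟩
    have h1 : T ≤ v y := hy2
    have h2 : (j : ℝ) + 1 ≤ J := by exact_mod_cast hjJ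
    calc j * ε + ε = (j + 1) * ε := by ring
      _ ≤ J * ε := by gcongr
      _ = T := by rw [hε]; field_simp
      _ ≤ v y := h1
  exact (measure_mono hsub).trans hfin

end Density

section Chains

/-- Inf-convolution of a truncated function with a multiple of the distance. -/
def lipMinorant (G : X → ℝ≥0∞) (n : ℕ) (z : X) : ℝ≥0∞ := ⨅ y, (min (G y) n + n * edist z y)

lemma lipMinorant_le (G : X → ℝ≥0∞) (n : ℕ) (z : X) : lipMinorant G n z ≤ min (G z) n :=
  (iInf_le _ z).trans (by simp)

lemma lipMinorant_mono (G : X → ℝ≥0∞) {m n : ℕ} (h : m ≤ n) (z : X) :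
    lipMinorant G m z ≤ lipMinorant G n z :=
  iInf_mono fun y => add_le_add (min_le_min_left _ (by exact_mod_cast h))
    (mul_le_mul_left (by exact_mod_cast h) _)

lemma lipMinorant_le_add (G : X → ℝ≥0∞) (n : ℕ) (z z' : X) :
    lipMinorant G n z ≤ lipMinorant G n z' + n * edist z z' := by
  rw [lipMinorant, lipMinorant, ENNReal.iInf_add]
  refine iInf_mono fun y => ?_
  rw [add_assoc, ← mul_add]
  refine add_le_add_right (mul_le_mul_right ?_ _) _
  rw [add_comm]
  exact edist_triangle _ _ _

lemma continuous_lipMinorant (G : X → ℝ≥0∞) (n : ℕ) : Continuous (lipMinorant G n) := by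
  refine continuous_of_le_add_edist n (by simp) fun z z' => ?_
  exact lipMinorant_le_add G n z z'

lemma le_lipMinorant {G : X → ℝ≥0∞} {δ : ℝ≥0∞} (hδ : ∀ y, δ ≤ G y) {n : ℕ} (hn : δ ≤ n) (z : X) :
    δ ≤ lipMinorant G n z :=
  le_iInf fun y => (le_min (hδ y) hn).trans le_self_add

lemma eventually_le_lipMinorant {G : X → ℝ≥0∞} (hG : LowerSemicontinuous G)
    {ι : Type*} {l : Filter ι} {n : ι → ℕ} (hn : Tendsto n l atTop) {x : ι → X} {y : X}
    (hx : Tendsto x l (𝓝 y)) {c : ℝ≥0∞} (hc : c < G y) :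
    ∀ᶠ i in l, c ≤ lipMinorant G (n i) (x i) := by
  obtain ⟨ε, hε, hball⟩ := Metric.mem_nhds_iff.1 (hG y c hc)
  have hc' : c ≠ ∞ := hc.ne_top
  obtain ⟨m, hm⟩ := ENNReal.exists_nat_gt hc'
  obtain ⟨m', hm'⟩ := ENNReal.exists_nat_gt (ENNReal.div_ne_top hc'
    (ENNReal.ofReal_pos.2 (half_pos hε)).ne')
  filter_upwards [hx (ball_mem_nhds y (half_pos hε)), hn.eventually_ge_atTop m,
    hn.eventually_ge_atTop m'] with i h1 h2 h3
  refine le_iInf fun z => ?_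
  by_cases hz : dist (x i) z < ε / 2
  · refine le_trans (le_min ?_ ?_) le_self_add
    · refine (hball ?_ : c < G z).le
      have h1' : dist (x i) y < ε / 2 := h1
      rw [mem_ball]
      rw [dist_comm] at hz
      linarith [dist_triangle z (x i) y]
    · exact hm.le.trans (by exact_mod_cast h2)
  · refine le_trans ?_ le_add_self
    rw [ENNReal.div_lt_iff (Or.inl (ENNReal.ofReal_pos.2 (half_pos hε)).ne')
      (Or.inl ENNReal.ofReal_ne_top)] at hm'
    refine hm'.le.trans (mul_le_mul' (by exact_mod_cast h3) ?_)
    rw [edist_dist]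
    exact ENNReal.ofReal_le_ofReal (not_lt.1 hz)

/-- The cost of a discrete path `p 0, …, p N`. -/
def chainCost (G φ : X → ℝ≥0∞) (p : ℕ → X) (N : ℕ) : ℝ≥0∞ :=
  φ (p N) + ∑ i ∈ Finset.range N, G (p i) * edist (p i) (p (i + 1))

/-- The infimum of the costs of discrete paths from `z` with steps of length at most `r`. -/
def chainInf (G φ : X → ℝ≥0∞) (r : ℝ) (z : X) : ℝ≥0∞ :=
  ⨅ (p : ℕ → X) (N : ℕ) (_ : p 0 = z) (_ : ∀ i < N, dist (p i) (p (i + 1)) ≤ r), chainCost G φ p N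

lemma chainInf_le (G φ : X → ℝ≥0∞) (r : ℝ) (z : X) : chainInf G φ r z ≤ φ z := by
  refine (iInf₂_le_of_le (fun _ => z) 0 <| iInf₂_le_of_le rfl (by simp) le_rfl).trans ?_
  simp [chainCost]

lemma chainInf_mono {G G' φ : X → ℝ≥0∞} {r r' : ℝ} (hG : ∀ y, G y ≤ G' y) (hr : r' ≤ r) (z : X) :
    chainInf G φ r z ≤ chainInf G' φ r' z := by
  refine iInf_mono fun p => iInf_mono fun N => iInf_mono fun _ => le_iInf fun h => ?_
  refine iInf_le_of_le (fun i hi => (h i hi).trans hr) ?_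
  exact add_le_add_right (Finset.sum_le_sum fun i _ => mul_le_mul_left (hG _) _) _

lemma chainInf_step (G φ : X → ℝ≥0∞) {r : ℝ} {z z' : X} (h : dist z z' ≤ r) :
    chainInf G φ r z ≤ chainInf G φ r z' + G z * edist z z' := by
  unfold chainInf
  simp only [ENNReal.iInf_add]
  refine le_iInf fun p => le_iInf fun N => le_iInf fun h0 => le_iInf fun hp => ?_
  refine iInf₂_le_of_le (fun i => Nat.casesOn i z p) (N + 1) <| iInf₂_le_of_le rfl ?_ ?_
  · rintro (_ | i) hi
    · simpa [h0] using h
    · exact hp i (by omega)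
  · simp only [chainCost, Finset.sum_range_succ' _ N, h0]
    rw [add_assoc]
    exact le_rfl

/-- Reparametrization of a discrete path by (normalized) arc length. -/
lemma exists_reparam [BorelSpace X] {G : X → ℝ≥0∞} (p : ℕ → X) (N : ℕ) {r : ℝ} (hr : 0 ≤ r)
    (hp : ∀ i < N, dist (p i) (p (i + 1)) ≤ r) :
    ∃ (γ : ℝ → X) (L : ℝ), 0 ≤ L ∧
      ENNReal.ofReal L = ∑ i ∈ Finset.range N, edist (p i) (p (i + 1)) ∧
      γ 0 = p 0 ∧ γ 1 = p N ∧ (∀ s t, dist (γ s) (γ t) ≤ L * |s - t| + r) ∧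
      Measurable (fun t => G (γ t)) ∧
      ENNReal.ofReal L * ∫⁻ t in Icc (0:ℝ) 1, G (γ t) ≤
        ∑ i ∈ Finset.range N, G (p i) * edist (p i) (p (i + 1)) := by
  classical
  set S : ℕ → ℝ := fun k => ∑ i ∈ Finset.range k, dist (p i) (p (i + 1)) with hS
  have hSmono : Monotone S := monotone_nat_of_le_succ fun n => by
    simp only [hS, Finset.sum_range_succ]; linarith [dist_nonneg (x := p n) (y := p (n + 1))]
  have hS0 : S 0 = 0 := by simp [hS]
  have hSs : ∀ i, S (i + 1) = S i + dist (p i) (p (i + 1)) := fun i => by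
    simp only [hS, Finset.sum_range_succ]
  have hdist : ∀ i j, i ≤ j → dist (p i) (p j) ≤ S j - S i := fun i j hij => by
    have := dist_le_Ico_sum_dist p hij
    rwa [Finset.sum_Ico_eq_sub _ hij] at this
  set L := S N with hL
  have hL0 : 0 ≤ L := by rw [← hS0]; exact hSmono (Nat.zero_le _)
  set k : ℝ → ℕ := fun t => Nat.findGreatest (fun i => S i ≤ L * t) N with hk
  have hkN : ∀ t, k t ≤ N := fun t => Nat.findGreatest_le _
  have hkmono : Monotone k := fun s t hst =>
    Nat.findGreatest_mono_left (fun i hi => le_trans hi (mul_le_mul_of_nonneg_left hst hL0)) N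
  have hkS : ∀ t, k t ≠ 0 → S (k t) ≤ L * t := fun t ht =>
    Nat.findGreatest_of_ne_zero (P := fun i => S i ≤ L * t) rfl ht
  have hkS' : ∀ t, 0 ≤ t → S (k t) ≤ L * t := fun t ht => by
    by_cases h : k t = 0
    · rw [h, hS0]; positivity
    · exact hkS t h
  have hkG : ∀ t, k t < N → L * t < S (k t + 1) := fun t ht => by
    have := Nat.findGreatest_is_greatest (P := fun i => S i ≤ L * t) (n := N) (k := k t + 1)
      (Nat.lt_succ_self _) ht
    exact not_le.1 this
  have hk1 : k 1 = N := by
    refine le_antisymm (hkN 1) ?_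
    exact Nat.le_findGreatest le_rfl (by rw [mul_one])
  have hkm : Measurable k := hkmono.measurable
  refine ⟨fun t => p (k t), L, hL0, ?_, ?_, by simp only [hk1], ?_, ?_, ?_⟩
  · rw [hL, hS, ENNReal.ofReal_sum_of_nonneg fun _ _ => dist_nonneg]
    simp only [edist_dist]
  · have := hdist 0 (k 0) (Nat.zero_le _)
    have h2 := hkS' 0 le_rfl
    exact (dist_le_zero.1 (by rw [hS0] at this; linarith)).symm
  · have key : ∀ s t, s ≤ t → dist (p (k s)) (p (k t)) ≤ L * (t - s) + r := by
      intro s t hst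
      have hpos : 0 ≤ L * (t - s) := mul_nonneg hL0 (sub_nonneg.2 hst)
      rcases (hkmono hst).eq_or_lt with h | h
      · rw [h, dist_self]; linarith
      · have h1 := hdist _ _ h.le
        have h2 := hkS t (Nat.ne_zero_of_lt h)
        have hlt := h.trans_le (hkN t)
        have h3 := hkG s hlt
        rw [hSs] at h3
        have h4 := hp _ hlt
        linarith
    intro s t
    rcases le_total s t with h | h
    · rw [abs_sub_comm, abs_of_nonneg (sub_nonneg.2 h)]; exact key s t h
    · rw [dist_comm, abs_of_nonneg (sub_nonneg.2 h)]; exact key t s h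
  · exact (measurable_from_nat (f := fun i => G (p i))).comp hkm
  · rcases hL0.eq_or_lt with h0 | h0
    · rw [← h0]; simp
    have hIco : Icc (0:ℝ) 1 =ᵐ[volume] Ico (0:ℝ) 1 := Ico_ae_eq_Icc.symm
    rw [setLIntegral_congr hIco]
    have hbound : ∀ t ∈ Ico (0:ℝ) 1, G (p (k t)) ≤ ∑ i ∈ Finset.range N,
        (Icc (S i / L) (S (i + 1) / L)).indicator (fun _ => G (p i)) t := by
      intro t ht
      have hlt : k t < N := by
        refine lt_of_le_of_ne (hkN t) fun h => ?_
        have := hkS' t ht.1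
        rw [h] at this
        nlinarith [ht.2]
      refine le_trans ?_ (Finset.single_le_sum (f := fun i =>
        (Icc (S i / L) (S (i + 1) / L)).indicator (fun _ => G (p i)) t) (fun _ _ => zero_le)
        (Finset.mem_range.2 hlt))
      have hmem : t ∈ Icc (S (k t) / L) (S (k t + 1) / L) := by
        refine ⟨?_, ?_⟩
        · rw [div_le_iff₀ h0, mul_comm]; exact hkS' t ht.1
        · rw [le_div_iff₀ h0, mul_comm]; exact (hkG t hlt).le
      simp only [indicator_of_mem hmem, le_refl]
    calc ENNReal.ofReal L * ∫⁻ t in Ico (0:ℝ) 1, G (p (k t))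
        ≤ ENNReal.ofReal L * ∫⁻ t, ∑ i ∈ Finset.range N,
          (Icc (S i / L) (S (i + 1) / L)).indicator (fun _ => G (p i)) t :=
          mul_le_mul_right ((setLIntegral_mono' measurableSet_Ico hbound).trans
            (setLIntegral_le_lintegral _ _)) _
      _ = ∑ i ∈ Finset.range N, G (p i) * edist (p i) (p (i + 1)) := by
          rw [lintegral_finsetSum _ fun i _ => measurable_const.indicator measurableSet_Icc,
            Finset.mul_sum]
          refine Finset.sum_congr rfl fun i _ => ?_
          rw [lintegral_indicator_const measurableSet_Icc, Real.volume_Icc, mul_left_comm,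
            ← ENNReal.ofReal_mul hL0, edist_dist, hSs]
          congr 2
          field_simp
          ring

/-- Compactness of almost Lipschitz sequences of maps. -/
lemma exists_subseq_tendsto_of_dist_le [ProperSpace X] {γ : ℕ → ℝ → X} {L : ℕ → ℝ} {r : ℕ → ℝ}
    {Λ : ℝ} (hL : ∀ n, 0 ≤ L n) (hLΛ : ∀ n, L n ≤ Λ) (hr : Tendsto r atTop (𝓝 0)) (hr1 : ∀ n, r n ≤ 1)
    (hγ : ∀ n s t, dist (γ n s) (γ n t) ≤ L n * |s - t| + r n) {z : X} (hz : ∀ n, γ n 0 = z) :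
    ∃ (ψ : ℕ → ℕ) (γ' : ℝ → X) (L' : ℝ), StrictMono ψ ∧ 0 ≤ L' ∧
      Tendsto (fun n => L (ψ n)) atTop (𝓝 L') ∧
      (∀ t, Tendsto (fun n => γ (ψ n) t) atTop (𝓝 (γ' t))) ∧
      ∀ s t, dist (γ' s) (γ' t) ≤ L' * |s - t| := by
  have hcomp : IsCompact ((Icc (0:ℝ) Λ) ×ˢ
      (Set.univ.pi fun q : ℚ => closedBall z (Λ * |(q:ℝ)| + 1))) :=
    isCompact_Icc.prod (isCompact_univ_pi fun q => isCompact_closedBall _ _)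
  have hmem : ∀ n, ((L n, fun q : ℚ => γ n q) : ℝ × (ℚ → X)) ∈ ((Icc (0:ℝ) Λ) ×ˢ
      (Set.univ.pi fun q : ℚ => closedBall z (Λ * |(q:ℝ)| + 1))) := fun n => by
    refine ⟨⟨hL n, hLΛ n⟩, fun q _ => ?_⟩
    have := hγ n q 0
    rw [hz, sub_zero] at this
    refine this.trans (add_le_add (mul_le_mul_of_nonneg_right (hLΛ n) (abs_nonneg _)) (hr1 n))
  obtain ⟨⟨L', y⟩, hy, ψ, hψ, hlim⟩ := hcomp.tendsto_subseq hmem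
  rw [Prod.tendsto_iff] at hlim
  obtain ⟨hlimL, hlimq⟩ := hlim
  rw [tendsto_pi_nhds] at hlimq
  have hrψ := hr.comp hψ.tendsto_atTop
  have hΛ : 0 ≤ Λ := (hL 0).trans (hLΛ 0)
  have hcauchy : ∀ t, CauchySeq fun n => γ (ψ n) t := by
    intro t
    refine Metric.cauchySeq_iff'.2 fun ε hε => ?_
    obtain ⟨q, hq1, hq2⟩ := exists_rat_btwn (show t < t + ε / (8 * (Λ + 1)) by
      linarith [show 0 < ε / (8 * (Λ + 1)) by positivity])
    have hq : Λ * |t - q| ≤ ε / 8 := by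
      have h1 : |t - q| ≤ ε / (8 * (Λ + 1)) := by rw [abs_le]; constructor <;> linarith
      calc Λ * |t - q| ≤ (Λ + 1) * (ε / (8 * (Λ + 1))) := by gcongr; linarith
        _ = ε / 8 := by field_simp
    have hcq := Metric.cauchySeq_iff'.1 (hlimq q).cauchySeq (ε / 8) (by positivity)
    obtain ⟨N₁, hN₁⟩ := hcq
    obtain ⟨N₂, hN₂⟩ := eventually_atTop.1 (hrψ.eventually (gt_mem_nhds (show 0 < ε / 8 by positivity)))
    have hclose : ∀ n, N₂ ≤ n → dist (γ (ψ n) t) (γ (ψ n) q) < ε / 4 := fun n hn => by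
      have h1 := hγ (ψ n) t q
      have h2 := mul_le_mul_of_nonneg_right (hLΛ (ψ n)) (abs_nonneg (t - q))
      have h3 : r (ψ n) < ε / 8 := hN₂ n hn
      linarith
    refine ⟨max N₁ N₂, fun n hn => ?_⟩
    have a1 := hclose n (le_trans (le_max_right _ _) hn)
    have a2 := hclose (max N₁ N₂) (le_max_right _ _)
    have a3 : dist (γ (ψ n) q) (γ (ψ N₁) q) < ε / 8 := hN₁ n (le_trans (le_max_left _ _) hn)
    have a4 : dist (γ (ψ (max N₁ N₂)) q) (γ (ψ N₁) q) < ε / 8 := hN₁ _ (le_max_left _ _)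
    rw [dist_comm] at a2 a4
    have b1 := dist_triangle4 (γ (ψ n) t) (γ (ψ n) q) (γ (ψ N₁) q) (γ (ψ (max N₁ N₂)) q)
    have b2 := dist_triangle (γ (ψ n) t) (γ (ψ (max N₁ N₂)) q) (γ (ψ (max N₁ N₂)) t)
    linarith
  choose γ' hγ' using fun t => cauchySeq_tendsto_of_complete (hcauchy t)
  refine ⟨ψ, γ', L', hψ, hy.1.1, hlimL, hγ', fun s t => ?_⟩
  have h1 : Tendsto (fun n => L (ψ n) * |s - t| + r (ψ n)) atTop (𝓝 (L' * |s - t| + 0)) :=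
    (hlimL.mul_const _).add hrψ
  rw [add_zero] at h1
  exact le_of_tendsto_of_tendsto ((hγ' s).dist (hγ' t)) h1 (Eventually.of_forall fun n => hγ _ s t)

lemma speed_le_of_dist_le {γ : ℝ → X} {L : ℝ} (h : ∀ s t, dist (γ s) (γ t) ≤ L * |s - t|) (t : ℝ) :
    speed γ t ≤ ENNReal.ofReal L := by
  refine limsup_le_of_le (h := ?_)
  filter_upwards [self_mem_nhdsWithin] with s hs
  refine ENNReal.ofReal_le_ofReal ?_
  rw [div_le_iff₀ (abs_pos.2 hs)]
  simpa using h (t + s) t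

lemma liminf_add_le_liminf_add (f g : ℕ → ℝ≥0∞) :
    liminf f atTop + liminf g atTop ≤ liminf (fun n => f n + g n) atTop := by
  simp only [liminf_eq_iSup_iInf_of_nat]
  rw [ENNReal.iSup_add_iSup_of_monotone]
  · refine iSup_mono fun n => le_iInf₂ fun i hi => add_le_add (iInf₂_le i hi) (iInf₂_le i hi)
  · exact fun m n h => biInf_mono fun i hi => h.trans hi
  · exact fun m n h => biInf_mono fun i hi => h.trans hi

/-- Limits of almost optimal discrete paths are curves. -/
lemma exists_curve_of_chainInf_lt [BorelSpace X] [ProperSpace X] {G φ : X → ℝ≥0∞}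
    (hG : LowerSemicontinuous G) (hφ : LowerSemicontinuous φ) {δ : ℝ≥0∞} (hδ : δ ≠ 0) (hδ1 : δ ≤ 1)
    (hδG : ∀ y, δ ≤ G y) {c : ℝ≥0∞} (hc : c ≠ ∞) {z : X}
    (h : ∀ n : ℕ, chainInf (lipMinorant G (n + 1)) φ (1 / ((n:ℝ) + 1)) z < c) :
    ∃ γ : Curve X, γ.toFun 0 = z ∧ φ (γ.toFun 1) + curveIntegral G γ ≤ c := by
  have hchain : ∀ n : ℕ, ∃ (p : ℕ → X) (N : ℕ), p 0 = z ∧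
      (∀ i < N, dist (p i) (p (i + 1)) ≤ 1 / ((n:ℝ) + 1)) ∧
      chainCost (lipMinorant G (n + 1)) φ p N < c := fun n => by
    have := h n
    simp only [chainInf, iInf_lt_iff] at this
    obtain ⟨p, N, h0, h1, h2⟩ := this
    exact ⟨p, N, h0, h1, h2⟩
  choose p N hp0 hp hcost using hchain
  choose γ L hL0 hLsum hγ0 hγ1 hγd hγm hγi using fun n =>
    exists_reparam (G := lipMinorant G (n + 1)) (p n) (N n) (r := 1 / ((n:ℝ) + 1)) (by positivity) (hp n)
  have hδt : δ ≠ ∞ := ne_top_of_le_ne_top ENNReal.one_ne_top hδ1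
  have hLle : ∀ n, L n ≤ (c / δ).toReal := fun n => by
    rw [← ENNReal.ofReal_le_iff_le_toReal (ENNReal.div_ne_top hc hδ), hLsum,
      ENNReal.le_div_iff_mul_le (Or.inl hδ) (Or.inl hδt), Finset.sum_mul]
    refine le_trans (Finset.sum_le_sum fun i _ => ?_) (le_add_self.trans (hcost n).le)
    rw [mul_comm]
    refine mul_le_mul_left (le_lipMinorant hδG (hδ1.trans ?_) _) _
    push_cast
    exact le_add_self
  obtain ⟨ψ, γ', L', hψ, hL', hlimL, hlim, hγ'⟩ := exists_subseq_tendsto_of_dist_le hL0 hLle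
    tendsto_one_div_add_atTop_nhds_zero_nat (fun n => by
      rw [div_le_one (by positivity)]; linarith [show (0:ℝ) ≤ n from n.cast_nonneg]) hγd
      (fun n => (hγ0 n).trans (hp0 n))
  set Γ : Curve X := ⟨γ', L'.toNNReal, LipschitzOnWith.of_dist_le_mul fun s _ t _ => by
    rw [Real.coe_toNNReal _ hL', Real.dist_eq]; exact hγ' s t⟩ with hΓ
  refine ⟨Γ, ?_, ?_⟩
  · refine tendsto_nhds_unique (hlim 0) ?_
    simp only [hγ0, hp0]
    exact tendsto_const_nhds
  · have hψt : Tendsto (fun n => ψ n + 1) atTop atTop := (tendsto_add_atTop_nat 1).comp hψ.tendsto_atTop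
    have h1 : φ (γ' 1) ≤ liminf (fun n => φ (p (ψ n) (N (ψ n)))) atTop := by
      refine le_of_forall_lt fun a ha => ?_
      obtain ⟨b, hab, hb⟩ := exists_between ha
      refine hab.trans_le (le_liminf_of_le (h := ?_))
      filter_upwards [(hlim 1).eventually (hφ _ b hb)] with n hn
      rw [← hγ1]
      exact hn.le
    have h2 : curveIntegral G Γ ≤ liminf (fun n => ∑ i ∈ Finset.range (N (ψ n)),
        lipMinorant G (ψ n + 1) (p (ψ n) i) * edist (p (ψ n) i) (p (ψ n) (i + 1))) atTop := by
      calc curveIntegral G Γ ≤ ∫⁻ t in Icc (0:ℝ) 1, liminf (fun n =>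
            ENNReal.ofReal (L (ψ n)) * lipMinorant G (ψ n + 1) (γ (ψ n) t)) atTop := by
            refine lintegral_mono fun t => ?_
            refine (mul_le_mul_right (speed_le_of_dist_le hγ' t) _).trans ?_
            refine ENNReal.mul_le_of_forall_lt fun a ha b hb => ?_
            refine le_liminf_of_le (h := ?_)
            filter_upwards [eventually_le_lipMinorant hG hψt (hlim t) ha,
              (ENNReal.tendsto_ofReal hlimL).eventually (lt_mem_nhds hb)] with n hn1 hn2
            rw [mul_comm]
            exact mul_le_mul' hn2.le hn1
        _ ≤ liminf (fun n => ∫⁻ t in Icc (0:ℝ) 1,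
            ENNReal.ofReal (L (ψ n)) * lipMinorant G (ψ n + 1) (γ (ψ n) t)) atTop :=
            lintegral_liminf_le fun n => (hγm (ψ n)).const_mul _
        _ ≤ _ := by
            refine liminf_le_liminf (Eventually.of_forall fun n => ?_)
            rw [lintegral_const_mul _ (hγm (ψ n))]
            exact hγi (ψ n)
    refine (add_le_add h1 h2).trans ((liminf_add_le_liminf_add _ _).trans ?_)
    refine liminf_le_of_frequently_le' (Frequently.of_forall fun n => ?_)
    exact (hcost (ψ n)).le

end Chains

section Approximation
variable {μ : Measure X} {Cd CP lam : ℝ}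

lemma derivBound_of_continuous (γ : Curve X) {v : X → ℝ} {L : ℝ≥0} (hv : LipschitzWith L v)
    {G : X → ℝ≥0∞} (hG : Continuous G) (hG0 : ∀ y, G y ≠ 0) (hGt : ∀ y, G y ≠ ∞) {r : ℝ}
    (hr : 0 < r)
    (h : ∀ z z', dist z z' ≤ r → ENNReal.ofReal (v z - v z') ≤ G z * edist z z') :
    DerivBound γ v G := by
  refine ⟨(derivBound_of_lipschitz γ hv).1, ?_⟩
  filter_upwards [(derivBound_of_lipschitz γ hv).ae_differentiableAt] with t ht h01
  have hd := tendsto_abs_quotient (ht h01)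
  have hd' := (ENNReal.continuous_ofReal.tendsto _).comp hd
  refine ENNReal.le_mul_of_forall_lt (Or.inl (hG0 _)) (Or.inl (hGt _)) fun a' ha' c' hc' => ?_
  obtain ⟨a, ha, haa'⟩ := exists_between ha'
  refine le_trans ?_ (mul_le_mul' haa'.le hc'.le)
  rw [← hd'.limsup_eq, speed, ← ENNReal.limsup_const_mul_of_ne_top haa'.ne_top]
  refine limsup_le_limsup ?_
  have hγt : Tendsto (fun s => γ.toFun (t + s)) (𝓝[≠] 0) (𝓝 (γ.toFun t)) :=
    (γ.continuousAt h01).tendsto.comp (tendsto_add_nhdsNE t)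
  filter_upwards [((hG.tendsto _).comp hγt).eventually (gt_mem_nhds ha),
    hγt (ball_mem_nhds _ hr)] with s hs1 hs2
  simp only [Function.comp_apply] at hs1 ⊢
  have hs2' : dist (γ.toFun (t + s)) (γ.toFun t) < r := hs2
  have key : ENNReal.ofReal |v (γ.toFun (t + s)) - v (γ.toFun t)| ≤
      a * ENNReal.ofReal (dist (γ.toFun (t + s)) (γ.toFun t)) := by
    rw [← edist_dist]
    rcases le_total (v (γ.toFun t)) (v (γ.toFun (t + s))) with h1 | h1
    · rw [abs_of_nonneg (sub_nonneg.2 h1)]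
      exact (h _ _ hs2'.le).trans (mul_le_mul_left hs1.le _)
    · rw [abs_of_nonpos (sub_nonpos.2 h1), neg_sub, edist_comm]
      exact (h _ _ (by rw [dist_comm]; exact hs2'.le)).trans (mul_le_mul_left ha.le _)
  rw [div_eq_mul_inv, div_eq_mul_inv, ENNReal.ofReal_mul (abs_nonneg _),
    ENNReal.ofReal_mul dist_nonneg, ← mul_assoc]
  exact mul_le_mul_left key _

lemma exists_measurable_ge_lintegral_eq {f : X → ℝ≥0∞} (hf : AEMeasurable f μ) :
    ∃ Φ : X → ℝ≥0∞, Measurable Φ ∧ (∀ y, f y ≤ Φ y) ∧ ∫⁻ y, Φ y ∂μ = ∫⁻ y, f y ∂μ := by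
  obtain ⟨s, hs, hsm, hs0⟩ := exists_measurable_superset_of_null hf.ae_eq_mk
  refine ⟨fun y => s.indicator (fun _ => ∞) y + hf.mk f y,
    (measurable_const.indicator hsm).add hf.measurable_mk, fun y => ?_, ?_⟩
  · by_cases hy : y ∈ s
    · simp [hy]
    · rw [not_not.1 fun h => hy (hs h : y ∈ s)]
      exact le_add_self
  · rw [lintegral_add_right _ hf.measurable_mk, lintegral_indicator hsm,
      lintegral_congr_ae hf.ae_eq_mk]
    simp [hs0]

/-- Approximation of a bounded function with a weak upper gradient from inside by an increasing
sequence of Lipschitz functions having a common upper gradient. -/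
theorem MMS.exists_monotone_lipschitz [BorelSpace X] (hX : MMS μ Cd CP lam) {Ω : Set X}
    (hΩ : IsOpen Ω) (hΩt : μ Ω ≠ ∞) {v : X → ℝ} {g : X → ℝ≥0∞} {M : ℝ} (hv : AEMeasurable v μ)
    (hv0 : ∀ y, 0 ≤ v y) (hvM : ∀ y, v y ≤ M) (hvz : ∀ y, y ∉ Ω → v y = 0) (hg : Measurable g)
    (h : WGrad μ g v) {ε : ℝ≥0∞} (hε : ε ≠ 0) :
    ∃ (G : X → ℝ≥0∞) (w : ℕ → X → ℝ), Measurable G ∧ (∀ y, g y ≤ G y) ∧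
      ∫⁻ y, G y ∂μ ≤ ∫⁻ y, g y ∂μ + ε ∧ (∀ n, ∃ L, LipschitzWith L (w n)) ∧
      (∀ y, Monotone fun n => w n y) ∧ (∀ n y, 0 ≤ w n y) ∧ (∀ n y, w n y ≤ M) ∧
      (∀ n y, y ∉ Ω → w n y = 0) ∧ (∀ n, IsUpperGradientOn G (w n) univ) ∧
      ∫⁻ y, ENNReal.ofReal (⨆ n, w n y) ∂μ ≤ ∫⁻ y, ENNReal.ofReal (v y) ∂μ + ε ∧
      ∀ y, v y ≤ ⨆ n, w n y := by
  have := hX.properSpace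
  have := hX.isLocallyFiniteMeasure
  have hε3 : ε / 3 ≠ 0 := by simp [hε]
  have hM : 0 ≤ M := by
    obtain ⟨y⟩ : Nonempty X := hX.nontrivial.to_nonempty
    exact (hv0 y).trans (hvM y)
  obtain ⟨ρ, hρ, hρε, hUG⟩ := h.exists_isUpperGradientOn hg hε3
  obtain ⟨G', hG'le, hG', hG'ε⟩ := exists_le_lowerSemicontinuous_lintegral_ge (μ := μ)
    (fun x => g x + ρ x) (hg.add hρ) hε3
  obtain ⟨Φ, hΦ, hΦle, hΦint⟩ := exists_measurable_ge_lintegral_eq hv.ennreal_ofReal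
  obtain ⟨φ₀, hφ₀le', hφ₀, hφ₀ε'⟩ := exists_le_lowerSemicontinuous_lintegral_ge (μ := μ) Φ hΦ hε
  have hφ₀le : ∀ y, ENNReal.ofReal (v y) ≤ φ₀ y := fun y => (hΦle y).trans (hφ₀le' y)
  have hφ₀ε : ∫⁻ y, φ₀ y ∂μ ≤ ∫⁻ y, ENNReal.ofReal (v y) ∂μ + ε := hΦint ▸ hφ₀ε'
  set δ : ℝ≥0∞ := min 1 (ε / 3 / (μ Ω + 1)) with hδdef
  have hδ0 : δ ≠ 0 := by
    have : ε / 3 / (μ Ω + 1) ≠ 0 := ENNReal.div_ne_zero.2 ⟨hε3, by simp [hΩt]⟩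
    simp only [hδdef, ne_eq, min_eq_iff, not_or, not_and]
    exact ⟨fun h => absurd h one_ne_zero, fun h => absurd h this⟩
  have hδ1 : δ ≤ 1 := min_le_left _ _
  have hδΩ : δ * μ Ω ≤ ε / 3 := by
    calc δ * μ Ω ≤ ε / 3 / (μ Ω + 1) * (μ Ω + 1) :=
          mul_le_mul' (min_le_right _ _) le_self_add
      _ ≤ ε / 3 := (ENNReal.div_mul_cancel (by simp) (by simp [hΩt])).le
  set G : X → ℝ≥0∞ := fun y => G' y + δ with hGdef
  have hG : LowerSemicontinuous G := hG'.add lowerSemicontinuous_const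
  set φ : X → ℝ≥0∞ := fun y => min (φ₀ y) (Ω.indicator (fun _ => ENNReal.ofReal M) y) with hφdef
  have hφ : LowerSemicontinuous φ := hφ₀.inf (hΩ.lowerSemicontinuous_indicator zero_le)
  have hvφ : ∀ y, ENNReal.ofReal (v y) ≤ φ y := fun y => by
    refine le_min (hφ₀le y) ?_
    by_cases hy : y ∈ Ω
    · rw [indicator_of_mem hy]; exact ENNReal.ofReal_le_ofReal (hvM y)
    · rw [hvz y hy]; simp
  have hφM : ∀ y, φ y ≤ ENNReal.ofReal M := fun y =>
    (min_le_right _ _).trans (indicator_le_self' (fun _ _ => zero_le) y)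
  have hφz : ∀ y, y ∉ Ω → φ y = 0 := fun y hy => by simp [hφdef, indicator_of_notMem hy]
  have hδG : ∀ y, δ ≤ G y := fun y => le_add_self
  set W : ℕ → X → ℝ≥0∞ := fun n => chainInf (lipMinorant G (n + 1)) φ (1 / ((n:ℝ) + 1)) with hW
  have hWφ : ∀ n y, W n y ≤ φ y := fun n y => chainInf_le _ _ _ _
  have hWt : ∀ n y, W n y ≠ ∞ := fun n y =>
    (((hWφ n y).trans (hφM y)).trans_lt ENNReal.ofReal_lt_top).ne
  have hwM : ∀ n y, (W n y).toReal ≤ M := fun n y =>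
    ENNReal.toReal_le_of_le_ofReal hM ((hWφ n y).trans (hφM y))
  have hmono : ∀ y, Monotone fun n => (W n y).toReal := fun y => by
    refine monotone_nat_of_le_succ fun n => ENNReal.toReal_mono (hWt _ _) ?_
    refine chainInf_mono (lipMinorant_mono G (by omega)) ?_ y
    push_cast
    exact one_div_le_one_div_of_le (by positivity) (by linarith)
  have hbdd : ∀ y, BddAbove (range fun n => (W n y).toReal) := fun y =>
    ⟨M, by rintro _ ⟨n, rfl⟩; exact hwM n y⟩
  have hstep : ∀ (n : ℕ) z z', dist z z' ≤ 1 / ((n:ℝ) + 1) →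
      ENNReal.ofReal ((W n z).toReal - (W n z').toReal) ≤ lipMinorant G (n + 1) z * edist z z' := by
    intro n z z' hzz
    have h1 := chainInf_step (lipMinorant G (n + 1)) φ hzz
    rw [ENNReal.ofReal_sub _ ENNReal.toReal_nonneg, ENNReal.ofReal_toReal (hWt _ _),
      ENNReal.ofReal_toReal (hWt _ _)]
    exact tsub_le_iff_left.2 h1
  have hmin : ∀ n z, lipMinorant G (n + 1) z ≤ ((n + 1 : ℕ) : ℝ≥0∞) := fun n z =>
    (lipMinorant_le _ _ _).trans (min_le_right _ _)
  have hlip : ∀ n, ∃ L, LipschitzWith L fun y => (W n y).toReal := by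
    intro n
    refine ⟨(((n:ℝ) + 1) + M * (n + 1)).toNNReal, LipschitzWith.of_le_add_mul _ fun z z' => ?_⟩
    rw [Real.coe_toNNReal _ (by positivity)]
    rcases le_or_gt (dist z z') (1 / ((n:ℝ) + 1)) with hd | hd
    · have h1 := (hstep n z z' hd).trans (mul_le_mul_left (hmin n z) _)
      rw [edist_dist, ← ENNReal.ofReal_natCast, ← ENNReal.ofReal_mul (by positivity),
        ENNReal.ofReal_le_ofReal_iff (by positivity)] at h1
      push_cast at h1
      have : 0 ≤ M * (n + 1) * dist z z' := by positivity
      linarith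
    · have h1 : 1 ≤ (n + 1) * dist z z' := by
        rw [div_lt_iff₀ (by positivity)] at hd; linarith
      have h2 : M ≤ M * ((n + 1) * dist z z') := le_mul_of_one_le_right hM h1
      have h3 : 0 ≤ ((n:ℝ) + 1) * dist z z' := by positivity
      linarith [hwM n z, (ENNReal.toReal_nonneg : 0 ≤ (W n z').toReal)]
  refine ⟨fun y => G' y + Ω.indicator (fun _ => δ) y, fun n y => (W n y).toReal,
    hG'.measurable.add (measurable_const.indicator hΩ.measurableSet), fun y => ?_, ?_, hlip, hmono,
    fun n y => ENNReal.toReal_nonneg, hwM, fun n y hy => ?_, fun n γ _ => ?_, ?_, fun y => ?_⟩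
  · exact (le_self_add.trans (hG'le y)).trans le_self_add
  · rw [lintegral_add_left hG'.measurable, lintegral_indicator_const hΩ.measurableSet]
    calc _ ≤ (∫⁻ y, g y ∂μ + ε / 3) + ε / 3 + ε / 3 := by
          refine add_le_add (hG'ε.trans ?_) hδΩ
          rw [lintegral_add_left hg]
          exact add_le_add_left (add_le_add_right hρε _) _
      _ = _ := by rw [add_assoc, add_assoc, ← add_assoc (ε / 3), ENNReal.add_thirds]
  · have := hWφ n y
    rw [hφz y hy, nonpos_iff_eq_zero] at this
    simp [this]
  · obtain ⟨L, hL⟩ := hlip n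
    have hD := derivBound_of_continuous γ hL (continuous_lipMinorant G (n + 1))
      (fun y => (hδ0.bot_lt.trans_le (le_lipMinorant hδG (hδ1.trans (by
        push_cast; exact le_add_self)) y)).ne')
      (fun y => ((hmin n y).trans_lt (ENNReal.natCast_lt_top _)).ne)
      (r := 1 / ((n:ℝ) + 1)) (by positivity) (hstep n)
    have hD2 := hD.comp (ζ := fun a => max a 0) (L := 1)
      (LipschitzWith.id.max_const 0) (Z := Iic 0) fun a ha => Or.inl fun b => by
        simp only [max_eq_right (mem_Iic.1 ha)]; exact le_max_right _ _
    have heq : (fun y => max ((W n y).toReal) 0) = fun y => (W n y).toReal :=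
      funext fun y => max_eq_left ENNReal.toReal_nonneg
    rw [heq] at hD2
    refine (hD2.mono fun y => ?_).le_curveIntegral
    refine indicator_apply_le' (fun hy => ?_) (fun _ => zero_le)
    have hyΩ : y ∈ Ω := by
      by_contra hyΩ
      refine hy ?_
      have := hWφ n y
      rw [hφz y hyΩ, nonpos_iff_eq_zero] at this
      simp [this]
    rw [indicator_of_mem hyΩ, ENNReal.coe_one, one_mul]
    exact (lipMinorant_le _ _ _).trans (min_le_left _ _)
  · refine le_trans (lintegral_mono fun y => ?_) hφ₀ε
    have : (⨆ n, (W n y).toReal) ≤ (φ y).toReal :=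
      ciSup_le fun n => ENNReal.toReal_mono ((hφM y).trans_lt ENNReal.ofReal_lt_top).ne (hWφ n y)
    refine (ENNReal.ofReal_le_ofReal this).trans (ENNReal.ofReal_toReal_le.trans (min_le_left _ _))
  · by_contra hlt
    rw [not_le] at hlt
    set s := ⨆ n, (W n y).toReal with hs
    have hs0 : 0 ≤ s := ENNReal.toReal_nonneg.trans (le_ciSup (hbdd y) 0)
    obtain ⟨γ, hγ0, hγ⟩ := exists_curve_of_chainInf_lt hG hφ hδ0 hδ1 hδG
      (c := ENNReal.ofReal ((s + v y) / 2)) ENNReal.ofReal_ne_top (z := y) fun n => by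
        change W n y < _
        rw [ENNReal.lt_ofReal_iff_toReal_lt (hWt n y)]
        have : (W n y).toReal ≤ s := le_ciSup (hbdd y) n
        linarith
    have h1 := hUG γ fun _ _ => mem_univ _
    have h2 : ENNReal.ofReal (v y) ≤ ENNReal.ofReal ((s + v y) / 2) := by
      calc ENNReal.ofReal (v y) ≤ ENNReal.ofReal (v (γ.toFun 1) +
            |v (γ.toFun 1) - v (γ.toFun 0)|) := by
            refine ENNReal.ofReal_le_ofReal ?_
            rw [hγ0]
            linarith [neg_abs_le (v (γ.toFun 1) - v y)]
        _ ≤ φ (γ.toFun 1) + curveIntegral G γ := by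
            rw [ENNReal.ofReal_add (hv0 _) (abs_nonneg _)]
            exact add_le_add (hvφ _) (h1.trans (curveIntegral_mono γ fun z _ =>
              (hG'le _).trans le_self_add))
        _ ≤ _ := hγ
    rw [ENNReal.ofReal_le_ofReal_iff (by linarith [hv0 y])] at h2
    linarith

end Approximation

section AdmApprox
variable {μ : Measure X} {Cd CP lam : ℝ}

lemma tendsto_lintegral_sub_of_tendsto {v : ℕ → X → ℝ} {u b : X → ℝ} (hv : ∀ n, Measurable (v n))
    (hu : Measurable u) (hb : ∫⁻ y, ENNReal.ofReal (b y) ∂μ ≠ ∞)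
    (hvb : ∀ n y, |v n y - u y| ≤ b y) (hlim : ∀ y, Tendsto (fun n => v n y) atTop (𝓝 (u y))) :
    Tendsto (fun n => ∫⁻ y, ENNReal.ofReal |v n y - u y| ∂μ) atTop (𝓝 0) := by
  have := tendsto_lintegral_of_dominated_convergence (μ := μ)
    (F := fun n y => ENNReal.ofReal |v n y - u y|) (f := fun _ => 0)
    (fun y => ENNReal.ofReal (b y)) (fun n => ((hv n).sub hu).abs.ennreal_ofReal)
    (fun n => Eventually.of_forall fun y => ENNReal.ofReal_le_ofReal (hvb n y)) hb
    (Eventually.of_forall fun y => by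
      have h1 : Tendsto (fun n => |v n y - u y|) atTop (𝓝 0) := by
        have := ((hlim y).sub_const (u y)).abs
        simpa using this
      have := (ENNReal.continuous_ofReal.tendsto _).comp h1
      simpa [Function.comp_def] using this)
  simpa using this

lemma Adm.truncate {x : X} {R : ℝ} {v : X → ℝ} {g : X → ℝ≥0∞} (h : Adm μ x R v g) {k : ℝ}
    (hk : 0 ≤ k) : Adm μ x R (fun y => min (v y) k) g where
  meas := h.meas.min measurable_const
  nonneg y := le_min (h.nonneg y) hk
  zero y hy := by rw [h.zero y hy, min_eq_left hk]
  integrable := h.integrable.mono' (h.meas.min measurable_const).aestronglyMeasurable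
    (Eventually.of_forall fun y => by
      rw [Real.norm_of_nonneg (le_min (h.nonneg y) hk)]; exact min_le_left _ _)
  gmeas := h.gmeas
  gfin := h.gfin
  wgrad := by simpa using h.wgrad.comp_lipschitz (LipschitzWith.id.min_const k)

lemma Adm.exists_truncate {x : X} {R : ℝ} {v : X → ℝ} {g : X → ℝ≥0∞} (h : Adm μ x R v g)
    {ε : ℝ≥0∞} (hε : ε ≠ 0) :
    ∃ k : ℝ, 0 ≤ k ∧ ∫⁻ y, ENNReal.ofReal |min (v y) k - v y| ∂μ ≤ ε := by
  have := tendsto_lintegral_sub_of_tendsto (μ := μ) (v := fun (n : ℕ) y => min (v y) n) (u := v)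
    (b := v) (fun n => h.meas.min measurable_const) h.meas
    h.integrable.lintegral_lt_top.ne
    (fun n y => by
      rw [abs_sub_comm, abs_of_nonneg (sub_nonneg.2 (min_le_left _ _))]
      linarith [le_min (h.nonneg y) (Nat.cast_nonneg (α := ℝ) n)])
    (fun y => by
      refine tendsto_const_nhds.congr' ?_
      filter_upwards [eventually_ge_atTop ⌈v y⌉₊] with n hn
      exact (min_eq_left ((Nat.le_ceil _).trans (by exact_mod_cast hn))).symm)
  obtain ⟨n, hn⟩ := (this.eventually (ge_mem_nhds hε.bot_lt)).exists
  exact ⟨n, n.cast_nonneg, hn⟩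

lemma lintegral_abs_sub_le_add {a b c : X → ℝ} (hab : Measurable fun y => a y - b y) :
    ∫⁻ y, ENNReal.ofReal |a y - c y| ∂μ ≤
      ∫⁻ y, ENNReal.ofReal |a y - b y| ∂μ + ∫⁻ y, ENNReal.ofReal |b y - c y| ∂μ := by
  rw [← lintegral_add_left hab.abs.ennreal_ofReal]
  refine lintegral_mono fun y => ?_
  rw [← ENNReal.ofReal_add (abs_nonneg _) (abs_nonneg _)]
  exact ENNReal.ofReal_le_ofReal (abs_sub_le _ _ _)

/-- Lipschitz approximation in energy of functions vanishing outside a ball. -/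
theorem Adm.exists_lipschitz [BorelSpace X] (hX : MMS μ Cd CP lam) {x : X} {R : ℝ} {v : X → ℝ}
    {g : X → ℝ≥0∞} (h : Adm μ x R v g) {ε : ℝ≥0∞} (hε : ε ≠ 0) :
    ∃ (w : X → ℝ) (G : X → ℝ≥0∞), Adm μ x R w G ∧ (∃ L, LipschitzWith L w) ∧
      IsUpperGradientOn G w univ ∧ (∀ y, g y ≤ G y) ∧ ∫⁻ y, G y ∂μ ≤ ∫⁻ y, g y ∂μ + ε ∧
      ∫⁻ y, ENNReal.ofReal |w y - v y| ∂μ ≤ ε := by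
  wlog hεt : ε ≠ ∞ generalizing ε
  · obtain ⟨w, G, a, b, c, d, e, f⟩ := this one_ne_zero ENNReal.one_ne_top
    push Not at hεt
    exact ⟨w, G, a, b, c, d, by simp [hεt], by simp [hεt]⟩
  have hε3 : ε / 3 ≠ 0 := by simp [hε]
  obtain ⟨k, hk0, hk⟩ := h.exists_truncate hε3
  have hT := h.truncate hk0
  obtain ⟨G, w, hG, hgG, hGε, hlip, hmono, hw0, hwk, hwz, hUG, hint, hle⟩ :=
    hX.exists_monotone_lipschitz isOpen_ball (hX.ball_lt_top x R).ne hT.meas.aemeasurable hT.nonneg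
      (fun y => min_le_right _ _) hT.zero hT.gmeas hT.wgrad hε3
  set s : X → ℝ := fun y => ⨆ n, w n y with hs
  have hbdd : ∀ y, BddAbove (range fun n => w n y) := fun y =>
    ⟨k, by rintro _ ⟨n, rfl⟩; exact hwk n y⟩
  have hwm : ∀ n, Measurable (w n) := fun n => (hlip n).choose_spec.continuous.measurable
  have hlim : ∀ y, Tendsto (fun n => w n y) atTop (𝓝 (s y)) := fun y =>
    tendsto_atTop_ciSup (hmono y) (hbdd y)
  have hsm : Measurable s := measurable_of_tendsto_metrizable hwm (tendsto_pi_nhds.2 hlim)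
  have hs0 : ∀ y, 0 ≤ s y := fun y => (hw0 0 y).trans (le_ciSup (hbdd y) 0)
  have hsk : ∀ y, s y ≤ k := fun y => ciSup_le fun n => hwk n y
  have hsz : ∀ y, y ∉ ball x R → s y = 0 := fun y hy => by simp [hs, hwz _ y hy]
  have hws : ∀ n y, |w n y - s y| ≤ s y := fun n y => by
    rw [abs_sub_comm, abs_of_nonneg (sub_nonneg.2 (le_ciSup (hbdd y) n))]
    linarith [hw0 n y]
  have hsint := hX.integrable_of_le hsm hs0 hsk hsz
  have h1 := tendsto_lintegral_sub_of_tendsto (μ := μ) hwm hsm hsint.lintegral_lt_top.ne hws hlim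
  obtain ⟨n, hn⟩ := (h1.eventually (ge_mem_nhds hε3.bot_lt)).exists
  have h2 : ∫⁻ y, ENNReal.ofReal |s y - min (v y) k| ∂μ ≤ ε / 3 := by
    have hf := hT.integrable.lintegral_lt_top.ne
    rw [← ENNReal.add_le_add_iff_left hf, ← lintegral_add_left hT.meas.ennreal_ofReal]
    refine le_trans (lintegral_mono fun y => ?_) hint
    rw [← ENNReal.ofReal_add (hT.nonneg y) (abs_nonneg _), abs_of_nonneg (sub_nonneg.2 (hle y))]
    exact ENNReal.ofReal_le_ofReal (by linarith)
  have hGfin : ∫⁻ y, G y ∂μ ≠ ∞ := (hGε.trans_lt (ENNReal.add_lt_top.2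
    ⟨h.gfin.lt_top, (ENNReal.div_ne_top hεt (by norm_num)).lt_top⟩)).ne
  have h3 : ε / 3 ≤ ε := ENNReal.div_le_of_le_mul (le_mul_of_one_le_right zero_le (by norm_num))
  refine ⟨w n, G, ⟨hwm n, hw0 n, hwz n, hX.integrable_of_le (hwm n) (hw0 n) (hwk n) (hwz n), hG,
    hGfin, (hUG n).wgrad hG hGfin⟩, hlip n, hUG n, hgG, hGε.trans (add_le_add_right h3 _), ?_⟩
  calc _ ≤ ∫⁻ y, ENNReal.ofReal |w n y - s y| ∂μ + (∫⁻ y, ENNReal.ofReal |s y - min (v y) k| ∂μ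
        + ∫⁻ y, ENNReal.ofReal |min (v y) k - v y| ∂μ) :=
        (lintegral_abs_sub_le_add ((hwm n).sub hsm)).trans
          (add_le_add_right (lintegral_abs_sub_le_add (hsm.sub hT.meas)) _)
    _ ≤ ε / 3 + (ε / 3 + ε / 3) := add_le_add hn (add_le_add h2 hk)
    _ = ε := by rw [← add_assoc, ENNReal.add_thirds]

lemma setLIntegral_le_of_lintegral_le {g G : X → ℝ≥0∞}
    (hfin : ∫⁻ y, g y ∂μ ≠ ∞) (hgG : ∀ y, g y ≤ G y) {ε : ℝ≥0∞}
    (h : ∫⁻ y, G y ∂μ ≤ ∫⁻ y, g y ∂μ + ε) {U : Set X} (hU : MeasurableSet U) :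
    ∫⁻ y in U, G y ∂μ ≤ ∫⁻ y in U, g y ∂μ + ε := by
  have hc : ∫⁻ y in Uᶜ, g y ∂μ ≠ ∞ := ((setLIntegral_le_lintegral _ _).trans_lt hfin.lt_top).ne
  rw [← ENNReal.add_le_add_iff_right hc, add_right_comm, lintegral_add_compl _ hU]
  calc _ ≤ ∫⁻ y in U, G y ∂μ + ∫⁻ y in Uᶜ, G y ∂μ :=
        add_le_add_right (lintegral_mono fun y => hgG y) _
    _ = ∫⁻ y, G y ∂μ := lintegral_add_compl _ hU
    _ ≤ _ := h

end AdmApprox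

section Compactness
variable {μ : Measure X} {Cd CP lam : ℝ}

lemma lintegral_biUnion_finset_le {ι : Type*} (Z : Finset ι) (B : ι → Set X) (f : X → ℝ≥0∞) :
    ∫⁻ y in ⋃ z ∈ Z, B z, f y ∂μ ≤ ∑ z ∈ Z, ∫⁻ y in B z, f y ∂μ := by
  classical
  induction Z using Finset.induction_on with
  | empty => simp
  | insert a Z ha ih =>
    rw [Finset.set_biUnion_insert, Finset.sum_insert ha]
    exact (lintegral_union_le _ _ _).trans (add_le_add_right ih _)

lemma MMS.sum_setLIntegral_le [BorelSpace X] (hX : MMS μ Cd CP lam) {s Λ : ℝ} (hs : 0 < s)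
    (hΛ : 0 ≤ Λ) {k : ℕ} (hk : 4 * Λ + 2 ≤ 2 ^ k) {Z : Finset X}
    (hsep : ∀ z ∈ Z, ∀ z' ∈ Z, z ≠ z' → s ≤ dist z z') {D : Set X} (hD : MeasurableSet D)
    (hZD : ∀ z ∈ Z, ball z (Λ * s) ⊆ D) {g : X → ℝ≥0∞} (hg : Measurable g) :
    ∑ z ∈ Z, ∫⁻ y in ball z (Λ * s), g y ∂μ ≤ ENNReal.ofReal Cd ^ k * ∫⁻ y in D, g y ∂μ := by
  classical
  calc ∑ z ∈ Z, ∫⁻ y in ball z (Λ * s), g y ∂μ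
      = ∫⁻ y, ∑ z ∈ Z, (ball z (Λ * s)).indicator g y ∂μ := by
        rw [lintegral_finsetSum _ fun z _ => hg.indicator measurableSet_ball]
        exact Finset.sum_congr rfl fun z _ => (lintegral_indicator measurableSet_ball _).symm
    _ ≤ ∫⁻ y, ENNReal.ofReal Cd ^ k * D.indicator g y ∂μ := by
        refine lintegral_mono fun y => ?_
        have h1 : ∑ z ∈ Z, (ball z (Λ * s)).indicator g y =
            (Z.filter fun z => dist y z < Λ * s).card * g y := by
          rw [← nsmul_eq_mul, ← Finset.sum_const, Finset.sum_filter]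
          refine Finset.sum_congr rfl fun z _ => ?_
          simp only [indicator, mem_ball]
        rw [h1]
        rcases (Z.filter fun z => dist y z < Λ * s).eq_empty_or_nonempty with h0 | ⟨z, hz⟩
        · rw [h0]; simp
        · rw [Finset.mem_filter] at hz
          rw [indicator_of_mem (hZD z hz.1 (mem_ball.2 hz.2))]
          refine mul_le_mul_left (hX.card_separated_le hs hΛ hk (y := y) ?_ ?_) _
          · exact fun z hz z' hz' => hsep z (Finset.mem_filter.1 hz).1 z' (Finset.mem_filter.1 hz').1
          · exact fun z hz => (Finset.mem_filter.1 hz).2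
    _ = ENNReal.ofReal Cd ^ k * ∫⁻ y in D, g y ∂μ := by
        rw [lintegral_const_mul _ (hg.indicator hD), lintegral_indicator hD]

/-- A Poincaré inequality at small scales for functions vanishing outside a set of small density. -/
lemma MMS.lintegral_ball_le_of_density [BorelSpace X] (hX : MMS μ Cd CP lam) (x : X) {ρ σ : ℝ}
    (hρ : 0 < ρ) (hσ : 0 < σ) (hσ1 : σ ≤ 1) (hlσ : lam * σ ≤ 1) {k k₀ : ℕ} (hk : 3 ≤ 2 ^ k * σ)
    (hk₀ : 4 * lam + 2 ≤ 2 ^ k₀) {ε : ℝ≥0∞} (hε : ε * ENNReal.ofReal Cd ^ k ≤ 1 / 2)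
    {p : X → ℝ} {g : X → ℝ≥0∞} (hp : Integrable p μ) (hpm : Measurable p) (hp0 : ∀ y, 0 ≤ p y)
    (hg : Measurable g) (h : WGrad μ g p)
    (hdens : μ (ball x (2 * ρ) ∩ {y | 0 < p y}) ≤ ε * μ (ball x (2 * ρ))) :
    ∫⁻ y in ball x ρ, ENNReal.ofReal (p y) ∂μ ≤
      2 * ENNReal.ofReal (CP * (σ * ρ)) *
        (ENNReal.ofReal Cd ^ k₀ * ∫⁻ y in ball x (2 * ρ), g y ∂μ) := by
  have hs : 0 < σ * ρ := mul_pos hσ hρ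
  have hsρ : σ * ρ ≤ ρ := by nlinarith
  have hlsρ : lam * (σ * ρ) ≤ ρ := by nlinarith
  obtain ⟨Z, hZ, hsep, hcov⟩ := hX.exists_net x hρ hs
  have hloc : ∀ z ∈ Z, ∫⁻ y in ball z (σ * ρ), ENNReal.ofReal (p y) ∂μ ≤
      2 * (ENNReal.ofReal (CP * (σ * ρ)) * ∫⁻ y in ball z (lam * (σ * ρ)), g y ∂μ) := by
    intro z hz
    have hzρ := mem_ball.1 (hZ z hz)
    set m := μ (ball z (σ * ρ)) with hm
    have hmt : m ≠ ∞ := (hX.ball_lt_top _ _).ne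
    have h1 : μ (ball x (2 * ρ)) ≤ ENNReal.ofReal Cd ^ k * m := by
      refine le_trans (measure_mono ?_) (hX.measure_ball_le z hs k)
      refine ball_subset_ball' ?_
      rw [dist_comm] at hzρ
      nlinarith
    have h2 : μ (ball z (σ * ρ) ∩ {y | 0 < p y}) ≤ 1 / 2 * m := by
      calc _ ≤ μ (ball x (2 * ρ) ∩ {y | 0 < p y}) := by
            refine measure_mono (inter_subset_inter_left _ (ball_subset_ball' ?_))
            linarith
        _ ≤ ε * (ENNReal.ofReal Cd ^ k * m) := hdens.trans (mul_le_mul_right h1 _)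
        _ ≤ 1 / 2 * m := by rw [← mul_assoc]; exact mul_le_mul_left hε _
    have h3 : (1 / 2 : ℝ≥0∞) * m ≤ μ (ball z (σ * ρ) ∩ {y | p y = 0}) := by
      have hle : m ≤ μ (ball z (σ * ρ) ∩ {y | 0 < p y}) + μ (ball z (σ * ρ) ∩ {y | p y = 0}) := by
        refine le_trans (measure_mono fun y hy => ?_) (measure_union_le _ _)
        rcases (hp0 y).eq_or_lt with h | h
        · exact Or.inr ⟨hy, h.symm⟩
        · exact Or.inl ⟨hy, h⟩
      have hhalf : (1 / 2 : ℝ≥0∞) * m + 1 / 2 * m = m := by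
        rw [← add_mul, ENNReal.add_halves, one_mul]
      have := hle.trans (add_le_add_left h2 _)
      nth_rw 1 [← hhalf] at this
      exact (ENNReal.add_le_add_iff_left (ENNReal.mul_ne_top (by simp) hmt)).1 this
    have h4 := hX.poincare_zero z hs hp hpm hp0 hg h h3
    calc _ = 2 * (1 / 2 * ∫⁻ y in ball z (σ * ρ), ENNReal.ofReal (p y) ∂μ) := by
          rw [← mul_assoc, one_div, ENNReal.mul_inv_cancel two_ne_zero ENNReal.ofNat_ne_top, one_mul]
      _ ≤ _ := mul_le_mul_right h4 _
  calc ∫⁻ y in ball x ρ, ENNReal.ofReal (p y) ∂μ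
      ≤ ∫⁻ y in ⋃ z ∈ Z, ball z (σ * ρ), ENNReal.ofReal (p y) ∂μ := lintegral_mono_set hcov
    _ ≤ ∑ z ∈ Z, ∫⁻ y in ball z (σ * ρ), ENNReal.ofReal (p y) ∂μ :=
        lintegral_biUnion_finset_le _ _ _
    _ ≤ ∑ z ∈ Z, 2 * (ENNReal.ofReal (CP * (σ * ρ)) * ∫⁻ y in ball z (lam * (σ * ρ)), g y ∂μ) :=
        Finset.sum_le_sum hloc
    _ = 2 * ENNReal.ofReal (CP * (σ * ρ)) *
        ∑ z ∈ Z, ∫⁻ y in ball z (lam * (σ * ρ)), g y ∂μ := by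
        rw [Finset.mul_sum]; simp only [mul_assoc]
    _ ≤ _ := mul_le_mul_right (hX.sum_setLIntegral_le hs (by linarith [hX.hlam]) hk₀ hsep
        measurableSet_ball (fun z hz => ball_subset_ball' (by
          have := mem_ball.1 (hZ z hz); linarith)) hg) _

lemma Adm.setLIntegral_eq [BorelSpace X] {x : X} {R : ℝ} {v : X → ℝ} {g : X → ℝ≥0∞}
    (h : Adm μ x R v g) {R' : ℝ} (hR : R ≤ R') :
    ∫⁻ y in ball x R', ENNReal.ofReal (v y) ∂μ = ∫⁻ y, ENNReal.ofReal (v y) ∂μ := by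
  rw [← lintegral_indicator measurableSet_ball]
  refine lintegral_congr fun y => ?_
  by_cases hy : y ∈ ball x R'
  · rw [indicator_of_mem hy]
  · rw [indicator_of_notMem hy, h.zero y fun hy' => hy (ball_subset_ball hR hy')]; simp

lemma Adm.lintegral_le [BorelSpace X] (hX : MMS μ Cd CP lam) {x y₀ : X} {R : ℝ} (hR : 0 < R)
    (hy₀ : 4 * R ≤ dist y₀ x) {v : X → ℝ} {g : X → ℝ≥0∞} (h : Adm μ x R v g) :
    ∫⁻ y, ENNReal.ofReal (v y) ∂μ ≤
      ENNReal.ofReal Cd ^ 3 * (ENNReal.ofReal (CP * (4 * R)) * ∫⁻ y, g y ∂μ) := by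
  have hC0 : ENNReal.ofReal Cd ^ 3 ≠ 0 := pow_ne_zero _ (zero_lt_one.trans_le hX.one_le_ofReal).ne'
  have hCt : ENNReal.ofReal Cd ^ 3 ≠ ∞ := ENNReal.pow_ne_top ENNReal.ofReal_ne_top
  have h1 := hX.poincare_zero x (r := 4 * R) (by linarith) h.integrable h.meas h.nonneg h.gmeas
    h.wgrad (c := (ENNReal.ofReal Cd ^ 3)⁻¹) (by
      rw [ENNReal.inv_mul_le_iff hC0 hCt]
      refine (hX.measure_ball_le_annulus hR hy₀).trans (mul_le_mul_right (measure_mono ?_) _)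
      exact fun y hy => ⟨hy.1, h.zero y hy.2⟩)
  rw [h.setLIntegral_eq (by linarith), ENNReal.inv_mul_le_iff hC0 hCt] at h1
  exact h1.trans (mul_le_mul_right (mul_le_mul_right (setLIntegral_le_lintegral _ _) _) _)

/-- Oscillation estimate on a net. -/
lemma MMS.lintegral_sub_le_of_net [BorelSpace X] (hX : MMS μ Cd CP lam) {x : X} {R s : ℝ}
    (hs : 0 < s) {k₀ : ℕ} (hk₀ : 4 * lam + 2 ≤ 2 ^ k₀) {Z : Finset X}
    (hsep : ∀ z ∈ Z, ∀ z' ∈ Z, z ≠ z' → s ≤ dist z z') (hcov : ball x R ⊆ ⋃ z ∈ Z, ball z s)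
    {v w : X → ℝ} {g G : X → ℝ≥0∞} (hv : Adm μ x R v g) (hw : Adm μ x R w G) :
    ∫⁻ y, ENNReal.ofReal |v y - w y| ∂μ ≤
      ENNReal.ofReal (CP * s) * (ENNReal.ofReal Cd ^ k₀ * (∫⁻ y, g y ∂μ + ∫⁻ y, G y ∂μ)) +
      ∑ z ∈ Z, ENNReal.ofReal |(⨍ y in ball z s, v y ∂μ) - ⨍ y in ball z s, w y ∂μ| *
        μ (ball z s) := by
  have hsum : ∀ {u : X → ℝ} {e : X → ℝ≥0∞}, Adm μ x R u e →
      ∑ z ∈ Z, ∫⁻ y in ball z s, ENNReal.ofReal |u y - ⨍ y' in ball z s, u y' ∂μ| ∂μ ≤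
      ENNReal.ofReal (CP * s) * (ENNReal.ofReal Cd ^ k₀ * ∫⁻ y, e y ∂μ) := by
    intro u e hu
    calc _ ≤ ∑ z ∈ Z, ENNReal.ofReal (CP * s) * ∫⁻ y in ball z (lam * s), e y ∂μ :=
          Finset.sum_le_sum fun z _ => hX.poincare_wgrad z hs hu.integrable hu.gmeas hu.wgrad
      _ ≤ _ := by
          rw [← Finset.mul_sum]
          refine mul_le_mul_right ?_ _
          rw [← setLIntegral_univ (f := e)]
          exact hX.sum_setLIntegral_le hs (by linarith [hX.hlam]) hk₀ hsep MeasurableSet.univ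
            (fun _ _ => subset_univ _) hu.gmeas
  calc ∫⁻ y, ENNReal.ofReal |v y - w y| ∂μ
      ≤ ∫⁻ y in ⋃ z ∈ Z, ball z s, ENNReal.ofReal |v y - w y| ∂μ := by
        rw [← lintegral_indicator (Z.measurableSet_biUnion fun _ _ => measurableSet_ball)]
        refine lintegral_mono fun y => ?_
        by_cases hy : y ∈ ball x R
        · rw [indicator_of_mem (hcov hy)]
        · rw [hv.zero y hy, hw.zero y hy]; simp
    _ ≤ ∑ z ∈ Z, ∫⁻ y in ball z s, ENNReal.ofReal |v y - w y| ∂μ :=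
        lintegral_biUnion_finset_le _ _ _
    _ ≤ ∑ z ∈ Z, (∫⁻ y in ball z s, ENNReal.ofReal |v y - ⨍ y' in ball z s, v y' ∂μ| ∂μ +
          (∫⁻ y in ball z s, ENNReal.ofReal |w y - ⨍ y' in ball z s, w y' ∂μ| ∂μ +
          ENNReal.ofReal |(⨍ y in ball z s, v y ∂μ) - ⨍ y in ball z s, w y ∂μ| * μ (ball z s))) := by
        refine Finset.sum_le_sum fun z _ => ?_
        set a := ⨍ y in ball z s, v y ∂μ
        set b := ⨍ y in ball z s, w y ∂μ
        rw [← setLIntegral_const (ball z s) (ENNReal.ofReal |a - b|), ← lintegral_add_left,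
          ← lintegral_add_left]
        · refine lintegral_mono fun y => ?_
          rw [← ENNReal.ofReal_add (abs_nonneg _) (abs_nonneg _),
            ← ENNReal.ofReal_add (abs_nonneg _) (by positivity)]
          refine ENNReal.ofReal_le_ofReal ?_
          have : v y - w y = (v y - a) + (-(w y - b) + (a - b)) := by ring
          rw [this]
          refine (abs_add_le _ _).trans (add_le_add_right ((abs_add_le _ _).trans ?_) _)
          rw [abs_neg]
        · exact (hv.meas.sub_const _).abs.ennreal_ofReal
        · exact (hw.meas.sub_const _).abs.ennreal_ofReal
    _ ≤ _ := by
        rw [Finset.sum_add_distrib, Finset.sum_add_distrib, ← add_assoc, mul_add, mul_add]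
        exact add_le_add_left (add_le_add (hsum hv) (hsum hw)) _

/-- Compactness in `L¹` of sequences with bounded energy. -/
theorem MMS.exists_subseq_tendsto [BorelSpace X] (hX : MMS μ Cd CP lam) {x y₀ : X} {R : ℝ}
    (hR : 0 < R) (hy₀ : 4 * R ≤ dist y₀ x) {v : ℕ → X → ℝ} {g : ℕ → X → ℝ≥0∞}
    (h : ∀ i, Adm μ x R (v i) (g i)) {M : ℝ≥0∞} (hM : M ≠ ∞) (hgM : ∀ i, ∫⁻ y, g i y ∂μ ≤ M) :
    ∃ (ψ : ℕ → ℕ) (u : X → ℝ), StrictMono ψ ∧ Measurable u ∧ (∀ y, 0 ≤ u y) ∧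
      (∀ y, y ∉ ball x R → u y = 0) ∧ Integrable u μ ∧
      Tendsto (fun n => ∫⁻ y, ENNReal.ofReal |v (ψ n) y - u y| ∂μ) atTop (𝓝 0) := by
  obtain ⟨k₀, hk₀⟩ := pow_unbounded_of_one_lt (4 * lam + 2) one_lt_two
  set f : ℕ → (X →₁[μ] ℝ) := fun i => (h i).integrable.toL1 (v i) with hf
  have hedist : ∀ i j, edist (f i) (f j) = ∫⁻ y, ENNReal.ofReal |v i y - v j y| ∂μ := fun i j => by
    rw [hf, Integrable.edist_toL1_toL1]
    simp only [edist_dist, Real.dist_eq]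
  set 𝒰 : Ultrafilter ℕ := hyperfilter ℕ with h𝒰
  have hcauchy : Cauchy (map f (𝒰 : Filter ℕ)) := by
    rw [EMetric.cauchy_iff]
    refine ⟨NeBot.ne inferInstance, fun ε hε => ?_⟩
    obtain ⟨ε', hε', hεε⟩ := ENNReal.lt_iff_exists_real_btwn.1 hε
    have hε'0 : 0 < ε' := by
      rw [ENNReal.ofReal_pos] at hεε; exact hεε.1
    set K : ℝ := (ENNReal.ofReal Cd ^ k₀ * (M + M)).toReal with hK
    have hKt : ENNReal.ofReal Cd ^ k₀ * (M + M) ≠ ∞ :=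
      ENNReal.mul_ne_top (ENNReal.pow_ne_top ENNReal.ofReal_ne_top) (ENNReal.add_ne_top.2 ⟨hM, hM⟩)
    have hK0 : 0 ≤ K := ENNReal.toReal_nonneg
    have hCP := hX.hCP
    set s : ℝ := ε' / (2 * CP * (K + 1)) with hs
    have hs0 : 0 < s := by positivity
    have hsK : ENNReal.ofReal (CP * s) * (ENNReal.ofReal Cd ^ k₀ * (M + M)) ≤
        ENNReal.ofReal (ε' / 2) := by
      rw [← ENNReal.ofReal_toReal hKt, ← ENNReal.ofReal_mul (by positivity)]
      refine ENNReal.ofReal_le_ofReal ?_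
      rw [← hK]
      have : CP * s * (K + 1) = ε' / 2 := by rw [hs]; field_simp
      have : 0 ≤ CP * s := by positivity
      nlinarith
    obtain ⟨Z, hZ, hsep, hcov⟩ := hX.exists_net x hR hs0
    set a : X → ℕ → ℝ := fun z i => ⨍ y in ball z s, v i y ∂μ with ha
    have hlim : ∀ z, ∃ b, Tendsto (a z) 𝒰 (𝓝 b) := by
      intro z
      set V : ℝ := (ENNReal.ofReal Cd ^ 3 * (ENNReal.ofReal (CP * (4 * R)) * M)).toReal with hV
      have hVt : ENNReal.ofReal Cd ^ 3 * (ENNReal.ofReal (CP * (4 * R)) * M) ≠ ∞ :=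
        ENNReal.mul_ne_top (ENNReal.pow_ne_top ENNReal.ofReal_ne_top)
          (ENNReal.mul_ne_top ENNReal.ofReal_ne_top hM)
      have hbd : ∀ i, a z i ∈ Icc 0 ((μ.real (ball z s))⁻¹ * V) := by
        intro i
        have hav : a z i = (μ.real (ball z s))⁻¹ * ∫ y in ball z s, v i y ∂μ := by
          rw [ha, ← smul_eq_mul, ← setAverage_eq]
        rw [hav]
        refine ⟨mul_nonneg (by positivity) (integral_nonneg (h i).nonneg), ?_⟩
        refine mul_le_mul_of_nonneg_left ?_ (by positivity)
        refine (setIntegral_le_integral (h i).integrable (Eventually.of_forall (h i).nonneg)).trans ?_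
        rw [integral_eq_lintegral_of_nonneg_ae (Eventually.of_forall (h i).nonneg)
          (h i).meas.aestronglyMeasurable]
        refine ENNReal.toReal_mono hVt (((h i).lintegral_le hX hR hy₀).trans ?_)
        exact mul_le_mul_right (mul_le_mul_right (hgM i) _) _
      obtain ⟨b, -, hb⟩ := isCompact_Icc.ultrafilter_le_nhds (𝒰.map (a z))
        (le_principal_iff.2 (Eventually.of_forall hbd : ∀ᶠ i in (𝒰 : Filter ℕ), _))
      exact ⟨b, hb⟩
    choose b hb using hlim
    set m : ℝ := ∑ z ∈ Z, μ.real (ball z s) with hm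
    have hm0 : 0 ≤ m := Finset.sum_nonneg fun _ _ => measureReal_nonneg
    have hS : ∀ᶠ i in (𝒰 : Filter ℕ), ∀ z ∈ Z, |a z i - b z| < ε' / (4 * (m + 1)) := by
      rw [Filter.eventually_all_finset]
      intro z _
      have := (hb z).eventually (ball_mem_nhds (b z) (show 0 < ε' / (4 * (m + 1)) by positivity))
      filter_upwards [this] with i hi
      exact hi
    refine ⟨f '' {i | ∀ z ∈ Z, |a z i - b z| < ε' / (4 * (m + 1))}, image_mem_map hS, ?_⟩
    rintro _ ⟨i, hi, rfl⟩ _ ⟨j, hj, rfl⟩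
    rw [hedist]
    refine lt_of_le_of_lt ?_ hεε.2
    refine (hX.lintegral_sub_le_of_net hs0 hk₀.le hsep hcov (h i) (h j)).trans ?_
    have h2 : ∑ z ∈ Z, ENNReal.ofReal |a z i - a z j| * μ (ball z s) ≤ ENNReal.ofReal (ε' / 2) := by
      calc _ ≤ ∑ z ∈ Z, ENNReal.ofReal (ε' / (2 * (m + 1)) * μ.real (ball z s)) := by
            refine Finset.sum_le_sum fun z hz => ?_
            rw [ENNReal.ofReal_mul (by positivity), ofReal_measureReal (hX.ball_lt_top _ _).ne]
            refine mul_le_mul_left (ENNReal.ofReal_le_ofReal ?_) _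
            have h1 := hi z hz
            have h2 := hj z hz
            rw [abs_sub_comm] at h2
            have h3 := abs_sub_le (a z i) (b z) (a z j)
            have h4 : ε' / (2 * (m + 1)) = ε' / (4 * (m + 1)) + ε' / (4 * (m + 1)) := by
              field_simp; ring
            linarith
        _ = ENNReal.ofReal (ε' / (2 * (m + 1)) * m) := by
            rw [← ENNReal.ofReal_sum_of_nonneg fun _ _ => by positivity, Finset.mul_sum]
        _ ≤ _ := by
            refine ENNReal.ofReal_le_ofReal ?_
            rw [div_mul_eq_mul_div, div_le_iff₀ (by positivity)]
            nlinarith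
    calc _ ≤ ENNReal.ofReal (ε' / 2) + ENNReal.ofReal (ε' / 2) := by
          refine add_le_add (le_trans ?_ hsK) h2
          exact mul_le_mul_right (mul_le_mul_right (add_le_add (hgM i) (hgM j)) _) _
      _ = ENNReal.ofReal ε' := by
          rw [← ENNReal.ofReal_add (by positivity) (by positivity), add_halves]
  obtain ⟨F, hF⟩ := CompleteSpace.complete hcauchy
  have hcl : MapClusterPt F atTop f := by
    refine ClusterPt.of_le_nhds hF |>.mono (map_mono ?_)
    rw [← Nat.cofinite_eq_atTop]
    exact hyperfilter_le_cofinite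
  obtain ⟨ψ, hψ, hlim⟩ := hcl.tendsto_subseq
  have hFm : Measurable F := (Lp.stronglyMeasurable F).measurable
  refine ⟨ψ, (ball x R).indicator fun y => max (F y) 0, hψ,
    (hFm.max measurable_const).indicator measurableSet_ball,
    fun y => indicator_nonneg (fun _ _ => le_max_right _ _) y,
    fun y hy => indicator_of_notMem hy _,
    ((L1.integrable_coeFn F).pos_part).indicator measurableSet_ball, ?_⟩
  have h0 : Tendsto (fun n => edist (f (ψ n)) F) atTop (𝓝 0) := by
    rw [tendsto_iff_edist_tendsto_0] at hlim
    exact hlim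
  refine tendsto_of_tendsto_of_tendsto_of_le_of_le tendsto_const_nhds h0 (fun _ => zero_le)
    fun n => ?_
  have h1 : edist (f (ψ n)) F = ∫⁻ y, ENNReal.ofReal |v (ψ n) y - F y| ∂μ := by
    rw [hf, ← Integrable.toL1_coeFn F (L1.integrable_coeFn F), Integrable.edist_toL1_toL1]
    simp only [edist_dist, Real.dist_eq, Integrable.toL1_coeFn]
  dsimp only
  rw [h1]
  refine lintegral_mono fun y => ENNReal.ofReal_le_ofReal ?_
  by_cases hy : y ∈ ball x R
  · rw [indicator_of_mem hy, ← max_eq_left ((h (ψ n)).nonneg y)]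
    have := abs_max_sub_max_le_abs (v (ψ n) y) (F y) 0
    rwa [max_eq_left ((h (ψ n)).nonneg y)] at this ⊢
  · rw [indicator_of_notMem hy, (h _).zero y hy]
    simp

end Compactness

section Minimization
variable {μ : Measure X} {Cd CP lam : ℝ}

/-- A sequence minimizing the energy among functions that lie asymptotically above `f`, together
with its limit `u` in `L¹` and the limit `m` of the energies. -/
structure MinimizingSeq (μ : Measure X) (x : X) (R : ℝ) (f : X → ℝ) (m : ℝ≥0∞) (v : ℕ → X → ℝ)
    (g : ℕ → X → ℝ≥0∞) (u : X → ℝ) : Prop where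
  adm : ∀ i, Adm μ x R (v i) (g i)
  lower : Tendsto (fun i => ∫⁻ y, ENNReal.ofReal (f y - v i y) ∂μ) atTop (𝓝 0)
  ne_top : m ≠ ∞
  bound : ∀ i, ∫⁻ y, g i y ∂μ ≤ m + 1
  energy : ∀ ε : ℝ≥0∞, ε ≠ 0 → ∀ᶠ i in atTop, ∫⁻ y, g i y ∂μ ≤ m + ε
  conv : Tendsto (fun i => ∫⁻ y, ENNReal.ofReal |v i y - u y| ∂μ) atTop (𝓝 0)
  meas : Measurable u
  nonneg : ∀ y, 0 ≤ u y
  zero : ∀ y, y ∉ ball x R → u y = 0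
  integrable : Integrable u μ
  le_energy : ∀ (z : ℕ → X → ℝ) (e : ℕ → X → ℝ≥0∞), (∀ i, Adm μ x R (z i) (e i)) →
    Tendsto (fun i => ∫⁻ y, ENNReal.ofReal (f y - z i y) ∂μ) atTop (𝓝 0) →
    ∀ ε : ℝ≥0∞, ε ≠ 0 → ∀ᶠ i in atTop, m ≤ ∫⁻ y, e i y ∂μ + ε

lemma tendsto_ofReal_one_div : Tendsto (fun n : ℕ => ENNReal.ofReal (1 / ((n:ℝ) + 1))) atTop (𝓝 0) := by
  have := (ENNReal.continuous_ofReal.tendsto 0).comp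
    (tendsto_one_div_add_atTop_nhds_zero_nat (𝕜 := ℝ))
  simpa [Function.comp_def] using this

theorem exists_minimizingSeq [BorelSpace X] (hX : MMS μ Cd CP lam) {x y₀ : X} {R : ℝ} (hR : 0 < R)
    (hy₀ : 4 * R ≤ dist y₀ x) {f : X → ℝ} {Gf : X → ℝ≥0∞} (hf : Adm μ x R f Gf) :
    ∃ m v g u, MinimizingSeq μ x R f m v g u ∧ m ≤ ∫⁻ y, Gf y ∂μ := by
  set c : ℕ → ℝ≥0∞ := fun k => ENNReal.ofReal (1 / ((k:ℝ) + 1)) with hc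
  have hc0 : ∀ k, c k ≠ 0 := fun k => (ENNReal.ofReal_pos.2 (by positivity)).ne'
  have hc1 : ∀ k, c k ≤ 1 := fun k => by
    rw [hc, ENNReal.ofReal_le_one, div_le_one (by positivity)]
    linarith [(Nat.cast_nonneg k : (0:ℝ) ≤ k)]
  set S : ℕ → Set ℝ≥0∞ := fun k => {a | ∃ v g, Adm μ x R v g ∧
    ∫⁻ y, ENNReal.ofReal (f y - v y) ∂μ ≤ c k ∧ ∫⁻ y, g y ∂μ = a} with hS
  set E : ℕ → ℝ≥0∞ := fun k => sInf (S k) with hE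
  have hEf : ∀ k, E k ≤ ∫⁻ y, Gf y ∂μ := fun k => sInf_le ⟨f, Gf, hf, by simp, rfl⟩
  set m := ⨆ k, E k with hm
  have hmf : m ≤ ∫⁻ y, Gf y ∂μ := iSup_le hEf
  have hmt : m ≠ ∞ := (hmf.trans_lt hf.gfin.lt_top).ne
  have hex : ∀ k, ∃ v g, Adm μ x R v g ∧ ∫⁻ y, ENNReal.ofReal (f y - v y) ∂μ ≤ c k ∧
      ∫⁻ y, g y ∂μ ≤ m + c k := by
    intro k
    have h1 : E k < m + c k :=
      (le_iSup E k).trans_lt (ENNReal.lt_add_right hmt (hc0 k))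
    obtain ⟨a, ⟨v, g, hv, hvc, rfl⟩, ha⟩ := sInf_lt_iff.1 h1
    exact ⟨v, g, hv, hvc, ha.le⟩
  choose v g hadm hlow hen using hex
  obtain ⟨ψ, u, hψ, hu, hu0, huz, hui, hconv⟩ := hX.exists_subseq_tendsto hR hy₀ hadm
    (M := m + 1) (by simp [hmt]) fun i => (hen i).trans (add_le_add_right (hc1 i) _)
  have hcψ : Tendsto (fun i => c (ψ i)) atTop (𝓝 0) :=
    tendsto_ofReal_one_div.comp hψ.tendsto_atTop
  refine ⟨m, fun i => v (ψ i), fun i => g (ψ i), u, ⟨fun i => hadm _, ?_, hmt,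
    fun i => (hen _).trans (add_le_add_right (hc1 _) _), fun ε hε => ?_, hconv, hu, hu0, huz, hui,
    fun z e hz hlz ε hε => ?_⟩, hmf⟩
  · exact tendsto_of_tendsto_of_tendsto_of_le_of_le tendsto_const_nhds hcψ (fun _ => zero_le)
      fun i => hlow _
  · filter_upwards [hcψ.eventually (ge_mem_nhds hε.bot_lt)] with i hi
    exact (hen _).trans (add_le_add_right hi _)
  · rcases eq_or_ne m 0 with h0 | h0
    · simp [h0]
    · obtain ⟨k, hk⟩ := lt_iSup_iff.1 (ENNReal.sub_lt_self hmt h0 hε)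
      filter_upwards [hlz.eventually (ge_mem_nhds (hc0 k).bot_lt)] with i hi
      refine tsub_le_iff_right.1 (hk.le.trans ?_)
      exact sInf_le ⟨z i, e i, hz i, hi, rfl⟩

lemma MinimizingSeq.le_ae [BorelSpace X] {x : X} {R : ℝ} {f : X → ℝ} {m : ℝ≥0∞} {v : ℕ → X → ℝ}
    {g : ℕ → X → ℝ≥0∞} {u : X → ℝ} (h : MinimizingSeq μ x R f m v g u) (hf : Measurable f) :
    ∀ᵐ y ∂μ, f y ≤ u y := by
  have h1 : ∫⁻ y, ENNReal.ofReal (f y - u y) ∂μ = 0 := by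
    have h2 := h.lower.add h.conv
    rw [add_zero] at h2
    refine le_antisymm (ge_of_tendsto h2 (Eventually.of_forall fun i => ?_)) zero_le
    have hm : Measurable fun y => ENNReal.ofReal (f y - v i y) :=
      (hf.sub (h.adm i).meas).ennreal_ofReal
    rw [← lintegral_add_left hm]
    refine lintegral_mono fun y => ?_
    refine le_trans (ENNReal.ofReal_le_ofReal ?_) ENNReal.ofReal_add_le
    linarith [le_abs_self (v i y - u y)]
  have hm : Measurable fun y => ENNReal.ofReal (f y - u y) := (hf.sub h.meas).ennreal_ofReal
  rw [lintegral_eq_zero_iff hm] at h1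
  filter_upwards [h1] with y hy
  have := ENNReal.ofReal_eq_zero.1 hy
  linarith

lemma liminf_add_le_of_tendsto_zero {a e : ℕ → ℝ≥0∞} (he : Tendsto e atTop (𝓝 0)) :
    liminf (fun i => a i + e i) atTop ≤ liminf a atTop := by
  refine le_of_forall_lt fun c hc => ?_
  obtain ⟨c', hcc', hc'⟩ := exists_between hc
  obtain ⟨d, hcd, hdc'⟩ := exists_between hcc'
  refine hcd.trans_le (le_liminf_of_le (h := ?_))
  have h1 := eventually_lt_of_lt_liminf hc'
  filter_upwards [h1, he.eventually (gt_mem_nhds (tsub_pos_of_lt hdc'))] with i hi hi2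
  by_contra hlt
  rw [not_le] at hlt
  have := ENNReal.add_lt_add hlt hi2
  rw [add_tsub_cancel_of_le hdc'.le] at this
  exact absurd hi this.not_gt

/-- Lower semicontinuity bound for the total variation. -/
theorem tv_le_liminf [BorelSpace X] (hX : MMS μ Cd CP lam) {x : X} {R : ℝ} {v : ℕ → X → ℝ}
    {g : ℕ → X → ℝ≥0∞} (h : ∀ i, Adm μ x R (v i) (g i)) {u : X → ℝ}
    (hu : Tendsto (fun i => ∫⁻ y, ENNReal.ofReal |v i y - u y| ∂μ) atTop (𝓝 0)) {U : Set X}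
    (hU : IsOpen U) : tv μ u U ≤ liminf (fun i => ∫⁻ y in U, g i y ∂μ) atTop := by
  choose w G hadm hlip hUG hgG hint hclose using fun i : ℕ => (h i).exists_lipschitz hX
    (ε := ENNReal.ofReal (1 / ((i:ℝ) + 1))) (ENNReal.ofReal_pos.2 (by positivity)).ne'
  refine le_trans ?_ (liminf_add_le_of_tendsto_zero tendsto_ofReal_one_div)
  unfold tv
  refine iInf_le_of_le w <| iInf_le_of_le ?_ <| iInf_le_of_le ?_ <| iInf_le_of_le G <|
    iInf_le_of_le (fun i => (hadm i).gmeas) <| iInf_le_of_le ?_ ?_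
  · intro i K _ _
    obtain ⟨L, hL⟩ := hlip i
    exact ⟨L, hL.lipschitzOnWith⟩
  · intro K _ _
    have h1 := tendsto_ofReal_one_div.add hu
    rw [add_zero] at h1
    refine tendsto_of_tendsto_of_tendsto_of_le_of_le tendsto_const_nhds h1 (fun _ => zero_le)
      fun i => (setLIntegral_le_lintegral _ _).trans ?_
    exact (lintegral_abs_sub_le_add ((hadm i).meas.sub (h i).meas)).trans
      (add_le_add_left (hclose i) _)
  · exact fun i => isWeakUpperGradientOn_of_forall fun γ _ => hUG i γ fun _ _ => mem_univ _
  · exact liminf_le_liminf (Eventually.of_forall fun i =>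
      setLIntegral_le_of_lintegral_le (h i).gfin (hgG i) (hint i) hU.measurableSet)

lemma exists_cutoff_of_isCompact [ProperSpace X] {C U : Set X} (hC : IsCompact C) (hU : IsOpen U)
    (hCU : C ⊆ U) :
    ∃ (η : X → ℝ) (L : ℝ≥0) (U' C' : Set X), LipschitzWith L η ∧ (∀ y, 0 ≤ η y) ∧ (∀ y, η y ≤ 1) ∧
      IsOpen U' ∧ C ⊆ U' ∧ U' ⊆ C' ∧ (∀ y ∈ U', η y = 1) ∧ IsCompact C' ∧ C' ⊆ U ∧
      ∀ y, y ∉ C' → η y = 0 := by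
  obtain ⟨δ, hδ, hδU⟩ := hC.exists_cthickening_subset_open hU hCU
  have hδ2 : 0 < δ / 2 := half_pos hδ
  have hsub : thickening (δ / 2) (thickening (δ / 2) C) ⊆ cthickening δ C := by
    refine (thickening_thickening_subset _ _ _).trans ?_
    rw [add_halves]
    exact thickening_subset_cthickening _ _
  refine ⟨fun y => thickenedIndicator hδ2 (thickening (δ / 2) C) y, (δ / 2).toNNReal⁻¹,
    thickening (δ / 2) C, cthickening δ C, ?_, fun y => NNReal.coe_nonneg _, fun y => ?_,
    isOpen_thickening, self_subset_thickening hδ2 C,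
    (self_subset_thickening hδ2 _).trans hsub, fun y hy => ?_, hC.cthickening, hδU, fun y hy => ?_⟩
  · have := lipschitzWith_thickenedIndicator hδ2 (thickening (δ / 2) C)
    exact this
  · exact_mod_cast thickenedIndicator_le_one hδ2 _ y
  · beta_reduce
    rw [thickenedIndicator_one hδ2 _ hy]; simp
  · beta_reduce
    rw [thickenedIndicator_zero hδ2 _ fun h => hy (hsub h)]; simp

lemma lipschitz_mul_of_lipschitzOn {C : Set X} (hC : IsCompact C) {χ w : X → ℝ} {L K : ℝ≥0}
    (hχ : LipschitzWith L χ) (h0 : ∀ y, 0 ≤ χ y) (h1 : ∀ y, χ y ≤ 1) (hz : ∀ y, y ∉ C → χ y = 0)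
    (hw : LipschitzOnWith K w C) :
    ∃ (L' : ℝ≥0) (M : ℝ), LipschitzWith L' (fun y => χ y * w y) ∧ ∀ y, |χ y * w y| ≤ M := by
  obtain ⟨M, hM⟩ := hC.exists_bound_of_continuousOn hw.continuousOn
  have hM' : ∀ y ∈ C, |w y| ≤ max M 0 := fun y hy => (hM y hy).trans (le_max_left _ _)
  have hM0 : 0 ≤ max M 0 := le_max_right _ _
  have key : ∀ y z, |χ y * w y - χ z * w z| ≤ (K + max M 0 * L) * dist y z := by
    have hL : ∀ y z, |χ y - χ z| ≤ L * dist y z := fun y z => hχ.dist_le_mul y z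
    have out : ∀ y z, y ∈ C → z ∉ C → |χ y * w y - χ z * w z| ≤ (K + max M 0 * L) * dist y z := by
      intro y z hy hzC
      have h2 : χ y * w y - χ z * w z = (χ y - χ z) * w y := by rw [hz z hzC]; ring
      rw [h2, abs_mul]
      calc _ ≤ (L * dist y z) * max M 0 :=
            mul_le_mul (hL y z) (hM' y hy) (abs_nonneg _) (by positivity)
        _ ≤ _ := by nlinarith [mul_nonneg K.coe_nonneg (dist_nonneg (x := y) (y := z))]
    intro y z
    by_cases hy : y ∈ C <;> by_cases hzC : z ∈ C
    · have h2 : χ y * w y - χ z * w z = χ z * (w y - w z) + (χ y - χ z) * w y := by ring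
      have h3 : |w y - w z| ≤ K * dist y z := hw.dist_le_mul y hy z hzC
      rw [h2]
      refine (abs_add_le _ _).trans ?_
      rw [abs_mul, abs_mul, abs_of_nonneg (h0 z)]
      calc _ ≤ 1 * (K * dist y z) + (L * dist y z) * max M 0 :=
            add_le_add (mul_le_mul (h1 z) h3 (abs_nonneg _) zero_le_one)
              (mul_le_mul (hL y z) (hM' y hy) (abs_nonneg _) (by positivity))
        _ = _ := by ring
    · exact out y z hy hzC
    · rw [abs_sub_comm, dist_comm]; exact out z y hzC hy
    · rw [hz y hy, hz z hzC]; simp; positivity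
  refine ⟨(K + max M 0 * L).toNNReal, max M 0, LipschitzWith.of_dist_le_mul fun y z => ?_,
    fun y => ?_⟩
  · rw [Real.coe_toNNReal _ (by positivity), Real.dist_eq]; exact key y z
  · by_cases hy : y ∈ C
    · rw [abs_mul, abs_of_nonneg (h0 y)]
      calc _ ≤ 1 * max M 0 := mul_le_mul (h1 y) (hM' y hy) (abs_nonneg _) zero_le_one
        _ = _ := one_mul _
    · rw [hz y hy]; simp

end Minimization

section Superminimizer
variable {μ : Measure X} {Cd CP lam : ℝ}

/-- Gluing a competitor `w i` to the minimizing sequence by means of a cutoff function `η`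
cannot decrease the energy asymptotically. -/
theorem MinimizingSeq.eventually_le [BorelSpace X] {x : X} {R : ℝ} {f : X → ℝ} {m : ℝ≥0∞}
    {v : ℕ → X → ℝ} {g : ℕ → X → ℝ≥0∞} {u : X → ℝ} (h : MinimizingSeq μ x R f m v g u)
    {η : X → ℝ} {L : ℝ≥0} (hη : LipschitzWith L η) (h0 : ∀ y, 0 ≤ η y) (h1 : ∀ y, η y ≤ 1)
    {w : ℕ → X → ℝ} {e : ℕ → X → ℝ≥0∞} (hw : ∀ i, Measurable (w i)) (hw0 : ∀ i y, 0 ≤ w i y)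
    (hwz : ∀ i y, y ∉ ball x R → w i y = 0) (hwi : ∀ i, Integrable (w i) μ)
    (he : ∀ i, Measurable (e i)) (hgrad : ∀ i, WGrad μ (e i) (w i))
    (hfin : ∀ i, ∫⁻ y, ENNReal.ofReal (η y) * e i y ∂μ ≠ ∞)
    (hlow : Tendsto (fun i => ∫⁻ y, ENNReal.ofReal (f y - (η y * w i y + (1 - η y) * v i y)) ∂μ)
      atTop (𝓝 0)) {ε : ℝ≥0∞} (hε : ε ≠ 0) :
    ∀ᶠ i in atTop, ∫⁻ y, ENNReal.ofReal (η y) * g i y ∂μ ≤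
      ∫⁻ y, ENNReal.ofReal (η y) * e i y ∂μ +
        L * ∫⁻ y in {y | η y ≠ 0 ∧ η y ≠ 1}, ENNReal.ofReal |w i y - v i y| ∂μ + ε := by
  have hηm : Measurable η := hη.continuous.measurable
  have hη1 : Measurable fun y => ENNReal.ofReal (η y) := hηm.ennreal_ofReal
  have hη2 : Measurable fun y => ENNReal.ofReal (1 - η y) := (measurable_const.sub hηm).ennreal_ofReal
  have hS : MeasurableSet {y | η y ≠ 0 ∧ η y ≠ 1} :=
    (hηm (measurableSet_singleton 0)).compl.inter (hηm (measurableSet_singleton 1)).compl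
  have hd : ∀ i, Measurable fun y => (L:ℝ≥0∞) * ENNReal.ofReal |w i y - v i y| := fun i =>
    (((hw i).sub (h.adm i).meas).abs).ennreal_ofReal.const_mul _
  set E : ℕ → X → ℝ≥0∞ := fun i y => ENNReal.ofReal (η y) * e i y + ENNReal.ofReal (1 - η y) * g i y +
    {y | η y ≠ 0 ∧ η y ≠ 1}.indicator (fun y => L * ENNReal.ofReal |w i y - v i y|) y with hE
  have hfin2 : ∀ i, ∫⁻ y, ENNReal.ofReal (1 - η y) * g i y ∂μ ≠ ∞ := fun i =>
    ((lintegral_mono fun y => (mul_le_of_le_one_left zero_le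
      (ENNReal.ofReal_le_one.2 (by linarith [h0 y])) : _ ≤ g i y)).trans_lt
        (h.adm i).gfin.lt_top).ne
  have hErr : ∀ i, ∫⁻ y, {y | η y ≠ 0 ∧ η y ≠ 1}.indicator
      (fun y => L * ENNReal.ofReal |w i y - v i y|) y ∂μ =
      L * ∫⁻ y in {y | η y ≠ 0 ∧ η y ≠ 1}, ENNReal.ofReal |w i y - v i y| ∂μ := fun i => by
    rw [lintegral_indicator hS, lintegral_const_mul' _ _ ENNReal.coe_ne_top]
  have hErrfin : ∀ i, (L:ℝ≥0∞) * ∫⁻ y in {y | η y ≠ 0 ∧ η y ≠ 1},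
      ENNReal.ofReal |w i y - v i y| ∂μ ≠ ∞ := fun i => by
    refine ENNReal.mul_ne_top ENNReal.coe_ne_top ?_
    refine ((setLIntegral_le_lintegral _ _).trans_lt ?_).ne
    have := ((hwi i).sub (h.adm i).integrable).norm.lintegral_lt_top
    simpa [Real.norm_eq_abs] using this
  have hsum : ∀ i, ∫⁻ y, E i y ∂μ = ∫⁻ y, ENNReal.ofReal (η y) * e i y ∂μ +
      ∫⁻ y, ENNReal.ofReal (1 - η y) * g i y ∂μ +
      L * ∫⁻ y in {y | η y ≠ 0 ∧ η y ≠ 1}, ENNReal.ofReal |w i y - v i y| ∂μ := fun i => by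
    rw [hE]
    beta_reduce
    have m1 : Measurable fun y => ENNReal.ofReal (η y) * e i y := hη1.mul (he i)
    have m2 : Measurable fun y => ENNReal.ofReal (η y) * e i y + ENNReal.ofReal (1 - η y) * g i y :=
      m1.add (hη2.mul (h.adm i).gmeas)
    rw [lintegral_add_left m2, lintegral_add_left m1, hErr]
  have hadm : ∀ i, Adm μ x R (fun y => η y * w i y + (1 - η y) * v i y) (E i) := fun i => by
    refine ⟨(hηm.mul (hw i)).add ((measurable_const.sub hηm).mul (h.adm i).meas), fun y => ?_,
      fun y hy => ?_, ?_, ?_, ?_, ?_⟩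
    · exact add_nonneg (mul_nonneg (h0 y) (hw0 i y))
        (mul_nonneg (by linarith [h1 y]) ((h.adm i).nonneg y))
    · simp [hwz i y hy, (h.adm i).zero y hy]
    · refine ((hwi i).add (h.adm i).integrable).mono'
        ((hηm.mul (hw i)).add ((measurable_const.sub hηm).mul (h.adm i).meas)).aestronglyMeasurable
        (Eventually.of_forall fun y => ?_)
      have a1 := hw0 i y
      have a2 := (h.adm i).nonneg y
      rw [Real.norm_eq_abs, abs_of_nonneg (add_nonneg (mul_nonneg (h0 y) a1)
        (mul_nonneg (by linarith [h1 y]) a2))]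
      simp only [Pi.add_apply]
      nlinarith [h0 y, h1 y, mul_nonneg (h0 y) a2, mul_nonneg (sub_nonneg.2 (h1 y)) a1]
    · exact ((hη1.mul (he i)).add (hη2.mul (h.adm i).gmeas)).add ((hd i).indicator hS)
    · rw [hsum]
      exact ENNReal.add_ne_top.2 ⟨ENNReal.add_ne_top.2 ⟨hfin i, hfin2 i⟩, hErrfin i⟩
    · exact (hgrad i).convexCombination (h.adm i).wgrad hη h0 h1
  have hε2 : ε / 2 ≠ 0 := (ENNReal.half_pos hε).ne'
  filter_upwards [h.energy _ hε2, h.le_energy _ E hadm hlow _ hε2] with i hi hi'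
  have hsplit : ∫⁻ y, g i y ∂μ = ∫⁻ y, ENNReal.ofReal (η y) * g i y ∂μ +
      ∫⁻ y, ENNReal.ofReal (1 - η y) * g i y ∂μ := by
    have m1 : Measurable fun y => ENNReal.ofReal (η y) * g i y := hη1.mul (h.adm i).gmeas
    rw [← lintegral_add_left m1]
    refine lintegral_congr fun y => ?_
    rw [← add_mul, ← ENNReal.ofReal_add (h0 y) (by linarith [h1 y])]
    simp
  rw [hsum] at hi'
  rw [hsplit] at hi
  refine (ENNReal.add_le_add_iff_right (hfin2 i)).1 (hi.trans ((add_le_add_left hi' _).trans ?_))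
  conv_rhs => rw [← ENNReal.add_halves ε]
  apply le_of_eq
  ring

theorem MinimizingSeq.isSuperminimizer [BorelSpace X] (hX : MMS μ Cd CP lam) {x : X} {R : ℝ}
    {f : X → ℝ} {m : ℝ≥0∞} {v : ℕ → X → ℝ} {g : ℕ → X → ℝ≥0∞} {u : X → ℝ}
    (h : MinimizingSeq μ x R f m v g u) (hf : Measurable f) : IsSuperminimizer μ u (ball x R) := by
  have := hX.properSpace
  refine ⟨fun K hK hKU => ⟨ball x R, isOpen_ball, hKU, Subset.rfl, h.integrable.integrableOn, ?_⟩,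
    fun φ hφ hφ0 => ?_⟩
  · refine (tv_le_liminf hX h.adm h.conv isOpen_ball).trans_lt (lt_of_le_of_lt
      (liminf_le_of_frequently_le' (Eventually.of_forall fun i =>
        (setLIntegral_le_lintegral _ _).trans (h.bound i)).frequently)
      (ENNReal.add_lt_top.2 ⟨h.ne_top.lt_top, ENNReal.one_lt_top⟩))
  obtain ⟨-, hKc, hKb⟩ := hφ
  refine le_iInf₂ fun V hV => le_iInf fun hKV => ?_
  refine le_iInf₂ fun v' hv' => le_iInf₂ fun hc' g' => le_iInf₂ fun hg' hw' => ?_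
  refine le_of_forall_gt_imp_ge_of_dense fun c hc => ?_
  obtain ⟨ψ, hψ, hψc⟩ := extraction_of_frequently_atTop (frequently_lt_of_liminf_lt (by isBoundedDefault) hc)
  obtain ⟨η, L, U', C', hηL, hη0, hη1, hU', hKU', hU'C', hηU', hC', hC'U, hηz⟩ :=
    exists_cutoff_of_isCompact hKc (hV.inter isOpen_ball) (subset_inter hKV hKb)
  obtain ⟨χ, L', V', C'', hχL, hχ0, hχ1, hV', hC'V', hV'C'', hχV', hC'', hC''U, hχz⟩ :=
    exists_cutoff_of_isCompact hC' (hV.inter isOpen_ball) hC'U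
  have hV'V : V' ⊆ V := (hV'C''.trans hC''U).trans inter_subset_left
  have hlip : ∀ i, ∃ (K : ℝ≥0) (M : ℝ), LipschitzWith K (fun y => χ y * max (v' (ψ i) y) 0) ∧
      ∀ y, |χ y * max (v' (ψ i) y) 0| ≤ M := fun i => by
    obtain ⟨K, hK⟩ := hv' (ψ i) C'' hC'' (hC''U.trans inter_subset_left)
    have h2 : LipschitzOnWith K (fun y => max (v' (ψ i) y) 0) C'' := by
      intro y hy z hz
      have h3 := hK hy hz
      rw [edist_dist, Real.dist_eq] at *
      refine (ENNReal.ofReal_le_ofReal ?_).trans h3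
      exact abs_max_sub_max_le_abs _ _ _
    exact lipschitz_mul_of_lipschitzOn hC'' hχL hχ0 hχ1 hχz h2
  choose Λ M hΛ hM using hlip
  set w : ℕ → X → ℝ := fun i y => χ y * max (v' (ψ i) y) 0 with hwdef
  have hw0 : ∀ i y, 0 ≤ w i y := fun i y => mul_nonneg (hχ0 y) (le_max_right _ _)
  have hwm : ∀ i, Measurable (w i) := fun i => (hΛ i).continuous.measurable
  have hwz : ∀ i y, y ∉ ball x R → w i y = 0 := fun i y hy => by
    rw [hwdef]
    beta_reduce
    rw [hχz y fun hyC => hy (hC''U hyC).2, zero_mul]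
  have hwi : ∀ i, Integrable (w i) μ := fun i =>
    hX.integrable_of_le (hwm i) (hw0 i) (fun y => (le_abs_self _).trans (hM i y)) (hwz i)
  have hwV : ∀ i, ∀ y ∈ V', w i y = max (v' (ψ i) y) 0 := fun i y hy => by
    rw [hwdef]
    beta_reduce
    rw [hχV' y hy, one_mul]
  have hweak : ∀ i, IsWeakUpperGradientOn μ (g' (ψ i)) (w i) V' := fun i => by
    obtain ⟨Γ, hΓ, hΓ'⟩ := hw' (ψ i)
    refine ⟨Γ, hΓ, fun γ hγ hγV => ?_⟩
    rw [hwV i _ (hγV 1 (by simp)), hwV i _ (hγV 0 (by simp))]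
    exact (ENNReal.ofReal_le_ofReal (abs_max_sub_max_le_abs _ _ _)).trans
      (hΓ' γ hγ fun t ht => hV'V (hγV t ht))
  have hgrad : ∀ i, WGrad μ (fun y => V'.indicator (g' (ψ i)) y +
      V'ᶜ.indicator (fun _ => (Λ i : ℝ≥0∞)) y) (w i) := fun i =>
    wgrad_of_lipschitz_of_isWeak (hΛ i) hV' (hg' _)
      (((lintegral_mono_set hV'V).trans_lt (hψc i)).trans_le le_top).ne (hweak i)
  have hgle : ∀ i, ∫⁻ y, ENNReal.ofReal (η y) * (V'.indicator (g' (ψ i)) y +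
      V'ᶜ.indicator (fun _ => (Λ i : ℝ≥0∞)) y) ∂μ ≤ ∫⁻ y in V, g' (ψ i) y ∂μ := fun i => by
    rw [← lintegral_indicator hV.measurableSet]
    refine lintegral_mono fun y => ?_
    by_cases hy : y ∈ C'
    · have h2 := hC'V' hy
      simp only [indicator_of_mem h2, indicator_of_mem (hV'V h2), indicator_of_notMem
        (show y ∉ V'ᶜ from fun h => h h2), add_zero]
      exact mul_le_of_le_one_left zero_le (ENNReal.ofReal_le_one.2 (hη1 y))
    · simp [hηz y hy]
  set δ : ℕ → ℝ≥0∞ := fun i => ∫⁻ y in C', ENNReal.ofReal |v' (ψ i) y - (u y + φ y)| ∂μ with hδ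
  have hδ0 : Tendsto δ atTop (𝓝 0) :=
    (hc' C' hC' (hC'U.trans inter_subset_left)).comp hψ.tendsto_atTop
  have hlow : Tendsto (fun i => ∫⁻ y, ENNReal.ofReal (f y - (η y * w i y + (1 - η y) * v i y)) ∂μ)
      atTop (𝓝 0) := by
    have hlim := (h.lower.add h.conv).add hδ0
    have hlim := h.lower.add hlim
    rw [add_zero, add_zero, add_zero] at hlim
    refine tendsto_of_tendsto_of_tendsto_of_le_of_le tendsto_const_nhds hlim (fun _ => zero_le)
      fun i => ?_
    have m1 : Measurable fun y => ENNReal.ofReal (f y - v i y) :=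
      (hf.sub (h.adm i).meas).ennreal_ofReal
    have m2 : Measurable fun y => ENNReal.ofReal |v i y - u y| :=
      ((h.adm i).meas.sub h.meas).abs.ennreal_ofReal
    have m3 : Measurable fun y => ENNReal.ofReal (f y - v i y) + ENNReal.ofReal |v i y - u y| :=
      m1.add m2
    rw [hδ]
    beta_reduce
    rw [← lintegral_indicator hC'.measurableSet, ← lintegral_add_left m1,
      ← lintegral_add_left m3, ← lintegral_add_left m1]
    refine lintegral_mono fun y => ?_
    have a0 := hη0 y
    have a1 := hη1 y
    by_cases hy : y ∈ C'
    · rw [indicator_of_mem hy, hwV i y (hC'V' hy)]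
      have b1 : f y - (η y * max (v' (ψ i) y) 0 + (1 - η y) * v i y) ≤
          max (f y - v i y) 0 + (max (f y - v i y) 0 + |v i y - u y| +
            |v' (ψ i) y - (u y + φ y)|) := by
        have c1 := le_max_left (v' (ψ i) y) 0
        have c2 := le_max_left (f y - v i y) 0
        have c3 := le_max_right (f y - v i y) 0
        have c4 := le_abs_self (v i y - u y)
        have c5 := neg_abs_le (v' (ψ i) y - (u y + φ y))
        have c6 := hφ0 y
        set S := max (f y - v i y) 0 + |v i y - u y| + |v' (ψ i) y - (u y + φ y)| with hS
        have hS0 : 0 ≤ S := by positivity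
        have d1 : f y - max (v' (ψ i) y) 0 ≤ S := by linarith
        have d2 : η y * (f y - max (v' (ψ i) y) 0) ≤ S :=
          (mul_le_mul_of_nonneg_left d1 a0).trans (mul_le_of_le_one_left hS0 a1)
        have d3 : (1 - η y) * (f y - v i y) ≤ max (f y - v i y) 0 :=
          (mul_le_mul_of_nonneg_left c2 (by linarith)).trans
            (mul_le_of_le_one_left c3 (by linarith))
        linarith
      refine (ENNReal.ofReal_le_ofReal b1).trans (ENNReal.ofReal_add_le.trans ?_)
      have e1 : ENNReal.ofReal (max (f y - v i y) 0) = ENNReal.ofReal (f y - v i y) := by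
        rw [ENNReal.ofReal_max]; simp
      refine add_le_add e1.le (ENNReal.ofReal_add_le.trans (add_le_add_left
        (ENNReal.ofReal_add_le.trans (add_le_add_left e1.le _)) _))
    · rw [hηz y hy]
      simp only [zero_mul, sub_zero, one_mul, zero_add]
      exact le_self_add
  have herr : ∀ i, ∫⁻ y in {y | η y ≠ 0 ∧ η y ≠ 1}, ENNReal.ofReal |w i y - v i y| ∂μ ≤
      ∫⁻ y, ENNReal.ofReal |v i y - u y| ∂μ + δ i := fun i => by
    have m2 : Measurable fun y => ENNReal.ofReal |v i y - u y| :=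
      ((h.adm i).meas.sub h.meas).abs.ennreal_ofReal
    have hηm : Measurable η := hηL.continuous.measurable
    have hS : MeasurableSet {y | η y ≠ 0 ∧ η y ≠ 1} :=
      (hηm (measurableSet_singleton 0)).compl.inter (hηm (measurableSet_singleton 1)).compl
    rw [hδ]
    beta_reduce
    rw [← lintegral_indicator hC'.measurableSet, ← lintegral_add_left m2,
      ← lintegral_indicator hS]
    refine lintegral_mono fun y => ?_
    by_cases hy : y ∈ {y | η y ≠ 0 ∧ η y ≠ 1}
    · have hyC : y ∈ C' := by
        by_contra h2
        exact hy.1 (hηz y h2)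
      have hyφ : φ y = 0 := by
        by_contra h2
        exact hy.2 (hηU' y (hKU' (subset_tsupport φ h2)))
      rw [indicator_of_mem hy, indicator_of_mem hyC, hwV i y (hC'V' hyC),
        ← ENNReal.ofReal_add (abs_nonneg _) (abs_nonneg _), hyφ, add_zero]
      refine ENNReal.ofReal_le_ofReal ?_
      have b1 : |max (v' (ψ i) y) 0 - v i y| ≤ |v' (ψ i) y - v i y| := by
        have := abs_max_sub_max_le_abs (v' (ψ i) y) (v i y) 0
        rwa [max_eq_left ((h.adm i).nonneg y)] at this
      have b2 := abs_sub_le (v' (ψ i) y) (u y) (v i y)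
      rw [abs_sub_comm (u y)] at b2
      linarith
    · rw [indicator_of_notMem hy]; exact zero_le
  refine (iInf₂_le U' hU').trans ((iInf_le _ hKU').trans
    ((tv_le_liminf hX h.adm h.conv hU').trans ?_))
  refine ENNReal.le_of_forall_pos_le_add fun ε hε hct => ?_
  have hlimerr : Tendsto (fun i => (L:ℝ≥0∞) * (∫⁻ y, ENNReal.ofReal |v i y - u y| ∂μ + δ i))
      atTop (𝓝 0) := by
    have := ENNReal.Tendsto.const_mul (a := (L:ℝ≥0∞)) (h.conv.add hδ0) (Or.inr ENNReal.coe_ne_top)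
    simpa using this
  have hε2 : ((ε:ℝ≥0∞) / 2) ≠ 0 := (ENNReal.half_pos (by exact_mod_cast hε.ne')).ne'
  have hev := h.eventually_le hηL hη0 hη1 hwm hw0 hwz hwi
    (fun i => ((hg' (ψ i)).indicator hV'.measurableSet).add
      (measurable_const.indicator hV'.measurableSet.compl)) hgrad
    (fun i => (((hgle i).trans_lt (hψc i)).trans_le le_top).ne) hlow hε2
  refine liminf_le_of_frequently_le' (Eventually.frequently ?_)
  filter_upwards [hev, hlimerr.eventually (gt_mem_nhds (pos_iff_ne_zero.2 hε2))] with i hi hi2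
  calc ∫⁻ y in U', g i y ∂μ ≤ ∫⁻ y, ENNReal.ofReal (η y) * g i y ∂μ := by
        rw [← lintegral_indicator hU'.measurableSet]
        refine lintegral_mono fun y => ?_
        by_cases hy : y ∈ U'
        · simp [indicator_of_mem hy, hηU' y hy]
        · simp [indicator_of_notMem hy]
    _ ≤ _ := hi
    _ ≤ c + ε / 2 + ε / 2 := by
        gcongr
        · exact (hgle i).trans (hψc i).le
        · exact (mul_le_mul_right (herr i) _).trans hi2.le
    _ = c + ε := by rw [add_assoc, ENNReal.add_halves]

end Superminimizer

section UpperLimit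
variable {μ : Measure X} {Cd CP lam : ℝ}

lemma WGrad.max_const {g : X → ℝ≥0∞} {v : X → ℝ} (h : WGrad μ g v) (T : ℝ) :
    WGrad μ g (fun y => max (v y) T) := by
  have h2 : LipschitzWith 1 fun a : ℝ => max a T := LipschitzWith.id.max_const T
  exact (h.comp_lipschitz h2).mono fun y => by simp

/-- A Caccioppoli type inequality above the obstacle. -/
theorem MinimizingSeq.caccioppoli [BorelSpace X] {x : X} {R : ℝ} {f : X → ℝ} {Gf : X → ℝ≥0∞}
    (hf : Adm μ x R f Gf) {m : ℝ≥0∞} {v : ℕ → X → ℝ} {g : ℕ → X → ℝ≥0∞} {u : X → ℝ}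
    (h : MinimizingSeq μ x R f m v g u) {T : ℝ} (hT : 0 ≤ T) {ρ : ℝ} (hρ : 0 < ρ) {ε : ℝ≥0∞}
    (hε : ε ≠ 0) :
    ∀ᶠ i in atTop, ∫⁻ y in ball x (2 * ρ), {y | max (f y) T < v i y}.indicator (g i) y ∂μ ≤
      ∫⁻ y in ball x (4 * ρ), Gf y ∂μ + ENNReal.ofReal (1 / (2 * ρ)) *
        ∫⁻ y in ball x (4 * ρ), ENNReal.ofReal (max (v i y - max (f y) T) 0) ∂μ + ε := by
  obtain ⟨η, hηL, hη0, hη1, hηi, hηo⟩ := exists_cutoff x (show 2 * ρ < 4 * ρ by linarith)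
  have hηm : Measurable η := hηL.continuous.measurable
  have hη' : Measurable fun y => ENNReal.ofReal (η y) := hηm.ennreal_ofReal
  set M : X → ℝ := fun y => max (f y) T with hM
  have hMm : Measurable M := hf.meas.max measurable_const
  have hM0 : ∀ y, 0 ≤ M y := fun y => le_max_of_le_right hT
  have hS : ∀ i, MeasurableSet {y | M y < v i y} := fun i => measurableSet_lt hMm (h.adm i).meas
  set e : ℕ → X → ℝ≥0∞ := fun i y =>
    {y | M y < v i y}.indicator Gf y + {y | M y < v i y}ᶜ.indicator (g i) y with he
  have hgS : ∀ i, Measurable ({y | M y < v i y}.indicator (g i)) := fun i =>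
    (h.adm i).gmeas.indicator (hS i)
  have hgS' : ∀ i, Measurable ({y | M y < v i y}ᶜ.indicator (g i)) := fun i =>
    (h.adm i).gmeas.indicator (hS i).compl
  have hGS : ∀ i, Measurable ({y | M y < v i y}.indicator Gf) := fun i => hf.gmeas.indicator (hS i)
  have hle : ∀ i y, ENNReal.ofReal (η y) * e i y ≤ Gf y + g i y := fun i y => by
    refine (mul_le_of_le_one_left zero_le (ENNReal.ofReal_le_one.2 (hη1 y))).trans ?_
    exact add_le_add (indicator_le_self _ _ _) (indicator_le_self _ _ _)
  have hfin : ∀ i, ∫⁻ y, ENNReal.ofReal (η y) * e i y ∂μ ≠ ∞ := fun i => by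
    refine ((lintegral_mono (hle i)).trans_lt ?_).ne
    rw [lintegral_add_left hf.gmeas]
    exact ENNReal.add_lt_top.2 ⟨hf.gfin.lt_top, (h.adm i).gfin.lt_top⟩
  have hlow : Tendsto (fun i => ∫⁻ y, ENNReal.ofReal
      (f y - (η y * min (v i y) (M y) + (1 - η y) * v i y)) ∂μ) atTop (𝓝 0) := by
    refine tendsto_of_tendsto_of_tendsto_of_le_of_le tendsto_const_nhds h.lower
      (fun _ => zero_le) fun i => lintegral_mono fun y => ?_
    have b1 : f y - (η y * min (v i y) (M y) + (1 - η y) * v i y) ≤ max (f y - v i y) 0 := by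
      have c1 : f y - min (v i y) (M y) ≤ max (f y - v i y) 0 := by
        rcases min_choice (v i y) (M y) with h2 | h2 <;> rw [h2]
        · exact le_max_left _ _
        · exact le_max_of_le_right (by linarith [le_max_left (f y) T])
      have c2 := mul_le_mul_of_nonneg_left c1 (hη0 y)
      have c3 := mul_le_mul_of_nonneg_left (le_max_left (f y - v i y) 0)
        (sub_nonneg.2 (hη1 y))
      linarith
    refine (ENNReal.ofReal_le_ofReal b1).trans ?_
    rw [ENNReal.ofReal_max]; simp
  have hev := h.eventually_le hηL hη0 hη1 (w := fun i y => min (v i y) (M y)) (e := e)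
    (fun i => (h.adm i).meas.min hMm) (fun i y => le_min ((h.adm i).nonneg y) (hM0 y))
    (fun i y hy => by simp [(h.adm i).zero y hy, hM0 y])
    (fun i => (h.adm i).integrable.mono' ((h.adm i).meas.min hMm).aestronglyMeasurable
      (Eventually.of_forall fun y => by
        rw [Real.norm_eq_abs, abs_of_nonneg (le_min ((h.adm i).nonneg y) (hM0 y))]
        exact min_le_left _ _))
    (fun i => (hGS i).add (hgS' i)) (fun i => (h.adm i).wgrad.inf (hf.wgrad.max_const T))
    hfin hlow hε
  filter_upwards [hev] with i hi
  have m1 : Measurable fun y => ENNReal.ofReal (η y) * {y | M y < v i y}ᶜ.indicator (g i) y :=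
    hη'.mul (hgS' i)
  have hfin3 : ∫⁻ y, ENNReal.ofReal (η y) * {y | M y < v i y}ᶜ.indicator (g i) y ∂μ ≠ ∞ := by
    refine ((lintegral_mono fun y => ?_).trans_lt (h.adm i).gfin.lt_top).ne
    exact (mul_le_of_le_one_left zero_le (ENNReal.ofReal_le_one.2 (hη1 y))).trans
      (indicator_le_self _ _ _)
  have hL : ∫⁻ y, ENNReal.ofReal (η y) * g i y ∂μ =
      ∫⁻ y, ENNReal.ofReal (η y) * {y | M y < v i y}ᶜ.indicator (g i) y ∂μ +
      ∫⁻ y, ENNReal.ofReal (η y) * {y | M y < v i y}.indicator (g i) y ∂μ := by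
    rw [← lintegral_add_left m1]
    refine lintegral_congr fun y => ?_
    rw [← mul_add, indicator_compl_add_self_apply]
  have hRt : ∫⁻ y, ENNReal.ofReal (η y) * e i y ∂μ =
      ∫⁻ y, ENNReal.ofReal (η y) * {y | M y < v i y}ᶜ.indicator (g i) y ∂μ +
      ∫⁻ y, ENNReal.ofReal (η y) * {y | M y < v i y}.indicator Gf y ∂μ := by
    rw [← lintegral_add_left m1]
    refine lintegral_congr fun y => ?_
    rw [← mul_add, he, add_comm]
  rw [hL, hRt, add_assoc, add_assoc] at hi
  have hi := (ENNReal.add_le_add_iff_left hfin3).1 hi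
  have k1 : ∫⁻ y in ball x (2 * ρ), {y | M y < v i y}.indicator (g i) y ∂μ ≤
      ∫⁻ y, ENNReal.ofReal (η y) * {y | M y < v i y}.indicator (g i) y ∂μ := by
    rw [← lintegral_indicator measurableSet_ball]
    refine lintegral_mono fun y => ?_
    by_cases hy : y ∈ ball x (2 * ρ)
    · rw [indicator_of_mem hy, hηi y (mem_ball.1 hy).le]; simp
    · rw [indicator_of_notMem hy]; exact zero_le
  have k2 : ∫⁻ y, ENNReal.ofReal (η y) * {y | M y < v i y}.indicator Gf y ∂μ ≤
      ∫⁻ y in ball x (4 * ρ), Gf y ∂μ := by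
    rw [← lintegral_indicator measurableSet_ball]
    refine lintegral_mono fun y => ?_
    by_cases hy : y ∈ ball x (4 * ρ)
    · rw [indicator_of_mem hy]
      exact (mul_le_of_le_one_left zero_le (ENNReal.ofReal_le_one.2 (hη1 y))).trans
        (indicator_le_self _ _ _)
    · rw [hηo y (by simpa using hy)]; simp
  have k3 : ∫⁻ y in {y | η y ≠ 0 ∧ η y ≠ 1}, ENNReal.ofReal |min (v i y) (M y) - v i y| ∂μ ≤
      ∫⁻ y in ball x (4 * ρ), ENNReal.ofReal (max (v i y - M y) 0) ∂μ := by
    refine (lintegral_mono_set fun y hy => ?_).trans (lintegral_mono fun y => ?_)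
    · by_contra h2
      exact hy.1 (hηo y (by simpa using h2))
    · refine ENNReal.ofReal_le_ofReal ?_
      rcases le_total (v i y) (M y) with h2 | h2
      · rw [min_eq_left h2]; simp
      · rw [min_eq_right h2, abs_sub_comm, abs_of_nonneg (sub_nonneg.2 h2)]
        exact le_max_left _ _
  have k4 : (((1 / (4 * ρ - 2 * ρ)).toNNReal : ℝ≥0) : ℝ≥0∞) = ENNReal.ofReal (1 / (2 * ρ)) := by
    rw [show 4 * ρ - 2 * ρ = 2 * ρ by ring]; rfl
  rw [k4] at hi
  refine k1.trans (hi.trans ?_)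
  rw [add_assoc]
  gcongr

theorem MinimizingSeq.lintegral_decay [BorelSpace X] (hX : MMS μ Cd CP lam) {x y₀ : X} {R : ℝ}
    (hR : 0 < R) (hy₀ : 4 * R ≤ dist y₀ x) {F : ℝ} (hF : 0 < F)
    (hgrow : ∀ ρ : ℝ, 0 < ρ → ρ ≤ 8 * R → ENNReal.ofReal (F * ρ) ≤ μ (ball x ρ))
    {f : X → ℝ} {Gf : X → ℝ≥0∞} (hf : Adm μ x R f Gf) {m : ℝ≥0∞} {v : ℕ → X → ℝ}
    {g : ℕ → X → ℝ≥0∞} {u : X → ℝ} (h : MinimizingSeq μ x R f m v g u) :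
    ∃ T : ℝ, 0 ≤ T ∧ ∀ ρ, 0 < ρ → ρ ≤ R →
      ∫⁻ y in ball x ρ, ENNReal.ofReal (max (u y - max (f y) T) 0) ∂μ ≤
        ENNReal.ofReal (1 / 8 * ρ) * (2 * ∫⁻ y in ball x (4 * ρ), Gf y ∂μ +
          ENNReal.ofReal (1 / (2 * ρ)) *
            ∫⁻ y in ball x (4 * ρ), ENNReal.ofReal (max (u y - max (f y) T) 0) ∂μ) := by
  have hCP := hX.hCP
  have hCd : 0 < Cd := by linarith [hX.hCd]
  have hlam := hX.hlam
  obtain ⟨k₀, hk₀⟩ := pow_unbounded_of_one_lt (4 * lam + 2) (one_lt_two (α := ℝ))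
  set σ : ℝ := min (1 / lam) (1 / (16 * CP * Cd ^ k₀)) with hσ
  have hσ0 : 0 < σ := lt_min (by positivity) (by positivity)
  have hσl : lam * σ ≤ 1 := by
    have : σ ≤ 1 / lam := min_le_left _ _
    rw [le_div_iff₀ (by linarith)] at this
    linarith
  have hσ1 : σ ≤ 1 := by nlinarith
  have hσ2 : 2 * (CP * σ) * Cd ^ k₀ ≤ 1 / 8 := by
    have : σ ≤ 1 / (16 * CP * Cd ^ k₀) := min_le_right _ _
    rw [le_div_iff₀ (by positivity)] at this
    linarith
  obtain ⟨k, hk⟩ := pow_unbounded_of_one_lt (3 / σ) (one_lt_two (α := ℝ))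
  rw [div_lt_iff₀ hσ0] at hk
  have hmt : m + 1 ≠ ∞ := by simp [h.ne_top]
  set κ : ℝ := (m + 1).toReal with hκ
  have hκ1 : 1 ≤ κ := by
    rw [hκ, ← ENNReal.toReal_one]
    exact ENNReal.toReal_mono hmt le_add_self
  have hκe : ENNReal.ofReal κ = m + 1 := ENNReal.ofReal_toReal hmt
  set T : ℝ := (8 * CP * Cd ^ 4 * κ + 8 * CP * κ * Cd ^ k + 1) / F with hTd
  have hTF : T * F = 8 * CP * Cd ^ 4 * κ + 8 * CP * κ * Cd ^ k + 1 := div_mul_cancel₀ _ hF.ne'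
  have p1 : 0 < 8 * CP * Cd ^ 4 * κ := by positivity
  have p2 : 0 < 8 * CP * κ * Cd ^ k := by positivity
  have hT : 0 < T := by positivity
  refine ⟨T, hT.le, fun ρ hρ hρR => ?_⟩
  set M : X → ℝ := fun y => max (f y) T with hM
  have hMm : Measurable M := hf.meas.max measurable_const
  set K₁ : ℝ≥0∞ := ENNReal.ofReal (1 / 8 * ρ) with hK₁
  set c : ℝ≥0∞ := ENNReal.ofReal (1 / (2 * ρ)) with hc
  set ω := ∫⁻ y in ball x (4 * ρ), Gf y ∂μ with hω
  set I := fun r => ∫⁻ y in ball x r, ENNReal.ofReal (max (u y - M y) 0) ∂μ with hI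
  have hdens : ∀ i, μ (ball x (2 * ρ) ∩ {y | 0 < max (v i y - M y) 0}) ≤
      ENNReal.ofReal (1 / (2 * Cd ^ k)) * μ (ball x (2 * ρ)) := fun i => by
    refine (measure_mono (inter_subset_inter_right _ fun y hy => ?_)).trans
      ((hX.density_level hR hy₀ hF hgrow (h.adm i) hT (by linarith)
        ((h.bound i).trans hκe.ge) (by linarith) (by positivity) (by linarith)).trans ?_)
    · have hy : 0 < max (v i y - M y) 0 := hy
      have : 0 < v i y - M y := by
        by_contra h2
        rw [max_eq_right (not_lt.1 h2)] at hy
        exact lt_irrefl _ hy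
      have h3 : T ≤ M y := le_max_right _ _
      exact (by linarith : T ≤ v i y)
    · refine mul_le_mul_left (ENNReal.ofReal_le_ofReal ?_) _
      rw [hTF, div_le_div_iff₀ (by linarith) (by positivity)]
      linarith
  have hε' : ENNReal.ofReal (1 / (2 * Cd ^ k)) * ENNReal.ofReal Cd ^ k ≤ 1 / 2 := by
    rw [← ENNReal.ofReal_pow hCd.le, ← ENNReal.ofReal_mul (by positivity),
      show 1 / (2 * Cd ^ k) * Cd ^ k = 1 / 2 by field_simp,
      ENNReal.ofReal_div_of_pos (by norm_num)]
    simp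
  have hpi : ∀ i, Integrable (fun y => max (v i y - M y) 0) μ := fun i =>
    (h.adm i).integrable.mono' (((h.adm i).meas.sub hMm).max measurable_const).aestronglyMeasurable
      (Eventually.of_forall fun y => by
        rw [Real.norm_eq_abs, abs_of_nonneg (le_max_right _ _)]
        have : 0 ≤ M y := hT.le.trans (le_max_right _ _)
        exact max_le (by linarith) ((h.adm i).nonneg y))
  have key : ∀ ε : ℝ≥0∞, 0 < ε → I ρ ≤ K₁ * (2 * ω + c * (I (4 * ρ) + ε) + ε) + ε := by
    intro ε hε
    have hev := h.caccioppoli hf hT.le hρ hε.ne'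
    obtain ⟨i, hi, hd⟩ := (hev.and (h.conv.eventually (ge_mem_nhds hε))).exists
    have hdm : Measurable fun y => ENNReal.ofReal |v i y - u y| :=
      ((h.adm i).meas.sub h.meas).abs.ennreal_ofReal
    have hclose : ∀ r, ∫⁻ y in ball x r, ENNReal.ofReal |v i y - u y| ∂μ ≤ ε := fun r =>
      (setLIntegral_le_lintegral _ _).trans hd
    have a1 : I ρ ≤ ∫⁻ y in ball x ρ, ENNReal.ofReal (max (v i y - M y) 0) ∂μ + ε := by
      refine le_trans ?_ (add_le_add_right (hclose ρ) _)
      rw [← lintegral_add_right _ hdm]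
      refine lintegral_mono fun y => ?_
      refine le_trans (ENNReal.ofReal_le_ofReal ?_) ENNReal.ofReal_add_le
      refine max_le ?_ (by positivity)
      linarith [le_max_left (v i y - M y) 0, neg_abs_le (v i y - u y)]
    have a2 : ∫⁻ y in ball x (4 * ρ), ENNReal.ofReal (max (v i y - M y) 0) ∂μ ≤
        I (4 * ρ) + ε := by
      refine le_trans ?_ (add_le_add_right (hclose (4 * ρ)) _)
      rw [← lintegral_add_right _ hdm]
      refine lintegral_mono fun y => ?_
      refine le_trans (ENNReal.ofReal_le_ofReal ?_) ENNReal.ofReal_add_le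
      refine max_le ?_ (by positivity)
      linarith [le_max_left (u y - M y) 0, le_abs_self (v i y - u y)]
    have hS : MeasurableSet {y | M y < v i y} := measurableSet_lt hMm (h.adm i).meas
    have a3 := hX.lintegral_ball_le_of_density x hρ hσ0 hσ1 hσl hk.le hk₀.le hε' (hpi i)
      (((h.adm i).meas.sub hMm).max measurable_const) (fun y => le_max_right _ _)
      (((h.adm i).gmeas.add hf.gmeas).indicator hS)
      ((h.adm i).wgrad.posPart_sub (hf.wgrad.max_const T)) (hdens i)
    have a4 : ∫⁻ y in ball x (2 * ρ), {y | M y < v i y}.indicator (fun y => g i y + Gf y) y ∂μ ≤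
        2 * ω + c * (I (4 * ρ) + ε) + ε := by
      have b1 : ∫⁻ y in ball x (2 * ρ), {y | M y < v i y}.indicator (fun y => g i y + Gf y) y ∂μ ≤
          ∫⁻ y in ball x (2 * ρ), {y | M y < v i y}.indicator (g i) y ∂μ + ω := by
        refine le_trans ?_ (add_le_add_right (lintegral_mono_set
          (ball_subset_ball (by linarith : 2 * ρ ≤ 4 * ρ))) _)
        rw [← lintegral_add_right _ hf.gmeas]
        refine lintegral_mono fun y => ?_
        by_cases hy : y ∈ {y | M y < v i y}
        · simp only [indicator_of_mem hy, le_refl]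
        · simp only [indicator_of_notMem hy]; exact zero_le
      have b2 : ∫⁻ y in ball x (2 * ρ), {y | M y < v i y}.indicator (g i) y ∂μ ≤
          ω + c * (I (4 * ρ) + ε) + ε :=
        hi.trans (add_le_add_left (add_le_add_right (mul_le_mul_right a2 _) _) _)
      calc _ ≤ ω + c * (I (4 * ρ) + ε) + ε + ω := b1.trans (add_le_add_left b2 _)
        _ = 2 * ω + c * (I (4 * ρ) + ε) + ε := by
          generalize c * (I (4 * ρ) + ε) = a
          rw [two_mul]
          abel
    refine a1.trans (add_le_add_left (a3.trans ?_) _)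
    rw [← mul_assoc]
    refine mul_le_mul' ?_ a4
    rw [← ENNReal.ofReal_pow hCd.le, ← ENNReal.ofReal_ofNat 2, ← ENNReal.ofReal_mul (by norm_num),
      ← ENNReal.ofReal_mul (by positivity), hK₁]
    refine ENNReal.ofReal_le_ofReal ?_
    nlinarith
  have hcont : Continuous fun ε : ℝ≥0∞ => K₁ * (2 * ω + c * (I (4 * ρ) + ε) + ε) + ε := by
    refine ((ENNReal.continuous_const_mul ENNReal.ofReal_ne_top).comp
      ((continuous_const.add ((ENNReal.continuous_const_mul ENNReal.ofReal_ne_top).comp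
        (continuous_const.add continuous_id))).add continuous_id)).add continuous_id
  have hlim := (hcont.tendsto 0).mono_left (nhdsWithin_le_nhds (s := Ioi (0:ℝ≥0∞)))
  have := ge_of_tendsto hlim (eventually_mem_nhdsWithin.mono fun ε hε => key ε hε)
  simpa only [add_zero] using this

lemma exists_quadratic_bound {I ω : ℝ → ℝ} {P ρ₀ : ℝ} (hρ₀ : 0 < ρ₀) (hP : ∀ ρ, I ρ ≤ P)
    (hP0 : 0 ≤ P)
    (h : ∀ ρ, 0 < ρ → ρ ≤ ρ₀ → I ρ ≤ 1 / 4 * ρ * ω ρ + 1 / 16 * I (4 * ρ))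
    (hω : Tendsto ω (𝓝[>] 0) (𝓝 0)) {δ : ℝ} (hδ : 0 < δ) :
    ∃ C ρ₁, 0 < ρ₁ ∧ ∀ ρ, 0 < ρ → ρ ≤ ρ₁ → I ρ ≤ δ * ρ + C * ρ ^ 2 := by
  obtain ⟨ρ₂, hρ₂, hsub⟩ := mem_nhdsGT_iff_exists_Ioc_subset.1 (hω.eventually (gt_mem_nhds hδ))
  have hρ₂ : 0 < ρ₂ := hρ₂
  set ρ₁ := min ρ₀ ρ₂ with hρ₁
  have hρ₁0 : 0 < ρ₁ := lt_min hρ₀ hρ₂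
  have key : ∀ n : ℕ, ∀ ρ, ρ₁ / 4 ^ n < ρ → ρ ≤ 4 * ρ₁ → I ρ ≤ δ * ρ + P / ρ₁ ^ 2 * ρ ^ 2 := by
    intro n
    have base : ∀ ρ, ρ₁ < ρ → I ρ ≤ δ * ρ + P / ρ₁ ^ 2 * ρ ^ 2 := by
      intro ρ hρ
      have h1 : P ≤ P / ρ₁ ^ 2 * ρ ^ 2 := by
        rw [div_mul_eq_mul_div, le_div_iff₀ (by positivity)]
        exact mul_le_mul_of_nonneg_left (pow_le_pow_left₀ hρ₁0.le hρ.le 2) hP0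
      have h2 : 0 < δ * ρ := mul_pos hδ (hρ₁0.trans hρ)
      linarith [hP ρ]
    induction n with
    | zero => intro ρ hρ _; exact base ρ (by simpa using hρ)
    | succ n ih =>
      intro ρ hρ hρ'
      rcases lt_or_ge ρ₁ ρ with h1 | h1
      · exact base ρ h1
      have hρ0 : 0 < ρ := lt_trans (by positivity) hρ
      have h2 := ih (4 * ρ) (by
        rw [pow_succ, ← div_div, div_lt_iff₀ (by norm_num)] at hρ
        linarith) (by linarith)
      have h3 := h ρ hρ0 (h1.trans (min_le_left _ _))
      have h4 : ω ρ < δ := hsub ⟨hρ0, h1.trans (min_le_right _ _)⟩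
      have h5 : ρ * ω ρ ≤ ρ * δ := mul_le_mul_of_nonneg_left h4.le hρ0.le
      have h6 : 0 < ρ * δ := mul_pos hρ0 hδ
      set A := P / ρ₁ ^ 2
      nlinarith
  refine ⟨P / ρ₁ ^ 2, ρ₁, hρ₁0, fun ρ hρ hρ' => ?_⟩
  obtain ⟨n, hn⟩ := pow_unbounded_of_one_lt (ρ₁ / ρ) (by norm_num : (1:ℝ) < 4)
  refine key n ρ ?_ (by linarith)
  rw [div_lt_iff₀ hρ] at hn
  rw [div_lt_iff₀ (by positivity)]
  linarith

theorem MinimizingSeq.upperApprox_lt_top [BorelSpace X] (hX : MMS μ Cd CP lam) {x y₀ : X} {R : ℝ}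
    (hR : 0 < R) (hy₀ : 4 * R ≤ dist y₀ x) {F : ℝ} (hF : 0 < F)
    (hgrow : ∀ ρ : ℝ, 0 < ρ → ρ ≤ 8 * R → ENNReal.ofReal (F * ρ) ≤ μ (ball x ρ))
    {f : X → ℝ} {Gf : X → ℝ≥0∞} (hf : Adm μ x R f Gf)
    (hdens : Tendsto (fun r => μ ({y | 0 < f y} ∩ ball x r) / μ (ball x r)) (𝓝[>] 0) (𝓝 0))
    {m : ℝ≥0∞} {v : ℕ → X → ℝ}
    {g : ℕ → X → ℝ≥0∞} {u : X → ℝ} (h : MinimizingSeq μ x R f m v g u) :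
    upperApprox μ u x < ⊤ := by
  obtain ⟨T, hT, hdecay⟩ := h.lintegral_decay hX hR hy₀ hF hgrow hf
  have hne : y₀ ≠ x := by
    rintro rfl
    simp at hy₀
    linarith
  set p : X → ℝ := fun y => max (u y - max (f y) T) 0 with hp
  have hpm : Measurable p := (h.meas.sub (hf.meas.max measurable_const)).max measurable_const
  have hpu : ∀ y, p y ≤ u y := fun y =>
    max_le (by linarith [hT.trans (le_max_right (f y) T)]) (h.nonneg y)
  have hPfin : ∫⁻ y, ENNReal.ofReal (p y) ∂μ ≠ ∞ := by
    refine ((lintegral_mono fun y => ENNReal.ofReal_le_ofReal ((hpu y).trans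
      (le_abs_self _))).trans_lt ?_).ne
    have := h.integrable.norm.lintegral_lt_top
    simpa [Real.norm_eq_abs] using this
  set I : ℝ → ℝ≥0∞ := fun r => ∫⁻ y in ball x r, ENNReal.ofReal (p y) ∂μ with hI
  have hIP : ∀ r, I r ≤ ∫⁻ y, ENNReal.ofReal (p y) ∂μ := fun r => setLIntegral_le_lintegral _ _
  have hIt : ∀ r, I r ≠ ∞ := fun r => ((hIP r).trans_lt hPfin.lt_top).ne
  set ω : ℝ → ℝ := fun r => (∫⁻ y in ball x (4 * r), Gf y ∂μ).toReal with hω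
  have hωt : ∀ r, ∫⁻ y in ball x (4 * r), Gf y ∂μ ≠ ∞ := fun r =>
    ((setLIntegral_le_lintegral _ _).trans_lt hf.gfin.lt_top).ne
  have hω0 : Tendsto ω (𝓝[>] 0) (𝓝 0) := by
    have h1 : Tendsto (fun r : ℝ => 4 * r) (𝓝[>] 0) (𝓝[>] 0) := by
      refine tendsto_nhdsWithin_iff.2 ⟨?_, eventually_mem_nhdsWithin.mono fun r hr => ?_⟩
      · have : Tendsto (fun r : ℝ => 4 * r) (𝓝 0) (𝓝 (4 * 0)) := tendsto_id.const_mul 4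
        rw [mul_zero] at this
        exact this.mono_left nhdsWithin_le_nhds
      · exact mul_pos (by norm_num) (mem_Ioi.1 hr)
    have h2 := (hX.tendsto_lintegral_ball hne hf.gfin).comp h1
    have h3 := (ENNReal.tendsto_toReal (ENNReal.zero_ne_top)).comp h2
    simpa [Function.comp_def] using h3
  have hrec : ∀ ρ, 0 < ρ → ρ ≤ R → (I ρ).toReal ≤ 1 / 4 * ρ * ω ρ + 1 / 16 * (I (4 * ρ)).toReal := by
    intro ρ hρ hρR
    have h1 := ENNReal.toReal_mono (by
      refine ENNReal.mul_ne_top ENNReal.ofReal_ne_top (ENNReal.add_ne_top.2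
        ⟨ENNReal.mul_ne_top (by norm_num) (hωt ρ), ENNReal.mul_ne_top ENNReal.ofReal_ne_top
          (hIt (4 * ρ))⟩)) (hdecay ρ hρ hρR)
    rw [ENNReal.toReal_mul, ENNReal.toReal_add (ENNReal.mul_ne_top (by norm_num) (hωt ρ))
      (ENNReal.mul_ne_top ENNReal.ofReal_ne_top (hIt (4 * ρ))), ENNReal.toReal_mul,
      ENNReal.toReal_mul, ENNReal.toReal_ofReal (by positivity),
      ENNReal.toReal_ofReal (by positivity)] at h1
    refine h1.trans (le_of_eq ?_)
    simp only [ENNReal.toReal_ofNat]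
    change 1 / 8 * ρ * (2 * ω ρ + 1 / (2 * ρ) * (I (4 * ρ)).toReal) = _
    field_simp
    ring
  have hzero : Tendsto (fun r => μ (ball x r ∩ {y | 1 ≤ p y}) / μ (ball x r)) (𝓝[>] 0) (𝓝 0) := by
    rw [ENNReal.tendsto_nhds_zero]
    intro ε hε
    obtain ⟨ε', hε'0, hε'⟩ := ENNReal.lt_iff_exists_real_btwn.1 hε
    have hε'p : 0 < ε' := by simpa using hε'.1
    obtain ⟨C, ρ₁, hρ₁, hb⟩ := exists_quadratic_bound (I := fun r => (I r).toReal) hR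
      (fun r => ENNReal.toReal_mono hPfin (hIP r)) ENNReal.toReal_nonneg hrec hω0
      (δ := ε' * F / 2) (by positivity)
    set ρ₂ := min (min ρ₁ (8 * R)) (ε' * F / (2 * (|C| + 1))) with hρ₂
    have hρ₂0 : 0 < ρ₂ := lt_min (lt_min hρ₁ (by linarith)) (by positivity)
    filter_upwards [Ioc_mem_nhdsGT hρ₂0] with ρ hρ
    have hρ0 := hρ.1
    have c1 : ρ ≤ ρ₁ := hρ.2.trans ((min_le_left _ _).trans (min_le_left _ _))
    have c2 : ρ ≤ 8 * R := hρ.2.trans ((min_le_left _ _).trans (min_le_right _ _))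
    have c3 : ρ ≤ ε' * F / (2 * (|C| + 1)) := hρ.2.trans (min_le_right _ _)
    rw [le_div_iff₀ (by positivity)] at c3
    have d1 : (I ρ).toReal ≤ ε' * (F * ρ) := by
      have e1 : C * ρ ≤ |C| * ρ := mul_le_mul_of_nonneg_right (le_abs_self C) hρ0.le
      have e2 : C * ρ ≤ ε' * F / 2 := by linarith
      have e3 : C * ρ ^ 2 ≤ ε' * F / 2 * ρ := by
        rw [pow_two, ← mul_assoc]
        exact mul_le_mul_of_nonneg_right e2 hρ0.le
      linarith [hb ρ hρ0 c1]
    have d2 : I ρ ≤ ENNReal.ofReal ε' * μ (ball x ρ) := by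
      rw [← ENNReal.ofReal_toReal (hIt ρ)]
      refine (ENNReal.ofReal_le_ofReal d1).trans ?_
      rw [ENNReal.ofReal_mul hε'p.le]
      exact mul_le_mul_right (hgrow ρ hρ0 c2) _
    refine ENNReal.div_le_of_le_mul (le_trans ?_ (d2.trans (mul_le_mul_left hε'.2.le _)))
    have d3 := mul_meas_ge_le_lintegral (μ := μ.restrict (ball x ρ)) hpm.ennreal_ofReal 1
    rw [one_mul, Measure.restrict_apply (measurableSet_le measurable_const hpm.ennreal_ofReal)] at d3
    refine le_trans (measure_mono ?_) d3
    rintro y ⟨hy, hy1⟩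
    exact ⟨by simpa using ENNReal.ofReal_le_ofReal hy1, hy⟩
  have hmem : Tendsto (fun r : ℝ => μ ({y | T + 1 < u y} ∩ ball x r) / μ (ball x r))
      (𝓝[>] 0) (𝓝 0) := by
    have hsum := hdens.add hzero
    rw [add_zero] at hsum
    refine tendsto_of_tendsto_of_tendsto_of_le_of_le tendsto_const_nhds hsum (fun _ => zero_le)
      fun r => ?_
    beta_reduce
    rw [← ENNReal.add_div]
    refine ENNReal.div_le_div_right ((measure_mono ?_).trans (measure_union_le _ _)) _
    rintro y ⟨hy, hyr⟩
    have hy : T + 1 < u y := hy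
    rcases lt_or_ge 0 (f y) with h1 | h1
    · exact Or.inl ⟨h1, hyr⟩
    · refine Or.inr ⟨hyr, ?_⟩
      have h2 : max (f y) T = T := max_eq_right (h1.trans hT)
      have : 1 ≤ u y - max (f y) T := by rw [h2]; linarith
      exact this.trans (le_max_left _ _)
  exact (sInf_le (mem_image_of_mem _ hmem)).trans_lt (EReal.coe_lt_top _)

end UpperLimit

section Obstacle

variable {μ : Measure X} {Cd CP lam : ℝ}

/-- At arbitrarily small scales the ratio `μ(B(x,ρ))/ρ` is almost minimal among smaller radii. -/
lemma MMS.exists_radius [BorelSpace X] (hX : MMS μ Cd CP lam) {x : X} {F r₀ : ℝ} (hF : 0 < F)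
    (hr₀ : 0 < r₀) (hgrow : ∀ ρ : ℝ, 0 < ρ → ρ ≤ r₀ → ENNReal.ofReal (F * ρ) ≤ μ (ball x ρ)) :
    ∃ r K : ℝ, 0 < r ∧ r ≤ r₀ ∧ 0 < K ∧ μ (ball x r) = ENNReal.ofReal (32 * r * K) ∧
      ∀ ρ : ℝ, 0 < ρ → ρ ≤ 16 * r → ENNReal.ofReal (K * ρ) ≤ μ (ball x ρ) := by
  have hfin : ∀ ρ, μ (ball x ρ) ≠ ∞ := fun ρ => (hX.ball_lt_top x ρ).ne
  set S : Set ℝ := (fun ρ => (μ (ball x ρ)).toReal / ρ) '' Ioc 0 r₀ with hS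
  have hSF : ∀ s ∈ S, F ≤ s := by
    rintro _ ⟨ρ, ⟨h0, h1⟩, rfl⟩
    rw [le_div_iff₀ h0]
    exact (ENNReal.ofReal_le_iff_le_toReal (hfin ρ)).1 (hgrow ρ h0 h1)
  have hne : S.Nonempty := ⟨_, r₀, ⟨hr₀, le_rfl⟩, rfl⟩
  have hbdd : BddBelow S := ⟨F, hSF⟩
  have hFS : F ≤ sInf S := le_csInf hne hSF
  obtain ⟨_, ⟨r, ⟨hr, hrr⟩, rfl⟩, hlt⟩ := exists_lt_of_csInf_lt hne
    (show sInf S < 2 * sInf S by linarith)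
  have hK : 0 < (μ (ball x r)).toReal := ENNReal.toReal_pos (hX.ball_pos x hr).ne' (hfin r)
  refine ⟨r, (μ (ball x r)).toReal / (32 * r), hr, hrr, by positivity, ?_, fun ρ h0 h1 => ?_⟩
  · rw [mul_div_cancel₀ _ (by positivity), ENNReal.ofReal_toReal (hfin r)]
  · have h2 : sInf S ≤ (μ (ball x (ρ / 16))).toReal / (ρ / 16) :=
      csInf_le hbdd ⟨ρ / 16, ⟨by positivity, by linarith⟩, rfl⟩
    refine le_trans ?_ (measure_mono (ball_subset_ball (by linarith : ρ / 16 ≤ ρ)))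
    rw [ENNReal.ofReal_le_iff_le_toReal (hfin _)]
    have h3 : (μ (ball x r)).toReal / r ≤ 2 * ((μ (ball x (ρ / 16))).toReal / (ρ / 16)) := by
      simp only at hlt
      linarith
    have h4 := (le_div_iff₀ (by positivity : 0 < ρ / 16)).1
      (by linarith : (μ (ball x r)).toReal / r / 2 ≤ (μ (ball x (ρ / 16))).toReal / (ρ / 16))
    refine le_trans (le_of_eq ?_) h4
    field_simp
    norm_num

/-- The variational capacity can be tested with lower semicontinuous functions. -/
lemma MMS.exists_adm_of_vcap1_lt [BorelSpace X] (hX : MMS μ Cd CP lam) {x : X} {r : ℝ} {E : Set X}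
    {κ : ℝ≥0∞} (hκ : κ ≠ ∞) (h : vcap1 μ E (ball x r) < κ) :
    ∃ (v : X → ℝ) (G : X → ℝ≥0∞), Adm μ x r v G ∧ (∀ y ∈ E, 1 ≤ v y) ∧ (∀ t, IsOpen {y | t < v y}) ∧
      ∫⁻ y, G y ∂μ ≤ κ := by
  simp only [vcap1, iInf_lt_iff] at h
  obtain ⟨u, hu, huE, huz, g, hg, hgu, hgκ⟩ := h
  have hwg : WGrad μ g u := hgu.wgrad hg (hgκ.trans_le le_top).ne
  have hlip : LipschitzWith 1 fun t : ℝ => max 0 (min t 1) :=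
    (LipschitzWith.id.min_const 1).const_max 0
  have hv : WGrad μ g fun y => max 0 (min (u y) 1) :=
    (hwg.comp_lipschitz hlip).mono fun y => by simp
  obtain ⟨G, w, hG, hgG, hGε, hwl, hmono, hw0, hwM, hwz, hUG, -, hle⟩ :=
    hX.exists_monotone_lipschitz isOpen_ball (hX.ball_lt_top x r).ne
      (hlip.continuous.measurable.comp_aemeasurable hu.1.aemeasurable)
      (fun y => le_max_left _ _) (M := 1) (fun y => max_le zero_le_one (min_le_right _ _))
      (fun y hy => by simp [huz y hy]) hg hv (tsub_pos_of_lt hgκ).ne'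
  have hGκ : ∫⁻ y, G y ∂μ ≤ κ := hGε.trans (add_tsub_cancel_of_le hgκ.le).le
  have hGfin : ∫⁻ y, G y ∂μ ≠ ∞ := (hGκ.trans_lt hκ.lt_top).ne
  have hbdd : ∀ y, BddAbove (range fun n => w n y) := fun y =>
    ⟨1, by rintro _ ⟨n, rfl⟩; exact hwM n y⟩
  have hlim : ∀ y, Tendsto (fun n => w n y) atTop (𝓝 (⨆ n, w n y)) := fun y =>
    tendsto_atTop_ciSup (hmono y) (hbdd y)
  have hsm : Measurable fun y => ⨆ n, w n y := measurable_of_tendsto_metrizable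
    (fun n => (hwl n).choose_spec.continuous.measurable) (tendsto_pi_nhds.2 hlim)
  have hs0 : ∀ y, 0 ≤ ⨆ n, w n y := fun y => (hw0 0 y).trans (le_ciSup (hbdd y) 0)
  have hsz : ∀ y, y ∉ ball x r → ⨆ n, w n y = 0 := fun y hy => by simp [hwz _ y hy]
  have hsUG : IsUpperGradientOn G (fun y => ⨆ n, w n y) univ := fun γ hγ => by
    refine le_of_tendsto (ENNReal.tendsto_ofReal ((hlim _).sub (hlim _)).abs)
      (Eventually.of_forall fun n => hUG n γ hγ)
  refine ⟨fun y => ⨆ n, w n y, G, ⟨hsm, hs0, hsz, hX.integrable_of_le hsm hs0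
    (fun y => ciSup_le fun n => hwM n y) hsz, hG, hGfin, hsUG.wgrad hG hGfin⟩, fun y hy => ?_,
    fun t => ?_, hGκ⟩
  · refine le_trans ?_ (hle y)
    simp [huE y hy]
  · have : {y | t < ⨆ n, w n y} = ⋃ n, {y | t < w n y} := by
      ext y
      simp [lt_ciSup_iff (hbdd y)]
    rw [this]
    exact isOpen_iUnion fun n => isOpen_lt continuous_const (hwl n).choose_spec.continuous

/-- Countable sums of nonnegative functions have the sum of the upper gradients as upper
gradient. -/
lemma IsUpperGradientOn.tsum [BorelSpace X] {v : ℕ → X → ℝ} {g : ℕ → X → ℝ≥0∞} {V : Set X}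
    (hv : ∀ i y, 0 ≤ v i y) (hg : ∀ i, Measurable (g i)) (h : ∀ i, IsUpperGradientOn (g i) (v i) V) :
    IsUpperGradientOn (fun y => ∑' i, g i y) (fun y => (∑' i, ENNReal.ofReal (v i y)).toReal) V := by
  intro γ hγ
  rw [curveIntegral_tsum hg]
  beta_reduce
  have hstep : ∀ a b : ℕ → ℝ, ∀ c : ℕ → ℝ≥0∞, (∀ i, 0 ≤ b i) →
      (∀ i, ENNReal.ofReal |a i - b i| ≤ c i) →
      ∑' i, ENNReal.ofReal (a i) ≤ ∑' i, ENNReal.ofReal (b i) + ∑' i, c i := fun a b c hb hab => by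
    rw [← ENNReal.tsum_add]
    refine ENNReal.tsum_le_tsum fun i => le_trans ?_ (add_le_add_right (hab i) _)
    rw [← ENNReal.ofReal_add (hb i) (abs_nonneg _)]
    exact ENNReal.ofReal_le_ofReal (by linarith [le_abs_self (a i - b i)])
  have h1 := hstep (fun i => v i (γ.toFun 1)) (fun i => v i (γ.toFun 0))
    (fun i => curveIntegral (g i) γ) (fun i => hv i _) fun i => h i γ hγ
  have h2 := hstep (fun i => v i (γ.toFun 0)) (fun i => v i (γ.toFun 1))
    (fun i => curveIntegral (g i) γ) (fun i => hv i _)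
    fun i => by simpa only [abs_sub_comm] using h i γ hγ
  revert h1 h2
  generalize ∑' i, ENNReal.ofReal (v i (γ.toFun 1)) = a
  generalize ∑' i, ENNReal.ofReal (v i (γ.toFun 0)) = b
  generalize ∑' i, curveIntegral (g i) γ = c
  intro h1 h2
  by_cases hc : c = ∞
  · simp [hc]
  by_cases ha : a = ∞
  · have hb : b = ∞ := by
      by_contra hb
      rw [ha, top_le_iff, ENNReal.add_eq_top] at h1
      tauto
    simp [ha, hb]
  · have hb : b ≠ ∞ := (h2.trans_lt (ENNReal.add_lt_top.2 ⟨lt_top_iff_ne_top.2 ha,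
      lt_top_iff_ne_top.2 hc⟩)).ne
    rw [ENNReal.ofReal_le_iff_le_toReal hc, abs_le]
    have h1' := ENNReal.toReal_mono (ENNReal.add_ne_top.2 ⟨hb, hc⟩) h1
    have h2' := ENNReal.toReal_mono (ENNReal.add_ne_top.2 ⟨ha, hc⟩) h2
    rw [ENNReal.toReal_add hb hc] at h1'
    rw [ENNReal.toReal_add ha hc] at h2'
    constructor <;> linarith

/-- A function with small energy can be sharpened to one that vanishes near `x` in the sense of
density and still equals `1` on a superlevel set. -/
lemma MMS.exists_sharpening [BorelSpace X] (hX : MMS μ Cd CP lam) {x y₀ : X} {r : ℝ} (hr : 0 < r)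
    (hy₀ : 4 * r ≤ dist y₀ x) {K : ℝ} (hK : 0 < K)
    (hgrow : ∀ ρ : ℝ, 0 < ρ → ρ ≤ 8 * r → ENNReal.ofReal (K * ρ) ≤ μ (ball x ρ))
    {v : X → ℝ} {g : X → ℝ≥0∞} (h : Adm μ x r v g) {κ : ℝ} (hκ0 : 0 < κ)
    (hκ : ∫⁻ y, g y ∂μ ≤ ENNReal.ofReal κ) (hsmall : 8 * CP * Cd ^ 4 * κ < 1 / 2 * K) :
    ∃ (p : X → ℝ) (G : X → ℝ≥0∞), Adm μ x r p G ∧ (∀ y, p y ≤ 1) ∧ (∀ y, 3 / 4 < v y → p y = 1) ∧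
      Tendsto (fun ρ => (∫⁻ y in ball x ρ, ENNReal.ofReal (p y) ∂μ) / ENNReal.ofReal ρ)
        (𝓝[>] 0) (𝓝 0) ∧
      Tendsto (fun ρ => μ ({y | 0 < p y} ∩ ball x ρ) / μ (ball x ρ)) (𝓝[>] 0) (𝓝 0) := by
  have hCP := hX.hCP
  have hyx : y₀ ≠ x := fun h => by rw [h, dist_self] at hy₀; linarith
  set ζ : ℝ → ℝ := fun t => max 0 (min (4 * (t - 1 / 2)) 1) with hζ
  set ξ : ℝ → ℝ := fun t => max 0 (2 * t - 1) with hξ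
  have hζl : LipschitzWith 4 ζ := by
    refine (LipschitzWith.min_const ?_ 1).const_max 0
    refine LipschitzWith.of_dist_le_mul fun s t => le_of_eq ?_
    rw [Real.dist_eq, Real.dist_eq, ← mul_sub, abs_mul, sub_sub_sub_cancel_right]
    norm_num
  have hξl : LipschitzWith 2 ξ := by
    refine LipschitzWith.const_max ?_ 0
    refine LipschitzWith.of_dist_le_mul fun s t => le_of_eq ?_
    rw [Real.dist_eq, Real.dist_eq, sub_sub_sub_cancel_right, ← mul_sub, abs_mul]
    norm_num
  set w : X → ℝ := fun y => ζ (v y) with hw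
  have hw0 : ∀ y, 0 ≤ w y := fun y => le_max_left _ _
  have hw1 : ∀ y, w y ≤ 1 := fun y => max_le zero_le_one (min_le_right _ _)
  have hwz : ∀ y, y ∉ ball x r → w y = 0 := fun y hy => by
    simp only [hw, hζ, h.zero y hy]
    norm_num
  have hwm : Measurable w := hζl.continuous.measurable.comp h.meas
  have hwint := hX.integrable_of_le hwm hw0 hw1 hwz
  have hwg : WGrad μ (fun y => 4 * g y) w := h.wgrad.comp_lipschitz hζl
  set p : X → ℝ := fun y => ξ (w y) with hp
  have hpw : ∀ y, p y ≤ w y := fun y => max_le (hw0 y) (by linarith [hw1 y])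
  have hp0 : ∀ y, 0 ≤ p y := fun y => le_max_left _ _
  have hp1 : ∀ y, p y ≤ 1 := fun y => (hpw y).trans (hw1 y)
  have hpz : ∀ y, y ∉ ball x r → p y = 0 := fun y hy =>
    le_antisymm ((hpw y).trans (hwz y hy).le) (hp0 y)
  have hpm : Measurable p := hξl.continuous.measurable.comp hwm
  have hpos : ∀ y, 0 < p y → 1 / 2 ≤ w y := fun y hy => by
    by_contra hlt
    push Not at hlt
    have : p y = 0 := max_eq_left (by linarith)
    linarith
  have hmean : ∀ ρ : ℝ, 0 < ρ → ρ ≤ 4 * r →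
      (∫⁻ y in ball x ρ, ENNReal.ofReal (w y) ∂μ) / ENNReal.ofReal ρ ≤
        ENNReal.ofReal (8 * CP) * ∫⁻ y in ball x (lam * ρ), g y ∂μ := fun ρ hρ hρr => by
    have hd := hX.density_level hr hy₀ hK hgrow h (T := 1 / 2) (by norm_num) hκ0 hκ hsmall hρ hρr
    have hc : ENNReal.ofReal (1 / 2) * μ (ball x ρ) ≤ μ (ball x ρ ∩ {y | w y = 0}) := by
      have hle : 4 * CP * κ / (1 / 2 * K) ≤ 1 / 2 := by
        rw [div_le_iff₀ (by positivity)]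
        have : 1 ≤ Cd ^ 4 := one_le_pow₀ hX.hCd
        nlinarith [mul_pos hCP hκ0]
      have h1 : μ (ball x ρ) ≤ ENNReal.ofReal (1 / 2) * μ (ball x ρ) +
          μ (ball x ρ ∩ {y | w y = 0}) := by
        calc μ (ball x ρ) ≤ μ (ball x ρ ∩ {y | 1 / 2 ≤ v y}) + μ (ball x ρ ∩ {y | w y = 0}) := by
              refine (measure_mono fun y hy => ?_).trans (measure_union_le _ _)
              by_cases hvy : 1 / 2 ≤ v y
              · exact Or.inl ⟨hy, hvy⟩
              · refine Or.inr ⟨hy, ?_⟩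
                push Not at hvy
                exact max_eq_left ((min_le_left _ _).trans (by linarith))
          _ ≤ _ := by
              gcongr
              exact hd.trans (mul_le_mul_left (ENNReal.ofReal_le_ofReal hle) _)
      have h2 : μ (ball x ρ) = ENNReal.ofReal (1 / 2) * μ (ball x ρ) +
          ENNReal.ofReal (1 / 2) * μ (ball x ρ) := by
        rw [← add_mul, ← ENNReal.ofReal_add (by norm_num) (by norm_num)]
        norm_num
      have hne : ENNReal.ofReal (1 / 2) * μ (ball x ρ) ≠ ∞ :=
        ENNReal.mul_ne_top ENNReal.ofReal_ne_top (hX.ball_lt_top x ρ).ne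
      exact (ENNReal.add_le_add_iff_left hne).1 (h2 ▸ h1)
    have hP := hX.poincare_zero x hρ hwint hwm hw0 (h.gmeas.const_mul 4) hwg hc
    rw [lintegral_const_mul _ h.gmeas] at hP
    refine ENNReal.div_le_of_le_mul ?_
    calc ∫⁻ y in ball x ρ, ENNReal.ofReal (w y) ∂μ
        = 2 * (ENNReal.ofReal (1 / 2) * ∫⁻ y in ball x ρ, ENNReal.ofReal (w y) ∂μ) := by
          rw [← mul_assoc, ← ENNReal.ofReal_ofNat 2, ← ENNReal.ofReal_mul (by norm_num)]
          norm_num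
      _ ≤ 2 * (ENNReal.ofReal (CP * ρ) * (4 * ∫⁻ y in ball x (lam * ρ), g y ∂μ)) := by gcongr
      _ = _ := by
          rw [ENNReal.ofReal_mul hCP.le, ENNReal.ofReal_mul (by norm_num), ENNReal.ofReal_ofNat]
          ring
  have hIoc : Ioc (0 : ℝ) (4 * r) ∈ 𝓝[>] (0 : ℝ) := Ioc_mem_nhdsGT (by positivity)
  have htend : Tendsto (fun ρ => (∫⁻ y in ball x ρ, ENNReal.ofReal (w y) ∂μ) / ENNReal.ofReal ρ)
      (𝓝[>] 0) (𝓝 0) := by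
    have hlam : Tendsto (fun ρ : ℝ => lam * ρ) (𝓝[>] 0) (𝓝[>] 0) := by
      refine tendsto_nhdsWithin_iff.2 ⟨?_, ?_⟩
      · have : Tendsto (fun ρ : ℝ => lam * ρ) (𝓝 0) (𝓝 (lam * 0)) :=
          (continuous_const.mul continuous_id).tendsto 0
        rw [mul_zero] at this
        exact this.mono_left nhdsWithin_le_nhds
      · filter_upwards [self_mem_nhdsWithin] with ρ hρ
        exact mul_pos (zero_lt_one.trans_le hX.hlam) hρ
    have h0 := ENNReal.Tendsto.const_mul (a := ENNReal.ofReal (8 * CP))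
      ((hX.tendsto_lintegral_ball hyx h.gfin).comp hlam) (Or.inr ENNReal.ofReal_ne_top)
    rw [mul_zero] at h0
    refine tendsto_of_tendsto_of_tendsto_of_le_of_le' tendsto_const_nhds h0
      (Eventually.of_forall fun ρ => zero_le) ?_
    filter_upwards [hIoc] with ρ hρ
    exact hmean ρ hρ.1 hρ.2
  refine ⟨p, fun y => 2 * (4 * g y), ⟨hpm, hp0, hpz, hX.integrable_of_le hpm hp0 hp1 hpz,
    (h.gmeas.const_mul 4).const_mul 2, ?_, hwg.comp_lipschitz hξl⟩, hp1, fun y hy => ?_, ?_, ?_⟩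
  · rw [lintegral_const_mul _ (h.gmeas.const_mul 4), lintegral_const_mul _ h.gmeas]
    exact ENNReal.mul_ne_top (by simp) (ENNReal.mul_ne_top (by simp) h.gfin)
  · have hwy : w y = 1 := by
      simp only [hw, hζ]
      rw [min_eq_right (by linarith)]
      norm_num
    simp only [hp, hξ, hwy]
    norm_num
  · refine tendsto_of_tendsto_of_tendsto_of_le_of_le tendsto_const_nhds htend
      (fun ρ => zero_le) fun ρ => ?_
    exact ENNReal.div_le_div_right
      (lintegral_mono fun y => ENNReal.ofReal_le_ofReal (hpw y)) _
  · have h0 := ENNReal.Tendsto.const_mul (a := 2 / ENNReal.ofReal K) htend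
      (Or.inr (ENNReal.div_ne_top (by simp) (by simpa using hK)))
    rw [mul_zero] at h0
    refine tendsto_of_tendsto_of_tendsto_of_le_of_le' tendsto_const_nhds h0
      (Eventually.of_forall fun ρ => zero_le) ?_
    filter_upwards [hIoc] with ρ hρ
    have hcheb : ENNReal.ofReal (1 / 2) * μ ({y | 0 < p y} ∩ ball x ρ) ≤
        ∫⁻ y in ball x ρ, ENNReal.ofReal (w y) ∂μ := by
      refine le_trans ?_ (mul_meas_ge_le_lintegral hwm.ennreal_ofReal (ENNReal.ofReal (1 / 2)))
      refine mul_le_mul_right ?_ _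
      rw [Measure.restrict_apply (measurableSet_le measurable_const hwm.ennreal_ofReal)]
      exact measure_mono fun y hy => ⟨ENNReal.ofReal_le_ofReal (hpos y hy.1), hy.2⟩
    calc μ ({y | 0 < p y} ∩ ball x ρ) / μ (ball x ρ)
        ≤ (2 * ∫⁻ y in ball x ρ, ENNReal.ofReal (w y) ∂μ) / ENNReal.ofReal (K * ρ) := by
          refine ENNReal.div_le_div ?_ (hgrow ρ hρ.1 (by linarith [hρ.2]))
          calc μ ({y | 0 < p y} ∩ ball x ρ)
              = 2 * (ENNReal.ofReal (1 / 2) * μ ({y | 0 < p y} ∩ ball x ρ)) := by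
                rw [← mul_assoc, ← ENNReal.ofReal_ofNat 2, ← ENNReal.ofReal_mul (by norm_num)]
                norm_num
            _ ≤ _ := by gcongr
      _ = _ := by
          rw [ENNReal.ofReal_mul hK.le, div_eq_mul_inv, div_eq_mul_inv, div_eq_mul_inv,
            ENNReal.mul_inv (Or.inl (by simpa using hK)) (Or.inl ENNReal.ofReal_ne_top)]
          ring

end Obstacle

section Stacking

variable {μ : Measure X} {Cd CP lam : ℝ}

/-- Localization of an admissible function to a ball by a cutoff. -/
lemma Adm.exists_localization [BorelSpace X] {x : X} {r : ℝ} {p : X → ℝ} {g : X → ℝ≥0∞}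
    (h : Adm μ x r p g) {ρ : ℝ} (hρ : 0 < ρ) {ε : ℝ≥0∞} (hε : ε ≠ 0)
    (hgε : ∫⁻ y in ball x ρ, g y ∂μ ≤ ε)
    (hpε : (∫⁻ y in ball x ρ, ENNReal.ofReal (p y) ∂μ) / ENNReal.ofReal ρ ≤ ε) :
    ∃ (v : X → ℝ) (G : X → ℝ≥0∞), Measurable v ∧ (∀ y, 0 ≤ v y) ∧ (∀ y, v y ≤ p y) ∧
      (∀ y, ρ ≤ dist y x → v y = 0) ∧ (∀ y, dist y x ≤ ρ / 2 → v y = p y) ∧ Measurable G ∧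
      IsUpperGradientOn G v univ ∧ ∫⁻ y, G y ∂μ ≤ 4 * ε ∧
      ∫⁻ y, ENNReal.ofReal (v y) ∂μ ≤ ENNReal.ofReal ρ * ε := by
  obtain ⟨η, hηl, hη0, hη1, hη, hηz⟩ := exists_cutoff x (half_lt_self hρ)
  set L := (1 / (ρ - ρ / 2)).toNNReal with hL
  have hz : WGrad μ (fun _ => 0) fun _ : X => (0 : ℝ) :=
    wgrad_of_lipschitz (LipschitzWith.const' (K := 0) 0)
  set G₀ : X → ℝ≥0∞ := (ball x ρ).indicator fun y => g y + L * ENNReal.ofReal (p y) with hG₀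
  have hpm := h.meas.ennreal_ofReal
  have hG₀m : Measurable G₀ := (h.gmeas.add (hpm.const_mul _)).indicator measurableSet_ball
  have hv : WGrad μ G₀ fun y => η y * p y := by
    have h1 := (h.wgrad.convexCombination hz hηl hη0 hη1).mono (g' := G₀) fun y => by
      by_cases hy : y ∈ ball x ρ
      · simp only [hG₀, indicator_of_mem hy, mul_zero, add_zero, sub_zero]
        refine add_le_add ?_ ((indicator_le_self _ _ y).trans (by rw [abs_of_nonneg (h.nonneg y)]))
        exact mul_le_of_le_one_left zero_le (ENNReal.ofReal_le_one.2 (hη1 y))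
      · have : η y = 0 := hηz y (not_lt.1 hy)
        simp [this]
    simpa using h1
  have hLρ : (L : ℝ≥0∞) = 2 * (ENNReal.ofReal ρ)⁻¹ := by
    have h2 : 1 / (ρ - ρ / 2) = 2 * ρ⁻¹ := by field_simp; norm_num
    rw [hL, h2, ← ENNReal.ofReal_inv_of_pos hρ, ← ENNReal.ofReal_ofNat 2,
      ← ENNReal.ofReal_mul (by norm_num)]
    rfl
  have hG₀ε : ∫⁻ y, G₀ y ∂μ ≤ 3 * ε := by
    rw [lintegral_indicator measurableSet_ball, lintegral_add_left h.gmeas,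
      lintegral_const_mul _ hpm, hLρ]
    calc _ = ∫⁻ y in ball x ρ, g y ∂μ +
          2 * ((∫⁻ y in ball x ρ, ENNReal.ofReal (p y) ∂μ) / ENNReal.ofReal ρ) := by
          rw [div_eq_mul_inv]; ring
      _ ≤ ε + 2 * ε := by gcongr
      _ = 3 * ε := by ring
  obtain ⟨τ, hτ, hτε, hUG⟩ := hv.exists_isUpperGradientOn hG₀m hε
  have hle : ∀ y, η y * p y ≤ p y := fun y => mul_le_of_le_one_left (h.nonneg y) (hη1 y)
  refine ⟨fun y => η y * p y, fun y => G₀ y + τ y, hηl.continuous.measurable.mul h.meas,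
    fun y => mul_nonneg (hη0 y) (h.nonneg y), hle, fun y hy => by simp [hηz y hy],
    fun y hy => by simp [hη y hy], hG₀m.add hτ, hUG, ?_, ?_⟩
  · rw [lintegral_add_left hG₀m]
    calc _ ≤ 3 * ε + ε := add_le_add hG₀ε hτε
      _ = 4 * ε := by ring
  · have h3 : ∫⁻ y, ENNReal.ofReal (η y * p y) ∂μ ≤
        ∫⁻ y in ball x ρ, ENNReal.ofReal (p y) ∂μ := by
      rw [← lintegral_indicator measurableSet_ball]
      refine lintegral_mono fun y => ?_
      by_cases hy : y ∈ ball x ρ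
      · rw [indicator_of_mem hy]
        exact ENNReal.ofReal_le_ofReal (hle y)
      · simp [hηz y (not_lt.1 hy)]
    refine h3.trans ?_
    rw [mul_comm]
    exact (ENNReal.div_le_iff (by simpa using hρ) ENNReal.ofReal_ne_top).1 hpε

/-- Summing localizations of a function at rapidly decreasing scales produces a function that
blows up at `x` along the set where the original function equals `1`. -/
lemma Adm.exists_blowup [BorelSpace X] {x : X} {r R : ℝ} (hR : 0 < R) {p : X → ℝ} {g : X → ℝ≥0∞}
    (h : Adm μ x r p g)
    (hg : Tendsto (fun ρ => ∫⁻ y in ball x ρ, g y ∂μ) (𝓝[>] 0) (𝓝 0))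
    (hp : Tendsto (fun ρ => (∫⁻ y in ball x ρ, ENNReal.ofReal (p y) ∂μ) / ENNReal.ofReal ρ)
      (𝓝[>] 0) (𝓝 0)) :
    ∃ (f : X → ℝ) (G : X → ℝ≥0∞), Adm μ x R f G ∧ (∀ y, 0 < f y → 0 < p y) ∧
      ∀ N : ℕ, ∀ᶠ z in 𝓝 x, z ≠ x → p z = 1 → (N : ℝ) ≤ f z := by
  set δ : ℕ → ℝ≥0∞ := fun i => (2 : ℝ≥0∞)⁻¹ ^ i with hδ
  have hδ0 : ∀ i, δ i ≠ 0 := fun i => pow_ne_zero _ (by simp)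
  have hδ2 : ∑' i, δ i = 2 := ENNReal.tsum_geometric_two
  have hscale : ∀ i : ℕ, ∃ ρ : ℝ, 0 < ρ ∧ ρ ≤ min (min R 1) (1 / ((i : ℝ) + 1)) ∧
      ∫⁻ y in ball x ρ, g y ∂μ ≤ δ i ∧
      (∫⁻ y in ball x ρ, ENNReal.ofReal (p y) ∂μ) / ENNReal.ofReal ρ ≤ δ i := fun i => by
    have hpos : 0 < min (min R 1) (1 / ((i : ℝ) + 1)) := by positivity
    have hev := (hg.eventually (ge_mem_nhds (hδ0 i).bot_lt)).and
      ((hp.eventually (ge_mem_nhds (hδ0 i).bot_lt)).and (Ioc_mem_nhdsGT hpos))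
    obtain ⟨ρ, h1, h2, h3⟩ := hev.exists
    exact ⟨ρ, h3.1, h3.2, h1, h2⟩
  choose ρ hρ0 hρle hρg hρp using hscale
  choose v G hvm hv0 hvp hvz hv1 hGm hGv hGε hvε using fun i =>
    h.exists_localization (hρ0 i) (hδ0 i) (hρg i) (hρp i)
  have hSm : Measurable fun y => ∑' i, ENNReal.ofReal (v i y) :=
    Measurable.tsum fun i => (hvm i).ennreal_ofReal
  have hGtm : Measurable fun y => ∑' i, G i y := Measurable.tsum hGm
  have hGfin : ∫⁻ y, ∑' i, G i y ∂μ ≠ ∞ := by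
    rw [lintegral_tsum fun i => (hGm i).aemeasurable]
    refine ((ENNReal.tsum_le_tsum hGε).trans_lt ?_).ne
    rw [ENNReal.tsum_mul_left, hδ2]
    exact ENNReal.mul_lt_top (by simp) (by simp)
  have hSfin : ∫⁻ y, ∑' i, ENNReal.ofReal (v i y) ∂μ ≠ ∞ := by
    rw [lintegral_tsum fun i => (hvm i).ennreal_ofReal.aemeasurable]
    have hle : ∀ i, ∫⁻ y, ENNReal.ofReal (v i y) ∂μ ≤ δ i := fun i => (hvε i).trans <|
      mul_le_of_le_one_left zero_le (ENNReal.ofReal_le_one.2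
        ((hρle i).trans ((min_le_left _ _).trans (min_le_right _ _))))
    refine ((ENNReal.tsum_le_tsum hle).trans_lt ?_).ne
    rw [hδ2]
    simp
  refine ⟨fun y => (∑' i, ENNReal.ofReal (v i y)).toReal, fun y => ∑' i, G i y,
    ⟨hSm.ennreal_toReal, fun y => ENNReal.toReal_nonneg, fun y hy => ?_,
      integrable_toReal_of_lintegral_ne_top hSm.aemeasurable hSfin, hGtm, hGfin,
      (IsUpperGradientOn.tsum hv0 hGm hGv).wgrad hGtm hGfin⟩, fun y hy => ?_, fun N => ?_⟩
  · have : ∀ i, v i y = 0 := fun i => hvz i y <|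
      ((hρle i).trans ((min_le_left _ _).trans (min_le_left _ _))).trans (not_lt.1 hy)
    simp [this]
  · by_contra hpy
    have : ∀ i, v i y = 0 := fun i => le_antisymm ((hvp i y).trans (not_lt.1 hpy)) (hv0 i y)
    simp [this] at hy
  · have hev : ∀ᶠ z in 𝓝 x, ∀ i ∈ Finset.range N, dist z x ≤ ρ i / 2 := by
      rw [Filter.eventually_all_finset]
      exact fun i _ => closedBall_mem_nhds x (half_pos (hρ0 i))
    filter_upwards [hev] with z hz hzx hpz
    have hfin : ∑' i, ENNReal.ofReal (v i z) ≠ ∞ := by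
      obtain ⟨n, hn⟩ := exists_nat_one_div_lt (dist_pos.2 hzx)
      rw [tsum_eq_sum (s := Finset.range n) fun i hi => by
        rw [hvz i z ((hρle i).trans ((min_le_right _ _).trans (le_trans ?_ hn.le)))]
        · simp
        · have : (n : ℝ) ≤ i := by exact_mod_cast not_lt.1 fun h => hi (Finset.mem_range.2 h)
          gcongr]
      exact ENNReal.sum_ne_top.2 fun i _ => ENNReal.ofReal_ne_top
    have hN : (N : ℝ≥0∞) ≤ ∑' i, ENNReal.ofReal (v i z) := by
      refine le_trans (le_of_eq ?_) (ENNReal.sum_le_tsum (Finset.range N))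
      rw [Finset.sum_congr rfl fun i hi => by rw [hv1 i z (hz i hi), hpz, ENNReal.ofReal_one]]
      simp
    simpa using ENNReal.toReal_mono hfin hN

/-- A set that is thin at a point of positive capacity carries an obstacle blowing up at the
point along the set, with positivity set of density zero there. -/
theorem MMS.exists_obstacle [BorelSpace X] (hX : MMS μ Cd CP lam) {x y₀ : X} {R : ℝ} (hR : 0 < R)
    (hy₀ : 4 * R ≤ dist y₀ x) {F : ℝ} (hF : 0 < F)
    (hgrow : ∀ ρ : ℝ, 0 < ρ → ρ ≤ 8 * R → ENNReal.ofReal (F * ρ) ≤ μ (ball x ρ))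
    {A : Set X} (hthin : IsThinAt μ A x) :
    ∃ (f : X → ℝ) (G : X → ℝ≥0∞), Adm μ x R f G ∧
      Tendsto (fun ρ => μ ({y | 0 < f y} ∩ ball x ρ) / μ (ball x ρ)) (𝓝[>] 0) (𝓝 0) ∧
      ∀ N : ℕ, ∃ U ∈ 𝓝 x, ∀ y ∈ A ∩ U, ∀ᶠ z in 𝓝 y, z ≠ x → (N : ℝ) ≤ f z := by
  have hCP := hX.hCP
  have hCd : 0 < Cd := zero_lt_one.trans_le hX.hCd
  have hyx : y₀ ≠ x := fun h => by rw [h, dist_self] at hy₀; linarith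
  set c : ℝ := 1 / (32 * CP * Cd ^ 4) with hc
  have hc0 : 0 < c := by positivity
  have hev := hthin.eventually (Iio_mem_nhds (show 0 < ENNReal.ofReal (c / 32) by simpa using hc0))
  obtain ⟨s, hs, hsub⟩ := mem_nhdsGT_iff_exists_Ioc_subset.1 hev
  obtain ⟨r, K, hr, hrs, hK, hμr, hKgrow⟩ := hX.exists_radius hF (r₀ := min s (R / 2))
    (lt_min hs (half_pos hR)) fun ρ h0 h1 => hgrow ρ h0 <| by
      linarith [h1.trans (min_le_right _ _)]
  have hrR : r ≤ R / 2 := hrs.trans (min_le_right _ _)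
  have hcap : vcap1 μ (A ∩ ball x r) (ball x (2 * r)) < ENNReal.ofReal (c * K) := by
    have h1 : ENNReal.ofReal r * vcap1 μ (A ∩ ball x r) (ball x (2 * r)) / μ (ball x r) <
        ENNReal.ofReal (c / 32) := hsub ⟨hr, hrs.trans (min_le_left _ _)⟩
    rw [hμr, ENNReal.div_lt_iff (Or.inl (by simp; positivity)) (Or.inl ENNReal.ofReal_ne_top),
      ← ENNReal.ofReal_mul (by positivity)] at h1
    by_contra hge
    refine absurd (mul_le_mul_right (not_lt.1 hge) (ENNReal.ofReal r)) (not_le.2 ?_)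
    rw [← ENNReal.ofReal_mul hr.le]
    convert h1 using 2
    ring
  obtain ⟨v, g, hv, hvA, hvo, hgκ⟩ := hX.exists_adm_of_vcap1_lt ENNReal.ofReal_ne_top hcap
  obtain ⟨p, g', hp, hp1, hpv, hpt, hpd⟩ := hX.exists_sharpening (by positivity : 0 < 2 * r)
    (by linarith) hK (fun ρ h0 h1 => hKgrow ρ h0 (by linarith)) hv (mul_pos hc0 hK) hgκ (by
      have : 8 * CP * Cd ^ 4 * (c * K) = 1 / 4 * K := by
        rw [hc]; field_simp; norm_num
      rw [this]
      linarith)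
  obtain ⟨f, G, hf, hfp, hfN⟩ := hp.exists_blowup hR (hX.tendsto_lintegral_ball hyx hp.gfin) hpt
  refine ⟨f, G, hf, ?_, fun N => ?_⟩
  · refine tendsto_of_tendsto_of_tendsto_of_le_of_le tendsto_const_nhds hpd
      (fun ρ => zero_le) fun ρ => ?_
    exact ENNReal.div_le_div_right
      (measure_mono (inter_subset_inter_left _ fun y hy => hfp y hy)) _
  · obtain ⟨U, hU, hUo, hxU⟩ := _root_.eventually_nhds_iff.1 (hfN N)
    refine ⟨U ∩ ball x r, inter_mem (hUo.mem_nhds hxU) (ball_mem_nhds x hr), fun y hy => ?_⟩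
    filter_upwards [hUo.mem_nhds hy.2.1, (hvo (3 / 4)).mem_nhds
      (show 3 / 4 < v y by linarith [hvA y ⟨hy.1, hy.2.2⟩])] with z hzU hz hzx
    exact hU z hzU hzx (hpv z hz)

end Stacking

lemma le_lowerApprox {μ : Measure X} {u : X → ℝ} {y : X} {t : ℝ}
    (h : ∃ V ∈ 𝓝 y, μ ({z | u z < t} ∩ V) = 0) : (t : EReal) ≤ lowerApprox μ u y := by
  obtain ⟨V, hV, h0⟩ := h
  obtain ⟨s, hs, hsV⟩ := Metric.mem_nhds_iff.1 hV
  refine le_sSup ⟨t, ?_, rfl⟩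
  refine tendsto_const_nhds.congr' ?_
  filter_upwards [Ioc_mem_nhdsGT hs] with ρ hρ
  rw [measure_mono_null (inter_subset_inter_right _ ((ball_subset_ball hρ.2).trans hsV)) h0,
    ENNReal.zero_div]

/-- **Strong Cartan property at points of positive capacity.** Suppose `cap₁({x}) > 0`, `A`
is 1-thin at `x` and `0 < R < (1/8) diam X`. Then there exists a 1-superminimizer `u` in
`B(x,R)` with `u^∧(y) → ∞` as `A ∋ y → x`, while `u^∨(x) < ∞`. -/
theorem strong_cartan_property
    {X : Type*} [MetricSpace X] [MeasurableSpace X] [BorelSpace X]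
    (μ : Measure X) (Cd CP lam : ℝ) (hX : MMS μ Cd CP lam)
    (x : X) (hx : 0 < cap1 μ {x}) (A : Set X) (hthin : IsThinAt μ A x)
    (R : ℝ) (hR : 0 < R)
    (hR' : ENNReal.ofReal R < EMetric.diam (Set.univ : Set X) / 8) :
    ∃ u : X → ℝ, IsSuperminimizer μ u (Metric.ball x R) ∧
      Filter.Tendsto (lowerApprox μ u) (𝓝[A] x) (𝓝 (⊤ : EReal)) ∧
      upperApprox μ u x < (⊤ : EReal) := by
  obtain ⟨y₀, hy₀⟩ := exists_le_dist_of_lt_diam hR'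
  have hyx : y₀ ≠ x := fun h => by rw [h, dist_self] at hy₀; linarith
  obtain ⟨F, hF, hgrow⟩ := hX.exists_growth hx (by positivity : 0 < 8 * R)
  obtain ⟨f, Gf, hf, hdens, hfN⟩ := hX.exists_obstacle hR hy₀ hF hgrow hthin
  obtain ⟨m, v, g, u, h, -⟩ := exists_minimizingSeq hX hR hy₀ hf
  refine ⟨u, h.isSuperminimizer hX hf.meas, EReal.tendsto_nhds_top_iff_real.2 fun t => ?_,
    h.upperApprox_lt_top hX hR hy₀ hF hgrow hf hdens⟩
  obtain ⟨N, hN⟩ := exists_nat_gt t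
  obtain ⟨U, hU, hUN⟩ := hfN N
  filter_upwards [inter_mem_nhdsWithin A hU] with y hy
  refine lt_of_lt_of_le (EReal.coe_lt_coe_iff.2 hN) (le_lowerApprox ⟨_, hUN y hy, ?_⟩)
  have hnull : μ ({z | f z ≤ u z}ᶜ ∪ {x}) = 0 :=
    measure_union_null (h.le_ae hf.meas) (hX.measure_singleton hyx)
  refine measure_mono_null (fun z hz => ?_) hnull
  by_cases hzx : z = x
  · exact Or.inr hzx
  · refine Or.inl fun hle => ?_
    have hz2 : (N : ℝ) ≤ f z := hz.2 hzx
    exact absurd hz.1 (not_lt.2 (hz2.trans hle))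

end MetricBV
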